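/- arXiv:1801.00927 — 2 statements merged into one kernel-verified Lean document; each statement's English description precedes it below -/
import Mathlib

section
/- Under the Setup, assume that either f'/f is a rational function or f(z) = B(1 − T(z)·e^{iAz}) with A real nonzero, B complex nonzero and T a rational function with |T(x)| = 1 for all real x, and assume that f, f', f'' and f''' have only real zeros. Then f is given by one of: (i) f(z) = (az+b)^μ; (ii) f(z) = (az+b)/(cz+d); (iii) f(z) = e^{az+b} − c, where a, b, c, d ∈ ℂ and μ ∈ ℤ. -/
open Complex Filter Topology MeasureTheory
open scoped Classical

noncomputable section

/-- `mtilde f` is the function `z ↦ conj (f (conj z))`, denoted `f̃` in the paper. -/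
def mtilde (f : ℂ → ℂ) : ℂ → ℂ := fun z => (starRingEnd ℂ) (f ((starRingEnd ℂ) z))

/-- Equality of meromorphic functions: near every point of `ℂ`, the two functions agree on a
punctured neighbourhood (so the set where they disagree is closed and discrete). -/
def MeroEq (h₁ h₂ : ℂ → ℂ) : Prop := ∀ z : ℂ, ∀ᶠ w in 𝓝[≠] z, h₁ w = h₂ w

/-- `f` is strictly non-real: `f̃` is not a constant multiple of `f`. -/
def StrictlyNonReal (f : ℂ → ℂ) : Prop := ¬ ∃ c : ℂ, MeroEq (mtilde f) (fun z => c * f z)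

/-- A rational function, as a meromorphic function on `ℂ`. -/
def IsRatFn (h : ℂ → ℂ) : Prop :=
  ∃ p q : Polynomial ℂ, q ≠ 0 ∧ MeroEq h (fun z => p.eval z / q.eval z)

/-- The order of vanishing (negative at a pole) of a function at a point, when the function is
meromorphic there; junk value `0` otherwise. -/
def meroOrder (h : ℂ → ℂ) (z : ℂ) : WithTop ℤ :=
  if hh : MeromorphicAt h z then meromorphicOrderAt h z else 0

/-- The positive part of the logarithm. -/
def logPlus (x : ℝ) : ℝ := max (Real.log x) 0

/-- The Nevanlinna proximity function `m(r, h)`. -/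
def proximity (h : ℂ → ℂ) (r : ℝ) : ℝ :=
  (2 * Real.pi)⁻¹ * ∫ θ in (0:ℝ)..(2 * Real.pi),
    logPlus ‖h ((r : ℂ) * Complex.exp (θ * Complex.I))‖

/-- The multiplicity of a pole of `h` at `z` (0 if not a pole). -/
def poleMult (h : ℂ → ℂ) (z : ℂ) : ℕ := (-((meroOrder h z).untopD 0)).toNat

/-- The number of poles, counted with multiplicity, in the closed disc of radius `t`. -/
def poleCount (h : ℂ → ℂ) (t : ℝ) : ℝ := ∑ᶠ z ∈ Metric.closedBall (0:ℂ) t, (poleMult h z : ℝ)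

/-- The integrated counting function `N(r, h)` of the poles of `h` (with multiplicity). -/
def NCount (h : ℂ → ℂ) (r : ℝ) : ℝ := ∫ t in (1:ℝ)..r, poleCount h t / t

/-- The Nevanlinna characteristic `T(r, h) = m(r, h) + N(r, h)`. -/
def TChar (h : ℂ → ℂ) (r : ℝ) : ℝ := proximity h r + NCount h r

/-- The number of points of `S` in the closed disc of radius `t`. -/
def distinctCount (S : Set ℂ) (t : ℝ) : ℝ := (S ∩ Metric.closedBall (0:ℂ) t).ncard

/-- The integrated counting function `N̄(r, h)` of the distinct poles of `h`. -/
def NbarPoles (h : ℂ → ℂ) (r : ℝ) : ℝ :=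
  ∫ t in (1:ℝ)..r, distinctCount {z | meroOrder h z < 0} t / t

/-- The integrated counting function `N̄(r, 1/h)` of the distinct zeros of `h`. -/
def NbarZeros (h : ℂ → ℂ) (r : ℝ) : ℝ :=
  ∫ t in (1:ℝ)..r, distinctCount {z | 0 < meroOrder h z} t / t

/-- `h` has finite (Nevanlinna) order: `T(r, h) ≤ r ^ C` for all large `r`. -/
def FiniteOrder (h : ℂ → ℂ) : Prop := ∃ C : ℝ, ∀ᶠ r in atTop, TChar h r ≤ r ^ C

/-- `h` has finite lower order: `T(r, h) ≤ r ^ C` for arbitrarily large `r`. -/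
def FiniteLowerOrder (h : ℂ → ℂ) : Prop := ∃ C : ℝ, ∃ᶠ r in atTop, TChar h r ≤ r ^ C

/-- The Setup of Section 3 of the paper: `M ≥ 4` and `f` is a strictly non-real meromorphic
function in the plane such that `f, f', …, f^(M+3)` all have finitely many non-real zeros. -/
def Setup (M : ℕ) (f : ℂ → ℂ) : Prop :=
  4 ≤ M ∧ (∀ z, MeromorphicAt f z) ∧ StrictlyNonReal f ∧
    ∀ m, m ≤ M + 3 → {z : ℂ | 0 < meroOrder (iteratedDeriv m f) z ∧ z.im ≠ 0}.Finite

/-- The function `F_m(z) = z - f^(m)(z) / f^(m+1)(z)`. -/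
def Fm (f : ℂ → ℂ) (m : ℕ) : ℂ → ℂ :=
  fun z => z - iteratedDeriv m f z / iteratedDeriv (m + 1) f z

/-- `Km` is the meromorphic function with finitely many zeros and poles satisfying
`F_m' = K_m G_m'`, where `G_m` is the analogue of `F_m` for `g = f̃`. -/
def IsKm (f : ℂ → ℂ) (m : ℕ) (Km : ℂ → ℂ) : Prop :=
  (∀ z, MeromorphicAt Km z) ∧ {z | 0 < meroOrder Km z}.Finite ∧
    {z | meroOrder Km z < 0}.Finite ∧
    MeroEq (deriv (Fm f m)) (fun z => Km z * deriv (Fm (mtilde f) m) z)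

end

/-! ### Basic facts on meromorphic functions in the plane -/

lemma ev_iff {P : ℂ → Prop} :
    (∀ᶠ z in codiscrete ℂ, P z) ↔ ∀ z, ∀ᶠ w in 𝓝[≠] z, P w := by
  rw [Filter.Eventually, mem_codiscrete]
  simp [disjoint_principal_right, Filter.Eventually]

lemma meroEq_iff {f g : ℂ → ℂ} : MeroEq f g ↔ ∀ᶠ z in codiscrete ℂ, f z = g z := ev_iff.symm

lemma ev_nhds {P : ℂ → Prop} (h : ∀ᶠ z in codiscrete ℂ, P z) :
    ∀ᶠ z in codiscrete ℂ, ∀ᶠ w in 𝓝 z, P w := by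
  have ho : IsOpen {z | P z} := (mem_codiscrete'.1 h).1
  filter_upwards [h] with z hz using ho.mem_nhds hz

lemma ev_deriv {f g : ℂ → ℂ} (h : ∀ᶠ z in codiscrete ℂ, f z = g z) :
    ∀ᶠ z in codiscrete ℂ, deriv f z = deriv g z := by
  filter_upwards [ev_nhds h] with z hz using Filter.EventuallyEq.deriv_eq hz

instance codiscrete_neBot : (codiscrete ℂ).NeBot := by
  refine ⟨fun h => ?_⟩
  have : ∀ᶠ z in codiscrete ℂ, False := by rw [h]; simp
  exact ((ev_iff.1 this) 0).exists.elim (fun _ h => h)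

lemma ev_analytic {F : ℂ → ℂ} (hF : Meromorphic F) :
    ∀ᶠ z in codiscrete ℂ, AnalyticAt ℂ F z :=
  ev_iff.2 fun z => (hF z).eventually_analyticAt

lemma ev_zero_of_local {F : ℂ → ℂ} (hF : Meromorphic F) {x : ℂ} (h : ∃ᶠ w in 𝓝[≠] x, F w = 0) :
    ∀ᶠ z in codiscrete ℂ, F z = 0 := by
  have h1 : meromorphicOrderAt F x = ⊤ := by
    by_contra hne
    exact h ((meromorphicOrderAt_ne_top_iff_eventually_ne_zero (hF x)).1 hne)
  refine ev_iff.2 fun z => meromorphicOrderAt_eq_top_iff.1 ?_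
  by_contra hne
  exact (MeromorphicOn.meromorphicOrderAt_ne_top_of_isPreconnected (U := Set.univ)
    (fun x _ => hF x) isPreconnected_univ (Set.mem_univ z) (Set.mem_univ x) hne) h1

lemma ev_zero_or_ne {F : ℂ → ℂ} (hF : Meromorphic F) :
    (∀ᶠ z in codiscrete ℂ, F z = 0) ∨ (∀ᶠ z in codiscrete ℂ, F z ≠ 0) := by
  by_cases h : ∃ x, ∃ᶠ w in 𝓝[≠] x, F w = 0
  · exact Or.inl (ev_zero_of_local hF h.choose_spec)
  · push Not at h
    exact Or.inr (ev_iff.2 h)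

lemma ev_const_of_deriv {F : ℂ → ℂ} (hF : Meromorphic F)
    (h : ∀ᶠ z in codiscrete ℂ, deriv F z = 0) : ∃ c, ∀ᶠ z in codiscrete ℂ, F z = c := by
  obtain ⟨x, hx1, hx2⟩ := ((ev_nhds (ev_analytic hF)).and (ev_nhds h)).exists
  refine ⟨F x, ?_⟩
  obtain ⟨r, hr, hb⟩ := Metric.eventually_nhds_iff_ball.1 (hx1.and hx2)
  have hF' : Meromorphic (fun z => F z - F x) := fun z => (hF z).sub (MeromorphicAt.const _ _)
  have := ev_zero_of_local hF' (x := x) ?_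
  · filter_upwards [this] with z hz using sub_eq_zero.1 hz
  · apply Filter.Eventually.frequently
    apply eventually_nhdsWithin_of_eventually_nhds
    filter_upwards [Metric.ball_mem_nhds x hr] with z hz
    have := Metric.isOpen_ball.is_const_of_deriv_eq_zero (𝕜 := ℂ) (f := F)
      (convex_ball x r).isPreconnected
      (fun y hy => (hb y hy).1.differentiableAt.differentiableWithinAt)
      (fun y hy => (hb y hy).2) hz (Metric.mem_ball_self hr)
    simp [this]

lemma meroOrder_eq {h : ℂ → ℂ} (hh : Meromorphic h) (z : ℂ) :
    meroOrder h z = meromorphicOrderAt h z := by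
  simp [meroOrder, hh z]

lemma order_ne_top {F : ℂ → ℂ} (hF : Meromorphic F) (h : ∀ᶠ z in codiscrete ℂ, F z ≠ 0) (z : ℂ) :
    meromorphicOrderAt F z ≠ ⊤ :=
  (meromorphicOrderAt_ne_top_iff_eventually_ne_zero (hF z)).2 (ev_iff.1 h z)

lemma ev_ne_of_real {F : ℂ → ℂ} (hF : Meromorphic F)
    (h : ∀ z : ℂ, 0 < meromorphicOrderAt F z → z.im = 0) : ∀ᶠ z in codiscrete ℂ, F z ≠ 0 := by
  refine (ev_zero_or_ne hF).resolve_left fun h0 => ?_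
  have h1 : meromorphicOrderAt F I = ⊤ := meromorphicOrderAt_eq_top_iff.2 (ev_iff.1 h0 I)
  have := h I (by simp [h1])
  simp at this

lemma order_congr {F G : ℂ → ℂ} (h : ∀ᶠ z in codiscrete ℂ, F z = G z) (z : ℂ) :
    meromorphicOrderAt F z = meromorphicOrderAt G z :=
  meromorphicOrderAt_congr (ev_iff.1 h z)

lemma mero_congr {F G : ℂ → ℂ} (hG : Meromorphic G) (h : ∀ᶠ z in codiscrete ℂ, F z = G z) :
    Meromorphic F := fun z =>
  (hG z).congr (by filter_upwards [ev_iff.1 h z] with w hw using hw.symm)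

lemma ev_conj {P : ℂ → Prop} (h : ∀ᶠ z in codiscrete ℂ, P z) :
    ∀ᶠ z in codiscrete ℂ, P ((starRingEnd ℂ) z) := by
  refine ev_iff.2 fun z => ?_
  have h1 := ev_iff.1 h ((starRingEnd ℂ) z)
  have : Tendsto (starRingEnd ℂ) (𝓝[≠] z) (𝓝[≠] ((starRingEnd ℂ) z)) := by
    refine tendsto_nhdsWithin_iff.2 ⟨(continuous_conj.tendsto z).mono_left nhdsWithin_le_nhds, ?_⟩
    filter_upwards [self_mem_nhdsWithin] with w hw
    intro h
    exact hw ((starRingEnd ℂ).injective h)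
  exact this.eventually h1

lemma mtilde_deriv (f : ℂ → ℂ) : deriv (mtilde f) = mtilde (deriv f) :=
  deriv_conj_conj (f := f)

lemma mtilde_mtilde (f : ℂ → ℂ) : mtilde (mtilde f) = f := by
  funext z; simp [mtilde]

lemma analyticAt_mtilde {f : ℂ → ℂ} {z : ℂ} (h : AnalyticAt ℂ f ((starRingEnd ℂ) z)) :
    AnalyticAt ℂ (mtilde f) z := by
  rw [Complex.analyticAt_iff_eventually_differentiableAt] at h ⊢
  filter_upwards [(continuous_conj.tendsto z).eventually h] with w hw
  have := hw.conj_conj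
  rwa [conj_conj] at this

lemma meromorphic_mtilde {f : ℂ → ℂ} (h : Meromorphic f) : Meromorphic (mtilde f) := by
  intro z
  obtain ⟨n, hn⟩ := h ((starRingEnd ℂ) z)
  refine ⟨n, ?_⟩
  have h1 := analyticAt_mtilde hn
  have h2 : mtilde (fun w => (w - (starRingEnd ℂ) z) ^ n • f w)
      = fun w => (w - z) ^ n • mtilde f w := by
    funext w
    simp [mtilde]
  rwa [h2] at h1

lemma ev_mtilde {f g : ℂ → ℂ} (h : ∀ᶠ z in codiscrete ℂ, f z = g z) :
    ∀ᶠ z in codiscrete ℂ, mtilde f z = mtilde g z := by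
  filter_upwards [ev_conj h] with z hz
  simp [mtilde, hz]

lemma ev_mtilde_ne {f : ℂ → ℂ} (h : ∀ᶠ z in codiscrete ℂ, f z ≠ 0) :
    ∀ᶠ z in codiscrete ℂ, mtilde f z ≠ 0 := by
  filter_upwards [ev_conj h] with z hz
  simpa [mtilde] using hz

lemma mero_poly (p : Polynomial ℂ) : Meromorphic (fun z => p.eval z) := fun z => by
  apply AnalyticAt.meromorphicAt
  exact (Differentiable.analyticAt (f := fun z => p.eval z) p.differentiable z)

lemma ev_poly_ne {p : Polynomial ℂ} (hp : p ≠ 0) : ∀ᶠ z in codiscrete ℂ, p.eval z ≠ 0 := by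
  have := (Set.Finite.compl_mem_codiscrete (p.roots.toFinset.finite_toSet))
  filter_upwards [this] with z hz h0
  apply hz
  simp [hp, h0]

lemma poly_eq_zero_of_ev {p : Polynomial ℂ} (h : ∀ᶠ z in codiscrete ℂ, p.eval z = 0) : p = 0 := by
  by_contra hp
  obtain ⟨z, h1, h2⟩ := (h.and (ev_poly_ne hp)).exists
  exact h2 h1

/-! ### Rational functions -/

lemma IsRatFn.congr {f g : ℂ → ℂ} (hg : IsRatFn g) (h : ∀ᶠ z in codiscrete ℂ, f z = g z) :
    IsRatFn f := by
  obtain ⟨p, q, hq, hpq⟩ := hg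
  refine ⟨p, q, hq, meroEq_iff.2 ?_⟩
  filter_upwards [h, meroEq_iff.1 hpq] with z h1 h2 using h1.trans h2

lemma IsRatFn.meromorphic {f : ℂ → ℂ} (hf : IsRatFn f) : Meromorphic f := by
  obtain ⟨p, q, hq, hpq⟩ := hf
  exact mero_congr (fun z => (mero_poly p z).fun_div (mero_poly q z)) (meroEq_iff.1 hpq)

lemma IsRatFn.poly (p : Polynomial ℂ) : IsRatFn (fun z => p.eval z) :=
  ⟨p, 1, one_ne_zero, meroEq_iff.2 (by simp)⟩

lemma IsRatFn.const (c : ℂ) : IsRatFn (fun _ => c) :=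
  (IsRatFn.poly (Polynomial.C c)).congr (by simp)

lemma IsRatFn.add {f g : ℂ → ℂ} (hf : IsRatFn f) (hg : IsRatFn g) :
    IsRatFn (fun z => f z + g z) := by
  obtain ⟨p, q, hq, hpq⟩ := hf
  obtain ⟨p', q', hq', hpq'⟩ := hg
  refine ⟨p * q' + q * p', q * q', mul_ne_zero hq hq', meroEq_iff.2 ?_⟩
  filter_upwards [meroEq_iff.1 hpq, meroEq_iff.1 hpq', ev_poly_ne hq, ev_poly_ne hq']
    with z h1 h2 h3 h4
  rw [h1, h2, div_add_div _ _ h3 h4]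
  simp

lemma IsRatFn.mul {f g : ℂ → ℂ} (hf : IsRatFn f) (hg : IsRatFn g) :
    IsRatFn (fun z => f z * g z) := by
  obtain ⟨p, q, hq, hpq⟩ := hf
  obtain ⟨p', q', hq', hpq'⟩ := hg
  refine ⟨p * p', q * q', mul_ne_zero hq hq', meroEq_iff.2 ?_⟩
  filter_upwards [meroEq_iff.1 hpq, meroEq_iff.1 hpq'] with z h1 h2
  rw [h1, h2, div_mul_div_comm]
  simp

lemma IsRatFn.inv {f : ℂ → ℂ} (hf : IsRatFn f) : IsRatFn (fun z => (f z)⁻¹) := by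
  obtain ⟨p, q, hq, hpq⟩ := hf
  by_cases hp : p = 0
  · refine ⟨0, 1, one_ne_zero, meroEq_iff.2 ?_⟩
    filter_upwards [meroEq_iff.1 hpq] with z h1
    simp [h1, hp]
  · refine ⟨q, p, hp, meroEq_iff.2 ?_⟩
    filter_upwards [meroEq_iff.1 hpq] with z h1
    simp [h1]

lemma IsRatFn.div {f g : ℂ → ℂ} (hf : IsRatFn f) (hg : IsRatFn g) :
    IsRatFn (fun z => f z / g z) := by
  simpa [div_eq_mul_inv] using hf.mul hg.inv

lemma IsRatFn.sub {f g : ℂ → ℂ} (hf : IsRatFn f) (hg : IsRatFn g) :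
    IsRatFn (fun z => f z - g z) := by
  have := hf.add ((IsRatFn.const (-1)).mul hg)
  simpa [sub_eq_add_neg] using this

lemma IsRatFn.deriv {f : ℂ → ℂ} (hf : IsRatFn f) : IsRatFn (deriv f) := by
  obtain ⟨p, q, hq, hpq⟩ := hf
  refine ⟨p.derivative * q - p * q.derivative, q ^ 2, pow_ne_zero 2 hq, meroEq_iff.2 ?_⟩
  filter_upwards [ev_deriv (meroEq_iff.1 hpq), ev_poly_ne hq] with z h1 h2
  rw [h1, ((p.hasDerivAt z).fun_div (q.hasDerivAt z) h2).deriv]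
  simp

lemma IsRatFn.coprime {f : ℂ → ℂ} (hf : IsRatFn f) :
    ∃ p q : Polynomial ℂ, q ≠ 0 ∧ IsCoprime p q ∧
      ∀ᶠ z in codiscrete ℂ, f z = p.eval z / q.eval z := by
  obtain ⟨p, q, hq, hpq⟩ := hf
  obtain ⟨a, ha⟩ := EuclideanDomain.gcd_dvd_left p q
  obtain ⟨b, hb⟩ := EuclideanDomain.gcd_dvd_right p q
  have hg : EuclideanDomain.gcd p q ≠ 0 := fun h => hq (by rw [hb, h, zero_mul])
  refine ⟨a, b, ?_, ?_, ?_⟩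
  · rintro rfl
    exact hq (by rw [hb, mul_zero])
  · have := EuclideanDomain.gcd_eq_gcd_ab p q
    refine ⟨EuclideanDomain.gcdA p q, EuclideanDomain.gcdB p q, mul_left_cancel₀ hg ?_⟩
    calc _ = (EuclideanDomain.gcd p q * a) * EuclideanDomain.gcdA p q
          + (EuclideanDomain.gcd p q * b) * EuclideanDomain.gcdB p q := by ring
      _ = p * EuclideanDomain.gcdA p q + q * EuclideanDomain.gcdB p q := by rw [← ha, ← hb]
      _ = _ := by rw [mul_one]; exact this.symm
  · filter_upwards [meroEq_iff.1 hpq, ev_poly_ne hg] with z h1 h2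
    have ea := congrArg (Polynomial.eval z) ha
    have eb := congrArg (Polynomial.eval z) hb
    rw [Polynomial.eval_mul] at ea eb
    rw [h1, ea, eb, mul_div_mul_left _ _ h2]

lemma real_roots_conj {n : Polynomial ℂ} (hn : n ≠ 0) (h : ∀ z, n.eval z = 0 → z.im = 0) :
    ∃ c : ℂ, c ≠ 0 ∧ ∀ z, n.eval z = c * (starRingEnd ℂ) (n.eval ((starRingEnd ℂ) z)) := by
  have hs : n.Splits := IsAlgClosed.splits n
  have hr : (n.map (starRingEnd ℂ)).roots = n.roots := by
    rw [hs.roots_map]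
    conv_rhs => rw [← Multiset.map_id n.roots]
    refine Multiset.map_congr rfl fun a ha => ?_
    exact Complex.conj_eq_iff_im.2 (h a (Polynomial.isRoot_of_mem_roots ha))
  have e1 := hs.eq_prod_roots
  have e2 := (IsAlgClosed.splits (n.map (starRingEnd ℂ))).eq_prod_roots
  rw [hr, Polynomial.leadingCoeff_map] at e2
  have hl : n.leadingCoeff ≠ 0 := Polynomial.leadingCoeff_ne_zero.2 hn
  have hl' : (starRingEnd ℂ) n.leadingCoeff ≠ 0 := by simpa using hl
  refine ⟨n.leadingCoeff / (starRingEnd ℂ) n.leadingCoeff, div_ne_zero hl hl', fun z => ?_⟩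
  have e3 : (starRingEnd ℂ) (n.eval ((starRingEnd ℂ) z)) = (n.map (starRingEnd ℂ)).eval z := by
    rw [Polynomial.eval_map]
    have := Polynomial.eval₂_at_apply (p := n) (starRingEnd ℂ) ((starRingEnd ℂ) z)
    rw [conj_conj] at this
    exact this.symm
  rw [e3, e2]
  conv_lhs => rw [e1]
  rw [Polynomial.eval_mul, Polynomial.eval_mul, Polynomial.eval_C, Polynomial.eval_C]
  field_simp

lemma order_poly_pos {p : Polynomial ℂ} {z : ℂ} (h : p.eval z = 0) :
    0 < meromorphicOrderAt (fun z => p.eval z) z := by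
  rw [← tendsto_zero_iff_meromorphicOrderAt_pos (mero_poly p z)]
  have := (p.continuous.tendsto z).mono_left (nhdsWithin_le_nhds (s := {z}ᶜ))
  rwa [h] at this

lemma order_poly_zero {p : Polynomial ℂ} {z : ℂ} (h : p.eval z ≠ 0) :
    meromorphicOrderAt (fun z => p.eval z) z = 0 := by
  rw [← tendsto_ne_zero_iff_meromorphicOrderAt_eq_zero (mero_poly p z)]
  exact ⟨_, h, (p.continuous.tendsto z).mono_left nhdsWithin_le_nhds⟩

lemma rat_conj {w : ℂ → ℂ} (hr : IsRatFn w) (hne : ∀ᶠ z in codiscrete ℂ, w z ≠ 0)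
    (ho : ∀ z : ℂ, z.im ≠ 0 → meromorphicOrderAt w z = 0) :
    ∃ K : ℂ, K ≠ 0 ∧ ∀ᶠ z in codiscrete ℂ, w z = K * mtilde w z := by
  obtain ⟨p, q, hq, ⟨a, b, hab⟩, hw⟩ := hr.coprime
  have hp : p ≠ 0 := by
    rintro rfl
    obtain ⟨z, h1, h2⟩ := (hw.and hne).exists
    simp [h1] at h2
  have hab' : ∀ z, a.eval z * p.eval z + b.eval z * q.eval z = 1 := fun z => by
    have := congrArg (Polynomial.eval z) hab
    simpa using this
  have ho' : ∀ z : ℂ, z.im ≠ 0 → meromorphicOrderAt (fun z => p.eval z) z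
      - meromorphicOrderAt (fun z => q.eval z) z = 0 := fun z hz => by
    rw [← fun_meromorphicOrderAt_div (mero_poly p z) (mero_poly q z), ← order_congr hw, ho z hz]
  have hp0 : ∀ z, p.eval z = 0 → z.im = 0 := by
    intro z hz
    by_contra him
    have hq0 : q.eval z ≠ 0 := fun h => by simpa [hz, h] using hab' z
    have := ho' z him
    rw [order_poly_zero hq0] at this
    have h3 := order_poly_pos hz
    simp at this
    rw [this] at h3
    exact lt_irrefl _ h3
  have hq0 : ∀ z, q.eval z = 0 → z.im = 0 := by
    intro z hz
    by_contra him
    have hp0 : p.eval z ≠ 0 := fun h => by simpa [hz, h] using hab' z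
    have := ho' z him
    rw [order_poly_zero hp0] at this
    have h3 := order_poly_pos hz
    have h4 := order_ne_top (mero_poly q) (ev_poly_ne hq) z
    lift meromorphicOrderAt (fun z => q.eval z) z to ℤ using h4 with m
    have h5 : (0 : ℤ) - m = 0 := by exact_mod_cast this
    have h6 : (0 : ℤ) < m := by exact_mod_cast h3
    omega
  obtain ⟨c, hc, hc'⟩ := real_roots_conj hp hp0
  obtain ⟨d, hd, hd'⟩ := real_roots_conj hq hq0
  refine ⟨c / d, div_ne_zero hc hd, ?_⟩
  filter_upwards [hw, ev_conj hw] with z h1 h2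
  rw [mtilde, h1, h2, hc' z, hd' z, map_div₀, div_mul_div_comm]

/-- Meromorphic, with only real zeros (and not identically zero). -/
def RealZeros (h : ℂ → ℂ) : Prop :=
  Meromorphic h ∧ ∀ z : ℂ, 0 < meromorphicOrderAt h z → z.im = 0

lemma order_quot {h : ℂ → ℂ} (h0 : RealZeros h) (h1 : RealZeros (deriv h))
    (h2 : RealZeros (deriv (deriv h))) (z : ℂ) (hz : z.im ≠ 0) :
    meromorphicOrderAt (fun z => h z * deriv (deriv h) z / deriv h z ^ 2) z = 0 := by
  simp_rw [pow_two]
  rw [fun_meromorphicOrderAt_div ((h0.1 z).fun_mul (h2.1 z)) ((h1.1 z).fun_mul (h1.1 z)),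
    fun_meromorphicOrderAt_mul (h0.1 z) (h2.1 z), fun_meromorphicOrderAt_mul (h1.1 z) (h1.1 z)]
  have g0 := order_ne_top h0.1 (ev_ne_of_real h0.1 h0.2) z
  have key : ∀ F : ℂ → ℂ, RealZeros (deriv F) → Meromorphic F → meromorphicOrderAt F z = 0 →
      meromorphicOrderAt (deriv F) z = 0 := by
    intro F h1 hF h0
    apply le_antisymm
    · by_contra h
      exact hz (h1.2 z (not_le.1 h))
    · obtain ⟨g, hg, hfg⟩ := ((hF z).meromorphicOrderAt_nonneg_iff).1 h0.ge
      rw [((h1.1 z).meromorphicOrderAt_nonneg_iff)]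
      exact ⟨deriv g, hg.deriv, hfg.nhdsNE_deriv⟩
  have hle : meromorphicOrderAt h z ≤ 0 := by
    by_contra h
    exact hz (h0.2 z (not_le.1 h))
  rcases hle.eq_or_lt with he | hlt
  · have e1 := key h h1 h0.1 he
    have e2 := key _ h2 h1.1 e1
    rw [he, e1, e2]; simp
  · lift meromorphicOrderAt h z to ℤ using g0 with n hn
    have hn0 : n < 0 := by exact_mod_cast hlt
    have e1 : meromorphicOrderAt (deriv h) z = ((n - 1 : ℤ) : WithTop ℤ) :=
      meromorphicOrderAt_deriv_eq_sub_one (by exact_mod_cast hn0.ne) hn.symm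
    have e2 : meromorphicOrderAt (deriv (deriv h)) z = ((n - 1 - 1 : ℤ) : WithTop ℤ) :=
      meromorphicOrderAt_deriv_eq_sub_one (by exact_mod_cast (by omega : n - 1 ≠ 0)) e1
    rw [e1, e2]
    have : n + (n - 1 - 1) - ((n - 1) + (n - 1)) = 0 := by ring
    exact_mod_cast this

lemma ev_deriv_div {h : ℂ → ℂ} (h0 : Meromorphic h)
    (h1 : ∀ᶠ z in codiscrete ℂ, deriv h z ≠ 0) :
    ∀ᶠ z in codiscrete ℂ, deriv (fun z => h z / deriv h z) z
      = 1 - h z * deriv (deriv h) z / deriv h z ^ 2 := by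
  filter_upwards [ev_analytic h0, ev_analytic h0.deriv, h1] with z a1 a2 a3
  rw [(a1.differentiableAt.hasDerivAt.fun_div a2.differentiableAt.hasDerivAt a3).deriv]
  field_simp

lemma keyA {h : ℂ → ℂ} (h0 : RealZeros h) (h1 : RealZeros (deriv h))
    (h2 : RealZeros (deriv (deriv h))) (hr : IsRatFn (fun z => deriv h z / h z)) :
    ∃ K C : ℂ, K ≠ 0 ∧ ∀ᶠ z in codiscrete ℂ,
      h z / deriv h z = z + K * (mtilde (fun z => h z / deriv h z) z - z) + C := by
  have n0 := ev_ne_of_real h0.1 h0.2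
  have n1 := ev_ne_of_real h1.1 h1.2
  have n2 := ev_ne_of_real h2.1 h2.2
  set u : ℂ → ℂ := fun z => h z / deriv h z with hu
  have hur : IsRatFn u := hr.inv.congr (by simp [hu])
  have hum := hur.meromorphic
  have hw := ev_deriv_div h0.1 n1
  have hwr : IsRatFn (fun z => h z * deriv (deriv h) z / deriv h z ^ 2) := by
    refine ((IsRatFn.const 1).sub hur.deriv).congr ?_
    filter_upwards [hw] with z hz
    rw [hz]; ring
  obtain ⟨K, hK, hKe⟩ := rat_conj hwr
    (by filter_upwards [n0, n1, n2] with z a b c; positivity) (order_quot h0 h1 h2)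
  have hvm := meromorphic_mtilde hum
  have hid : Meromorphic (fun z : ℂ => z) := fun z => MeromorphicAt.id z
  have hF : Meromorphic (fun z => u z - z - K * (mtilde u z - z)) := fun z =>
    ((hum z).fun_sub (hid z)).fun_sub ((MeromorphicAt.const K z).fun_mul ((hvm z).fun_sub (hid z)))
  obtain ⟨C, hC⟩ := ev_const_of_deriv hF (by
    filter_upwards [hw, ev_conj hw, hKe, ev_analytic hum, ev_analytic hvm] with z a b c d e
    have := ((d.differentiableAt.hasDerivAt.fun_sub (hasDerivAt_id' z)).fun_sub
      ((e.differentiableAt.hasDerivAt.fun_sub (hasDerivAt_id' z)).const_mul K)).deriv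
    rw [this, a, mtilde_deriv, c]
    simp only [mtilde]
    rw [b]
    simp)
  refine ⟨K, C, hK, ?_⟩
  filter_upwards [hC] with z hz
  linear_combination hz

/-! ### The first case: reduction to a linear differential equation -/

lemma snr_contra {f : ℂ → ℂ} (hf : Meromorphic f) (h0 : ∀ᶠ z in codiscrete ℂ, f z ≠ 0)
    (hs : StrictlyNonReal f)
    (h : ∀ᶠ z in codiscrete ℂ, deriv (mtilde f) z * f z = deriv f z * mtilde f z) : False := by
  have hg := meromorphic_mtilde hf
  obtain ⟨c, hc⟩ := ev_const_of_deriv (F := fun z => mtilde f z / f z)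
    (fun z => (hg z).fun_div (hf z)) (by
      filter_upwards [ev_analytic hf, ev_analytic hg, h0, h] with z a b c d
      rw [(b.differentiableAt.hasDerivAt.fun_div a.differentiableAt.hasDerivAt c).deriv, d]
      ring)
  refine hs ⟨c, meroEq_iff.2 ?_⟩
  filter_upwards [hc, h0] with z a b
  rw [← a]
  field_simp

lemma snr_contra' {f : ℂ → ℂ} (hf : Meromorphic f) (h0 : ∀ᶠ z in codiscrete ℂ, f z ≠ 0)
    (hs : StrictlyNonReal f) {Q S : ℂ → ℂ} (hQ : ∀ᶠ z in codiscrete ℂ, Q z ≠ 0)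
    (h : ∀ᶠ z in codiscrete ℂ, deriv f z * Q z = f z * S z)
    (hQr : ∀ z, (starRingEnd ℂ) (Q ((starRingEnd ℂ) z)) = Q z)
    (hSr : ∀ z, (starRingEnd ℂ) (S ((starRingEnd ℂ) z)) = S z) : False := by
  refine snr_contra hf h0 hs ?_
  filter_upwards [h, ev_conj h, hQ] with z a b c
  have b' := congrArg (starRingEnd ℂ) b
  rw [map_mul, map_mul, hQr, hSr] at b'
  have e : deriv (mtilde f) z = (starRingEnd ℂ) (deriv f ((starRingEnd ℂ) z)) := by
    rw [mtilde_deriv]; rfl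
  rw [e]
  apply mul_right_cancel₀ c
  simp only [mtilde]
  linear_combination (f z) * b' - (starRingEnd ℂ) (f ((starRingEnd ℂ) z)) * a

lemma lin_ev {a b : ℂ} (h : ∀ᶠ z in codiscrete ℂ, a * z + b = 0) : a = 0 ∧ b = 0 := by
  have : Polynomial.C a * Polynomial.X + Polynomial.C b = 0 := by
    apply poly_eq_zero_of_ev
    filter_upwards [h] with z hz
    simpa using hz
  constructor
  · simpa using congrArg (fun p => Polynomial.coeff p 1) this
  · simpa using congrArg (fun p => Polynomial.coeff p 0) this

lemma quad_ev_ne {a b c : ℂ} (h : ¬ (a = 0 ∧ b = 0 ∧ c = 0)) :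
    ∀ᶠ z in codiscrete ℂ, a * z ^ 2 + b * z + c ≠ 0 := by
  have hp : Polynomial.C a * Polynomial.X ^ 2 + Polynomial.C b * Polynomial.X + Polynomial.C c
      ≠ 0 := by
    intro h0
    apply h
    refine ⟨?_, ?_, ?_⟩
    · simpa [Polynomial.coeff_X, Polynomial.coeff_C] using
        congrArg (fun p => Polynomial.coeff p 2) h0
    · simpa [Polynomial.coeff_X_pow, Polynomial.coeff_C] using
        congrArg (fun p => Polynomial.coeff p 1) h0
    · simpa [Polynomial.coeff_X_pow, Polynomial.coeff_C] using
        congrArg (fun p => Polynomial.coeff p 0) h0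
  filter_upwards [ev_poly_ne hp] with z hz
  simpa using hz

/-- The differential equation `f' * (q₂ z² + q₁ z + q₀) = f * (s₁ z + s₀)`. -/
def Ode (f : ℂ → ℂ) (s1 s0 q2 q1 q0 : ℂ) : Prop :=
  ∀ᶠ z in codiscrete ℂ, deriv f z * (q2 * z ^ 2 + q1 * z + q0) = f z * (s1 * z + s0)

lemma case1_ode {f : ℂ → ℂ} (h0 : RealZeros f) (h1 : RealZeros (deriv f))
    (h2 : RealZeros (deriv (deriv f))) (h3 : RealZeros (deriv (deriv (deriv f))))
    (hs : StrictlyNonReal f) (hr : IsRatFn (fun z => deriv f z / f z)) :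
    ∃ s1 s0 q2 q1 q0 : ℂ, ¬ (q2 = 0 ∧ q1 = 0 ∧ q0 = 0) ∧ Ode f s1 s0 q2 q1 q0 := by
  have n0 := ev_ne_of_real h0.1 h0.2
  have n1 := ev_ne_of_real h1.1 h1.2
  have n2 := ev_ne_of_real h2.1 h2.2
  have hr1 : IsRatFn (fun z => deriv (deriv f) z / deriv f z) := by
    refine ((hr.deriv.div hr).add hr).congr ?_
    filter_upwards [ev_analytic h0.1, ev_analytic h1.1, n0, n1] with z a b c d
    rw [(b.differentiableAt.hasDerivAt.fun_div a.differentiableAt.hasDerivAt c).deriv]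
    field_simp
    ring
  obtain ⟨K, C, hK, hE⟩ := keyA h0 h1 h2 hr
  obtain ⟨K1, C1, hK1, hE1⟩ := keyA h1 h2 h3 hr1
  have hum : Meromorphic (fun z => f z / deriv f z) := fun z => (h0.1 z).fun_div (h1.1 z)
  have hw := ev_deriv_div h0.1 n1
  set u : ℂ → ℂ := fun z => f z / deriv f z with hu
  set u1 : ℂ → ℂ := fun z => deriv f z / deriv (deriv f) z with hu1
  have hrel : ∀ᶠ z in codiscrete ℂ, u z = u1 z * (1 - deriv u z) := by
    filter_upwards [hw, n0, n1, n2] with z a b c d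
    rw [a]
    simp only [hu, hu1]
    field_simp
    ring
  have hvm := meromorphic_mtilde hum
  have hrel' : ∀ᶠ z in codiscrete ℂ, mtilde u z = mtilde u1 z * (1 - deriv (mtilde u) z) := by
    filter_upwards [ev_conj hrel] with z a
    rw [mtilde_deriv]
    have := congrArg (starRingEnd ℂ) a
    simpa [mtilde] using this
  have hu' : ∀ᶠ z in codiscrete ℂ, deriv u z = 1 + K * (deriv (mtilde u) z - 1) := by
    filter_upwards [ev_deriv (f := u) hE, ev_analytic hvm] with z a b
    rw [a]
    exact ((((hasDerivAt_id' z).add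
      ((b.differentiableAt.hasDerivAt.fun_sub (hasDerivAt_id' z)).const_mul K)).add_const C)).deriv
  have hmain : ∀ᶠ z in codiscrete ℂ,
      K * (((1 - K1) * z + C1) * (1 - deriv (mtilde u) z) + K1 * mtilde u z)
        = (1 - K) * z + C + K * mtilde u z := by
    filter_upwards [hE, hE1, hrel, hrel', hu'] with z a b c d e
    have a' : u z = z + K * (mtilde u z - z) + C := a
    have b' : u1 z = z + K1 * (mtilde u1 z - z) + C1 := b
    rw [e, b'] at c
    linear_combination a' - c + K * K1 * d
  by_cases hz : 1 - K1 = 0 ∧ C1 = 0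
  · exfalso
    obtain ⟨hz1, rfl⟩ := hz
    have hK1' : K1 = 1 := by linear_combination -hz1
    subst hK1'
    have hl : ∀ᶠ z in codiscrete ℂ, (1 - K) * z + C = 0 := by
      filter_upwards [hmain] with z a
      linear_combination -a
    obtain ⟨l1, rfl⟩ := lin_ev hl
    have hK' : K = 1 := by linear_combination -l1
    subst hK'
    refine snr_contra h0.1 n0 hs ?_
    filter_upwards [hE, n1, ev_mtilde_ne n1] with z a b c
    rw [mtilde_deriv]
    have a' : f z / deriv f z = mtilde f z / mtilde (deriv f) z := by
      rw [a]; simp [mtilde, hu]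
    field_simp at a'
    linear_combination a'
  · set α : ℂ := (1 - K1) - (1 - K) / K with hα
    set β : ℂ := C1 - C / K with hβ
    have hlin : ∀ z : ℂ, HasDerivAt (fun z : ℂ => (1 - K1) * z + C1) (1 - K1) z := fun z => by
      simpa using ((hasDerivAt_id' z).const_mul (1 - K1)).add_const C1
    have hq : ∀ z : ℂ, HasDerivAt (fun z : ℂ => α / 2 * z ^ 2 + β * z) (α * z + β) z := fun z => by
      have := (((hasDerivAt_id' z).fun_pow 2).const_mul (α / 2)).fun_add ((hasDerivAt_id' z).const_mul β)
      refine this.congr_deriv ?_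
      norm_num
      ring
    have hlm : Meromorphic (fun z : ℂ => (1 - K1) * z + C1) := fun z => by fun_prop
    have hqm : Meromorphic (fun z : ℂ => α / 2 * z ^ 2 + β * z) := fun z => by fun_prop
    obtain ⟨γ, hγ⟩ := ev_const_of_deriv
      (F := fun z => mtilde u z * ((1 - K1) * z + C1) - (α / 2 * z ^ 2 + β * z))
      (fun z => ((hvm z).fun_mul (hlm z)).fun_sub (hqm z)) (by
        filter_upwards [hmain, ev_analytic hvm] with z a b
        rw [((b.differentiableAt.hasDerivAt.fun_mul (hlin z)).fun_sub (hq z)).deriv]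
        simp only [hα, hβ]
        field_simp
        linear_combination -a)
    have hv : ∀ᶠ z in codiscrete ℂ,
        mtilde u z * ((1 - K1) * z + C1) = α / 2 * z ^ 2 + β * z + γ := by
      filter_upwards [hγ] with z a
      linear_combination a
    refine ⟨(starRingEnd ℂ) (1 - K1), (starRingEnd ℂ) C1, (starRingEnd ℂ) (α / 2),
      (starRingEnd ℂ) β, (starRingEnd ℂ) γ, ?_, ?_⟩
    · simp only [map_eq_zero]
      rintro ⟨e1, e2, e3⟩
      apply hz
      apply lin_ev
      have hun : ∀ᶠ z in codiscrete ℂ, u z ≠ 0 := by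
        filter_upwards [n0, n1] with z a b using div_ne_zero a b
      filter_upwards [hv, ev_mtilde_ne hun] with z a b
      rw [e1, e2, e3] at a
      have : mtilde u z * ((1 - K1) * z + C1) = 0 := by rw [a]; ring
      exact (mul_eq_zero.1 this).resolve_left b
    · unfold Ode
      filter_upwards [ev_conj hv, n1] with z a b
      have a' := congrArg (starRingEnd ℂ) a
      simp only [mtilde, map_mul, map_add, conj_conj, map_pow, hu] at a'
      rw [← a']
      field_simp

/-! ### Solving the linear differential equation -/

lemma ode_step {f F : ℂ → ℂ} (hf : Meromorphic f) (hF : Meromorphic F) {q q' N N' s : ℂ → ℂ}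
    (k : ℕ) (hq : ∀ z, HasDerivAt q (q' z) z) (hN : ∀ z, HasDerivAt N (N' z) z)
    (hs : ∀ᶠ z in codiscrete ℂ, deriv f z * q z = f z * s z)
    (h : ∀ᶠ z in codiscrete ℂ, F z * q z ^ k = f z * N z) :
    ∀ᶠ z in codiscrete ℂ,
      deriv F z * q z ^ (k + 1) = f z * (N z * s z + N' z * q z - k * N z * q' z) := by
  filter_upwards [ev_analytic hf, ev_analytic hF, hs, h, ev_deriv h] with z a b c d e
  rw [(b.differentiableAt.hasDerivAt.fun_mul ((hq z).fun_pow k)).deriv,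
    (a.differentiableAt.hasDerivAt.fun_mul (hN z)).deriv] at e
  rcases k with _ | k
  · simp at e d ⊢
    linear_combination q z * e + N z * c
  · simp only [Nat.add_sub_cancel] at e
    linear_combination q z * e + N z * c - ((k + 1 : ℕ) : ℂ) * q' z * d

lemma res_lemma {f : ℂ → ℂ} {a : ℂ} (hf : MeromorphicAt f a) {n : ℤ}
    (hn : meromorphicOrderAt f a = n)
    {q s : ℂ → ℂ} (hq : Continuous q) (hs : Continuous s)
    (h : ∀ᶠ z in codiscrete ℂ, deriv f z * ((z - a) * q z) = f z * s z) : s a = n * q a := by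
  obtain ⟨g, hg, hga, hfg⟩ := (meromorphicOrderAt_eq_int_iff hf).1 hn
  have hfg' : ∀ᶠ z in 𝓝[≠] a, ∀ᶠ w in 𝓝 z, f w = (w - a) ^ n • g w :=
    eventually_eventually_nhdsWithin.2 hfg |>.mono (by
      intro z hz
      exact hz) |> fun h' => by
        filter_upwards [h', self_mem_nhdsWithin] with z hz hz'
        rwa [IsOpen.nhdsWithin_eq isOpen_compl_singleton hz'] at hz
  have hev : ∀ᶠ z in 𝓝[≠] a,
      (n * g z + (z - a) * deriv g z) * q z - g z * s z = 0 := by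
    filter_upwards [hfg', ev_iff.1 h a, self_mem_nhdsWithin,
      hg.eventually_analyticAt.filter_mono nhdsWithin_le_nhds] with z a1 a2 a3 a4
    have hza : z - a ≠ 0 := sub_ne_zero.2 a3
    have hd : HasDerivAt (fun w => (w - a) ^ n • g w)
        ((n * (z - a) ^ (n - 1) * 1) • g z + (z - a) ^ n • deriv g z) z := by
      have h1 : HasDerivAt (fun w => (w - a) ^ n) (n * (z - a) ^ (n - 1) * 1) z :=
        HasDerivAt.comp (h₂ := fun y : ℂ => y ^ n) z (hasDerivAt_zpow n (z - a) (Or.inl hza))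
          ((hasDerivAt_id' z).sub_const a)
      have := h1.fun_mul a4.differentiableAt.hasDerivAt
      simpa using this
    have e1 : deriv f z = _ := (Filter.EventuallyEq.deriv_eq a1).trans hd.deriv
    rw [e1, a1.self_of_nhds] at a2
    have e2 : (z - a) ^ n = (z - a) ^ (n - 1) * (z - a) := by
      rw [← zpow_add_one₀ hza]; simp
    simp only [smul_eq_mul] at a2
    rw [e2] at a2
    have hz2 : (z - a) ^ (n - 1) * (z - a) ≠ 0 := mul_ne_zero (zpow_ne_zero _ hza) hza
    apply mul_left_cancel₀ hz2
    linear_combination a2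
  have hc : ContinuousAt (fun z => (n * g z + (z - a) * deriv g z) * q z - g z * s z) a := by
    have := hg.continuousAt
    have := hg.deriv.continuousAt
    have := hq.continuousAt (x := a)
    have := hs.continuousAt (x := a)
    fun_prop
  have hl := hc.tendsto.mono_left (nhdsWithin_le_nhds (s := {a}ᶜ))
  have hl0 : Tendsto (fun z => (n * g z + (z - a) * deriv g z) * q z - g z * s z) (𝓝[≠] a)
      (𝓝 0) := by
    refine tendsto_const_nhds.congr' ?_
    filter_upwards [hev] with z hz using hz.symm
  have := tendsto_nhds_unique hl hl0
  simp only [sub_self, zero_mul, add_zero] at this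
  apply mul_left_cancel₀ hga
  linear_combination -this

lemma order_zero {f : ℂ → ℂ} (hf : Meromorphic f) (h0 : ∀ᶠ z in codiscrete ℂ, f z ≠ 0)
    {q s : ℂ → ℂ} (hq : Continuous q) (hs : Continuous s)
    (h : ∀ᶠ z in codiscrete ℂ, deriv f z * q z = f z * s z) {a : ℂ} (ha : q a ≠ 0) :
    meromorphicOrderAt f a = 0 := by
  obtain ⟨n, hn⟩ := WithTop.ne_top_iff_exists.1 (order_ne_top hf h0 a)
  have := res_lemma (hf a) hn.symm (q := q) (s := fun z => (z - a) * s z) hq (by fun_prop) (by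
    filter_upwards [h] with z hz
    linear_combination (z - a) * hz)
  simp [ha] at this
  rw [← hn, this]; rfl

lemma zero_real {f F : ℂ → ℂ} (hf : Meromorphic f) (hF : RealZeros F) {z : ℂ}
    {Q N : ℂ → ℂ} (hQ : Differentiable ℂ Q) (hN : Differentiable ℂ N)
    (h : ∀ᶠ z in codiscrete ℂ, F z * Q z = f z * N z) (hQz : Q z ≠ 0) (hNz : N z = 0)
    (h0 : meromorphicOrderAt f z = 0) : (starRingEnd ℂ) z = z := by
  refine conj_eq_iff_im.2 (hF.2 z ?_)
  have e := order_congr h z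
  have aQ := hQ.analyticAt z
  have aN := hN.analyticAt z
  have e1 : meromorphicOrderAt (fun z => F z * Q z) z
      = meromorphicOrderAt F z + meromorphicOrderAt Q z :=
    meromorphicOrderAt_mul (hF.1 z) aQ.meromorphicAt
  have e2 : meromorphicOrderAt (fun z => f z * N z) z
      = meromorphicOrderAt f z + meromorphicOrderAt N z :=
    meromorphicOrderAt_mul (hf z) aN.meromorphicAt
  have e3 : meromorphicOrderAt Q z = 0 := by
    rw [aQ.meromorphicOrderAt_eq, aQ.analyticOrderAt_eq_zero.2 hQz]; rfl
  have e4 : 0 < meromorphicOrderAt N z := by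
    rw [aN.meromorphicOrderAt_eq]
    have : analyticOrderAt N z ≠ 0 := aN.analyticOrderAt_ne_zero.2 hNz
    cases h : analyticOrderAt N z with
    | top => simp
    | coe n =>
      rw [h] at this
      have : n ≠ 0 := by exact_mod_cast this
      simp
      omega
  rw [e1, e2, e3, h0, add_zero, zero_add] at e
  rwa [e]

/-- The standing assumptions on `f` in the first case. -/
structure Good (f : ℂ → ℂ) : Prop where
  h0 : RealZeros f
  h1 : RealZeros (deriv f)
  h2 : RealZeros (deriv (deriv f))
  h3 : RealZeros (deriv (deriv (deriv f)))
  hs : StrictlyNonReal f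

lemma Good.ne {f : ℂ → ℂ} (hf : Good f) : ∀ᶠ z in codiscrete ℂ, f z ≠ 0 :=
  ev_ne_of_real hf.h0.1 hf.h0.2

lemma Good.zeros {f : ℂ → ℂ} (hf : Good f) {s1 s0 q2 q1 q0 : ℂ} (h : Ode f s1 s0 q2 q1 q0)
    {z s q q' N2 : ℂ} (hs : s = s1 * z + s0) (hq : q = q2 * z ^ 2 + q1 * z + q0)
    (hq' : q' = 2 * q2 * z + q1) (hN2 : N2 = s ^ 2 + s1 * q - s * q')
    (hq0 : q ≠ 0)
    (hz : s = 0 ∨ N2 = 0 ∨ N2 * s + (2 * s * s1 - 2 * q2 * s) * q - 2 * N2 * q' = 0) :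
    (starRingEnd ℂ) z = z := by
  have hm := hf.h0.1
  have dq : ∀ z : ℂ, HasDerivAt (fun z : ℂ => q2 * z ^ 2 + q1 * z + q0) (2 * q2 * z + q1) z := by
    intro z
    have := ((((hasDerivAt_id' z).fun_pow 2).const_mul q2).fun_add
      ((hasDerivAt_id' z).const_mul q1)).add_const q0
    refine this.congr_deriv ?_
    norm_num
    ring
  have ds : ∀ z : ℂ, HasDerivAt (fun z : ℂ => s1 * z + s0) s1 z := fun z => by
    simpa using ((hasDerivAt_id' z).const_mul s1).add_const s0
  have dq' : ∀ z : ℂ, HasDerivAt (fun z : ℂ => 2 * q2 * z + q1) (2 * q2) z := fun z => by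
    simpa using ((hasDerivAt_id' z).const_mul (2 * q2)).add_const q1
  have cq : Differentiable ℂ (fun z : ℂ => q2 * z ^ 2 + q1 * z + q0) := by fun_prop
  have cs : Differentiable ℂ (fun z : ℂ => s1 * z + s0) := by fun_prop
  have hord : meromorphicOrderAt f z = 0 :=
    order_zero hm hf.ne cq.continuous cs.continuous h (by rwa [hq] at hq0)
  have s2 := ode_step hm hf.h1.1 1 dq ds h (by simpa [Ode] using h)
  have dN2 : ∀ z : ℂ, HasDerivAt (fun z : ℂ => (s1 * z + s0) * (s1 * z + s0)
      + s1 * (q2 * z ^ 2 + q1 * z + q0) - (1 : ℕ) * (s1 * z + s0) * (2 * q2 * z + q1))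
      (2 * (s1 * z + s0) * s1 - 2 * q2 * (s1 * z + s0)) z := by
    intro z
    have := (((ds z).fun_mul (ds z)).fun_add ((dq z).const_mul s1)).fun_sub
      (((ds z).const_mul ((1 : ℕ) : ℂ)).fun_mul (dq' z))
    refine this.congr_deriv ?_
    norm_num
    ring
  have s3 := ode_step hm hf.h2.1 2 dq dN2 h s2
  rcases hz with hz | hz | hz
  · exact zero_real hm hf.h1 cq cs h (by rwa [hq] at hq0) (by rw [← hs, hz]) hord
  · refine zero_real hm hf.h2 (cq.pow 2) (by fun_prop) s2 ?_ ?_ hord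
    · simpa [← hq] using hq0
    · simp only [← hs, ← hq, ← hq']
      rw [← hz, hN2]; push_cast; ring
  · refine zero_real hm hf.h3 (cq.pow 3) (by fun_prop) s3 ?_ ?_ hord
    · simpa [← hq] using hq0
    · simp only [← hs, ← hq, ← hq']
      rw [← hz, hN2]; push_cast; ring

lemma ode_unique {f G : ℂ → ℂ} (hf : Meromorphic f) (h0 : ∀ᶠ z in codiscrete ℂ, f z ≠ 0)
    (hG : Meromorphic G) (hG0 : ∀ᶠ z in codiscrete ℂ, G z ≠ 0) {q s : ℂ → ℂ}
    (hq : ∀ᶠ z in codiscrete ℂ, q z ≠ 0)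
    (h : ∀ᶠ z in codiscrete ℂ, deriv f z * q z = f z * s z)
    (h' : ∀ᶠ z in codiscrete ℂ, deriv G z * q z = G z * s z) :
    ∃ c, c ≠ 0 ∧ ∀ᶠ z in codiscrete ℂ, f z = c * G z := by
  obtain ⟨c, hc⟩ := ev_const_of_deriv (F := fun z => f z / G z)
    (fun z => (hf z).fun_div (hG z)) (by
      filter_upwards [ev_analytic hf, ev_analytic hG, hG0, h, h', hq] with z a b c d e hq
      rw [(a.differentiableAt.hasDerivAt.fun_div b.differentiableAt.hasDerivAt c).deriv]
      rw [div_eq_zero_iff]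
      left
      apply mul_left_cancel₀ hq
      linear_combination G z * d - f z * e)
  refine ⟨c, ?_, ?_⟩
  · obtain ⟨z, a, b, d⟩ := (hc.and (h0.and hG0)).exists
    rw [← a]; exact div_ne_zero b d
  · filter_upwards [hc, hG0] with z a b
    rw [← a]; field_simp

/-- The conclusion of the theorem. -/
def Concl (f : ℂ → ℂ) : Prop :=
  ∃ (a b c d : ℂ) (μ : ℤ),
      MeroEq f (fun z => (a * z + b) ^ μ) ∨
      MeroEq f (fun z => (a * z + b) / (c * z + d)) ∨
      MeroEq f (fun z => Complex.exp (a * z + b) - c)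

lemma exists_cubic (a b : ℂ) : ∃ y : ℂ, y ^ 3 + a * y + b = 0 := by
  have hd : (Polynomial.X ^ 3 + Polynomial.C a * Polynomial.X + Polynomial.C b).degree = 3 := by
    compute_degree!
  obtain ⟨y, hy⟩ := IsAlgClosed.exists_root
    (Polynomial.X ^ 3 + Polynomial.C a * Polynomial.X + Polynomial.C b) (by rw [hd]; simp)
  exact ⟨y, by simpa using hy⟩

lemma exists_sqrt (a : ℂ) : ∃ y : ℂ, y ^ 2 = a := IsAlgClosed.exists_pow_nat_eq a (by norm_num)

lemma Good.contra {f : ℂ → ℂ} (hf : Good f) {s1 s0 q2 q1 q0 : ℂ} (h : Ode f s1 s0 q2 q1 q0)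
    (hq : ¬ (q2 = 0 ∧ q1 = 0 ∧ q0 = 0))
    (a1 : (starRingEnd ℂ) s1 = s1) (a2 : (starRingEnd ℂ) s0 = s0)
    (a3 : (starRingEnd ℂ) q2 = q2) (a4 : (starRingEnd ℂ) q1 = q1)
    (a5 : (starRingEnd ℂ) q0 = q0) : False :=
  snr_contra' hf.h0.1 hf.ne hf.hs (quad_ev_ne hq) h (by simp [a3, a4, a5]) (by simp [a1, a2])

lemma case_La {f : ℂ → ℂ} (hf : Good f) {α β : ℂ} (h : Ode f α β 0 0 1) : Concl f := by
  by_cases hα : α = 0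
  · subst hα
    have dG : ∀ z : ℂ, HasDerivAt (fun z : ℂ => exp (β * z)) (exp (β * z) * β) z := fun z => by
      simpa using ((hasDerivAt_id' z).const_mul β).cexp
    obtain ⟨c, hc, hfc⟩ := ode_unique hf.h0.1 hf.ne (G := fun z => exp (β * z))
      (fun z => by
        have : Differentiable ℂ (fun z : ℂ => exp (β * z)) := by fun_prop
        exact (this.analyticAt z).meromorphicAt) (Eventually.of_forall fun z => exp_ne_zero _)
      (quad_ev_ne (by simp)) h (Eventually.of_forall fun z => by rw [(dG z).deriv]; ring)
    refine ⟨β, log c, 0, 0, 0, Or.inr (Or.inr (meroEq_iff.2 ?_))⟩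
    filter_upwards [hfc] with z hz
    rw [hz, exp_add, exp_log hc]; ring
  · exfalso
    have r1 := hf.zeros h (z := -β / α) rfl rfl rfl rfl (by simp) (Or.inl (by field_simp; ring))
    obtain ⟨w, hw⟩ := exists_sqrt (-1 / α)
    have r2 := hf.zeros h (z := -β / α + w) rfl rfl rfl rfl (by simp) (Or.inr (Or.inl (by
      have : α * w ^ 2 = -1 := by rw [hw]; field_simp
      field_simp
      linear_combination α ^ 2 * this)))
    rw [map_add, r1] at r2
    have r3 : (starRingEnd ℂ) w = w := by linear_combination r2
    have r4 := congrArg (starRingEnd ℂ) hw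
    rw [map_pow, r3, hw] at r4
    have r5 : (starRingEnd ℂ) α = α := by
      simp only [map_div₀, map_neg, map_one] at r4
      have : (starRingEnd ℂ) α ≠ 0 := by simpa using hα
      field_simp at r4
      linear_combination -r4
    have r6 : (starRingEnd ℂ) β = β := by
      simp only [map_div₀, map_neg, r5] at r1
      field_simp at r1
      linear_combination -r1
    exact hf.contra h (by simp) r5 r6 (by simp) (by simp) (by simp)

lemma conj_real_of {ρ : ℂ} (h : (starRingEnd ℂ) ρ = ρ) : ∃ r : ℝ, ρ = r := by
  obtain ⟨r, hr⟩ := conj_eq_iff_real.1 h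
  exact ⟨r, hr⟩

lemma case_Lb0 {f : ℂ → ℂ} (hf : Good f) {z0 : ℂ} {m : ℤ} (h : Ode f 0 m 0 1 (-z0)) :
    Concl f := by
  have hz : ∀ᶠ z in codiscrete ℂ, z - z0 ≠ 0 := by
    filter_upwards [quad_ev_ne (a := 0) (b := 1) (c := -z0) (by simp)] with z hz h0
    exact hz (by linear_combination h0)
  obtain ⟨c, hc, hfc⟩ := ode_unique hf.h0.1 hf.ne (G := fun z => (z - z0) ^ m)
    (fun z => by fun_prop)
    (by filter_upwards [hz] with z hz using zpow_ne_zero _ hz)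
    (quad_ev_ne (by simp)) h (by
      filter_upwards [hz] with z hz
      have h1 : HasDerivAt (fun w => (w - z0) ^ m) (m * (z - z0) ^ (m - 1) * 1) z :=
        HasDerivAt.comp (h₂ := fun y : ℂ => y ^ m) z (hasDerivAt_zpow m (z - z0) (Or.inl hz))
          ((hasDerivAt_id' z).sub_const z0)
      rw [h1.deriv]
      have e2 : (z - z0) ^ m = (z - z0) ^ (m - 1) * (z - z0) := by
        rw [← zpow_add_one₀ hz]; simp
      rw [e2]; ring)
  by_cases hm : m = 0
  · subst hm
    refine ⟨0, log c, 0, 0, 0, Or.inr (Or.inr (meroEq_iff.2 ?_))⟩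
    filter_upwards [hfc] with z hz
    rw [hz, zero_mul, zero_add, exp_log hc]; simp
  · have ha : (exp (log c / m)) ^ m = c := by
      rw [← exp_int_mul]
      have : (m : ℂ) ≠ 0 := by exact_mod_cast hm
      rw [mul_div_cancel₀ _ this, exp_log hc]
    refine ⟨exp (log c / m), -exp (log c / m) * z0, 0, 0, m, Or.inl (meroEq_iff.2 ?_)⟩
    filter_upwards [hfc] with z hz
    rw [hz]
    have : exp (log c / m) * z + -exp (log c / m) * z0 = exp (log c / m) * (z - z0) := by ring
    rw [this, mul_zpow, ha]

lemma case_Lb {f : ℂ → ℂ} (hf : Good f) {α z0 : ℂ} {m : ℤ}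
    (hm : meromorphicOrderAt f z0 = m) (h : Ode f α (m - α * z0) 0 1 (-z0)) : Concl f := by
  by_cases hα : α = 0
  · subst hα
    exact case_Lb0 hf (by simpa using h)
  by_cases hm0 : m = 0
  · subst hm0
    refine case_La hf (α := 0) (β := α) ?_
    unfold Ode at h ⊢
    filter_upwards [h, quad_ev_ne (a := 0) (b := 1) (c := -z0) (by simp)] with z a b
    apply mul_right_cancel₀ b
    push_cast at a
    linear_combination a
  exfalso
  have hmc : (m : ℂ) ≠ 0 := by exact_mod_cast hm0
  have hcα : (starRingEnd ℂ) α ≠ 0 := by simpa using hα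
  have r1 := hf.zeros h (z := z0 - m / α) rfl rfl rfl rfl
    (by
      have : (0 : ℂ) * (z0 - m / α) ^ 2 + 1 * (z0 - m / α) + -z0 = - (m / α) := by ring
      rw [this]
      exact neg_ne_zero.2 (div_ne_zero hmc hα)) (Or.inl (by field_simp; ring))
  rcases lt_or_gt_of_ne hm0 with hneg | hpos
  · have hzz : ∀ y : ℂ, z0 - m / α + y / α - z0 = (y - m) / α := fun y => by ring
    obtain ⟨y0, hy0⟩ := exists_sqrt m
    obtain ⟨y, hy⟩ := exists_cubic (-3 * m) (2 * m)
    have hy0m : y0 ≠ m := by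
      rintro rfl
      have : m ^ 2 = m := by exact_mod_cast hy0
      nlinarith
    have hym : y ≠ m := by
      rintro rfl
      have h1 : m ^ 3 + -3 * m * m + 2 * m = 0 := by exact_mod_cast hy
      have h2 : m * ((m - 1) * (m - 2)) = 0 := by linear_combination h1
      rcases mul_eq_zero.1 h2 with h3 | h3
      · omega
      · nlinarith
    have hz : ∀ y : ℂ, y ≠ m → (y ^ 2 = m ∨ y ^ 3 + -3 * m * y + 2 * m = 0) →
        (starRingEnd ℂ) (y / α) = y / α := by
      intro y h1 h2
      have r2 := hf.zeros h (z := z0 - m / α + y / α) (s := y) (q := (y - m) / α) (q' := 1)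
        (N2 := y ^ 2 - m)
        (by field_simp; ring) (by field_simp; ring) (by ring) (by field_simp; ring)
        (div_ne_zero (sub_ne_zero.2 h1) hα) (by
          right
          rcases h2 with h2 | h2
          · left; rw [h2]; ring
          · right
            have e : α * ((y - m) / α) = y - m := by field_simp
            linear_combination h2 + 2 * y * e)
      rw [map_add, r1] at r2
      linear_combination r2
    have w0 := hz y0 hy0m (Or.inl hy0)
    have w1 := hz y hym (Or.inr hy)
    have hy00 : y0 ≠ 0 := by rintro rfl; simp at hy0; exact hmc hy0.symm
    obtain ⟨ρ, hρ⟩ := conj_real_of (ρ := (y / α) / (y0 / α)) (by rw [map_div₀, w0, w1])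
    have hρ' : y = ρ * y0 := by rw [← hρ]; field_simp
    rw [hρ'] at hy
    have e1 : y0 * (ρ ^ 3 - 3 * ρ) = -2 := by
      apply mul_left_cancel₀ hmc
      linear_combination hy - y0 * ρ ^ 3 * hy0
    have e2 : (m : ℂ) * (ρ ^ 3 - 3 * ρ) ^ 2 = 4 := by
      rw [← hy0]
      linear_combination (y0 * (ρ ^ 3 - 3 * ρ) - 2) * e1
    have e3 : (m : ℝ) * (ρ ^ 3 - 3 * ρ) ^ 2 = 4 := by exact_mod_cast e2
    have e4 : (m : ℝ) < 0 := by exact_mod_cast hneg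
    nlinarith [sq_nonneg (ρ ^ 3 - 3 * ρ)]
  · have r0 : (starRingEnd ℂ) z0 = z0 :=
      conj_eq_iff_im.2 (hf.h0.2 z0 (by rw [hm]; exact_mod_cast hpos))
    have ra : (starRingEnd ℂ) α = α := by
      simp only [map_sub, r0, map_div₀, map_intCast] at r1
      field_simp at r1
      apply mul_left_cancel₀ hmc
      linear_combination r1
    exact hf.contra h (by simp) ra (by simp [ra, r0]) (by simp) (by simp) (by simp [r0])

lemma case_Ld_pos {f : ℂ → ℂ} (hf : Good f) {p r : ℂ} (hpr : p ≠ r) {m n : ℤ}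
    (hm : meromorphicOrderAt f p = m) (hpos : 0 < m) (hn0 : n ≠ 0)
    (h : Ode f (m + n) (-(m * r) - n * p) 1 (-(p + r)) (p * r)) : Concl f := by
  have hmc : (m : ℂ) ≠ 0 := by exact_mod_cast hpos.ne'
  have hnc : (n : ℂ) ≠ 0 := by exact_mod_cast hn0
  have hd : p - r ≠ 0 := sub_ne_zero.2 hpr
  have r0 : (starRingEnd ℂ) p = p :=
    conj_eq_iff_im.2 (hf.h0.2 p (by rw [hm]; exact_mod_cast hpos))
  have key : (starRingEnd ℂ) r = r → Concl f := fun hr =>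
    (hf.contra h (by simp) (by simp) (by simp [r0, hr]) (by simp) (by simp [r0, hr])
      (by simp [r0, hr])).elim
  by_cases hS : m + n = 0
  · have hn : n = -m := by omega
    subst hn
    by_cases h1 : m = 1
    · subst h1
      have hp : ∀ᶠ z in codiscrete ℂ, z - p ≠ 0 := by
        filter_upwards [quad_ev_ne (a := 0) (b := 1) (c := -p) (by simp)] with z hz h0
        exact hz (by linear_combination h0)
      have hr : ∀ᶠ z in codiscrete ℂ, z - r ≠ 0 := by
        filter_upwards [quad_ev_ne (a := 0) (b := 1) (c := -r) (by simp)] with z hz h0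
        exact hz (by linear_combination h0)
      obtain ⟨c, hc, hfc⟩ := ode_unique hf.h0.1 hf.ne (G := fun z => (z - p) / (z - r))
        (fun z => by fun_prop)
        (by filter_upwards [hp, hr] with z a b using div_ne_zero a b)
        (quad_ev_ne (by simp)) h (by
          filter_upwards [hr] with z hz
          have h1 := ((hasDerivAt_id' z).sub_const p).fun_div ((hasDerivAt_id' z).sub_const r) hz
          rw [h1.deriv]
          field_simp
          push_cast
          ring)
      refine ⟨c, -c * p, 1, -r, 0, Or.inr (Or.inl (meroEq_iff.2 ?_))⟩
      filter_upwards [hfc] with z hz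
      rw [hz]; ring
    · have hm1 : (m : ℂ) - 1 ≠ 0 := by
        intro h'
        apply h1
        have : (m : ℂ) = 1 := by linear_combination h'
        exact_mod_cast this
      have hm2 : (m : ℂ) + 1 ≠ 0 := by
        intro h'
        have : m + 1 = 0 := by exact_mod_cast h'
        omega
      have r1 := hf.zeros h (z := ((m + 1) * p - (m - 1) * r) / 2)
        (s := m * (p - r)) (q := (m - 1) * (p - r) / 2 * ((m + 1) * (p - r) / 2))
        (q' := m * (p - r)) (N2 := 0)
        (by push_cast; ring) (by ring) (by ring) (by push_cast; ring)
        (by simp [hm1, hm2, hd]) (Or.inr (Or.inl rfl))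
      apply key
      simp only [map_div₀, map_sub, map_mul, map_add, r0, map_one, map_intCast, map_ofNat] at r1
      apply mul_left_cancel₀ hm1
      linear_combination -2 * r1
  · have hSc : (m : ℂ) + n ≠ 0 := by exact_mod_cast hS
    have r1 := hf.zeros h (z := (m * r + n * p) / (m + n))
      (s := 0) (q := (m * (r - p) / (m + n)) * (n * (p - r) / (m + n)))
      (by field_simp; ring) (by field_simp; ring) rfl rfl
      (by
        have : r - p ≠ 0 := sub_ne_zero.2 hpr.symm
        exact mul_ne_zero (div_ne_zero (mul_ne_zero hmc this) hSc)
          (div_ne_zero (mul_ne_zero hnc hd) hSc)) (Or.inl rfl)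
    apply key
    simp only [map_div₀, map_mul, map_add, r0, map_intCast] at r1
    field_simp at r1
    apply mul_left_cancel₀ hmc
    linear_combination r1

lemma case_Ld {f : ℂ → ℂ} (hf : Good f) {p r : ℂ} (hpr : p ≠ r) {m n : ℤ}
    (hm : meromorphicOrderAt f p = m) (hn : meromorphicOrderAt f r = n)
    (h : Ode f (m + n) (-(m * r) - n * p) 1 (-(p + r)) (p * r)) : Concl f := by
  by_cases hm0 : m = 0
  · subst hm0
    refine case_Lb0 hf (z0 := r) (m := n) ?_
    unfold Ode at h ⊢
    filter_upwards [h, quad_ev_ne (a := 0) (b := 1) (c := -p) (by simp)] with z a b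
    apply mul_right_cancel₀ b
    push_cast at a
    linear_combination a
  by_cases hn0 : n = 0
  · subst hn0
    refine case_Lb0 hf (z0 := p) (m := m) ?_
    unfold Ode at h ⊢
    filter_upwards [h, quad_ev_ne (a := 0) (b := 1) (c := -r) (by simp)] with z a b
    apply mul_right_cancel₀ b
    push_cast at a
    linear_combination a
  rcases lt_or_gt_of_ne hm0 with hmneg | hmpos
  swap
  · exact case_Ld_pos hf hpr hm hmpos hn0 h
  rcases lt_or_gt_of_ne hn0 with hnneg | hnpos
  swap
  · refine case_Ld_pos hf hpr.symm hn hnpos hm0 ?_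
    have e1 : (n : ℂ) + m = m + n := by ring
    have e2 : -((n : ℂ) * p) - m * r = -(m * r) - n * p := by ring
    rw [e1, e2, add_comm r p, mul_comm r p]
    exact h
  exfalso
  have hmc : (m : ℂ) ≠ 0 := by exact_mod_cast hm0
  have hnc : (n : ℂ) ≠ 0 := by exact_mod_cast hn0
  have hSc : (m : ℂ) + n ≠ 0 := by
    have : m + n ≠ 0 := by omega
    exact_mod_cast this
  have hS1 : (m : ℂ) + n - 1 ≠ 0 := by
    have : m + n - 1 ≠ 0 := by omega
    exact_mod_cast this
  have hS2 : (m : ℂ) + n - 2 ≠ 0 := by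
    have : m + n - 2 ≠ 0 := by omega
    exact_mod_cast this
  obtain ⟨δ, hδ⟩ : ∃ δ, δ = (r - p) / ((m : ℂ) + n) := ⟨_, rfl⟩
  obtain ⟨z1, hz1⟩ : ∃ z1, z1 = (m * r + n * p) / ((m : ℂ) + n) := ⟨_, rfl⟩
  have hδ0 : δ ≠ 0 := by rw [hδ]; exact div_ne_zero (sub_ne_zero.2 hpr.symm) hSc
  have hp : p = z1 - m * δ := by rw [hδ, hz1]; field_simp; ring
  have hr : r = z1 + n * δ := by rw [hδ, hz1]; field_simp; ring
  clear hδ hz1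
  have hgen : ∀ y : ℂ, y + m ≠ 0 → y - n ≠ 0 → (y = 0 ∨ (m + n - 1) * y ^ 2 = m * n ∨
      (m + n - 1) * (m + n - 2) * y ^ 3 - 3 * (m * n) * (m + n - 2) * y
        + 2 * (m - n) * (m * n) = 0) →
      (starRingEnd ℂ) (z1 + δ * y) = z1 + δ * y := by
    intro y h1 h2 h3
    refine hf.zeros h (z := z1 + δ * y) (s := (m + n) * δ * y) (q := δ ^ 2 * ((y + m) * (y - n)))
      (q' := δ * (2 * y + m - n)) (N2 := (m + n) * δ ^ 2 * ((m + n - 1) * y ^ 2 - m * n))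
      (by rw [hp, hr]; ring) (by rw [hp, hr]; ring) (by rw [hp, hr]; ring)
      (by ring) (mul_ne_zero (pow_ne_zero _ hδ0) (mul_ne_zero h1 h2)) ?_
    rcases h3 with h3 | h3 | h3
    · left; rw [h3]; ring
    · right; left; rw [h3]; ring
    · right; right
      linear_combination (m + n) * δ ^ 3 * h3
  have r1 : (starRingEnd ℂ) z1 = z1 := by
    simpa using hgen 0 (by simpa using hmc) (by simpa using hnc) (Or.inl rfl)
  obtain ⟨y0, hy0⟩ := exists_sqrt (m * n / (m + n - 1))
  have hy0' : ((m : ℂ) + n - 1) * y0 ^ 2 = m * n := by rw [hy0]; field_simp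
  clear hy0
  have hy00 : y0 ≠ 0 := by
    rintro rfl
    apply mul_ne_zero hmc hnc
    rw [← hy0']; ring
  obtain ⟨y, hy⟩ := exists_cubic (-3 * (m * n) / (m + n - 1))
    (2 * (m - n) * (m * n) / ((m + n - 1) * (m + n - 2)))
  have hy' : ((m : ℂ) + n - 1) * (m + n - 2) * y ^ 3 - 3 * (m * n) * (m + n - 2) * y
        + 2 * (m - n) * (m * n) = 0 := by
    field_simp at hy
    linear_combination hy
  clear hy
  have w0 : (starRingEnd ℂ) (δ * y0) = δ * y0 := by
    have := hgen y0 (by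
      intro h'
      have h1 : y0 = -m := by linear_combination h'
      rw [h1] at hy0'
      have h2 : (m + n - 1) * (-m) ^ 2 = m * n := by exact_mod_cast hy0'
      have h3 : m * ((m + n) * (m - 1)) = 0 := by linear_combination h2
      simp at h3
      omega) (by
      intro h'
      have h1 : y0 = n := by linear_combination h'
      rw [h1] at hy0'
      have h2 : (m + n - 1) * n ^ 2 = m * n := by exact_mod_cast hy0'
      have h3 : n * ((m + n) * (n - 1)) = 0 := by linear_combination h2
      simp at h3
      omega) (Or.inr (Or.inl hy0'))
    rw [map_add, r1] at this
    linear_combination this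
  have w1 : (starRingEnd ℂ) (δ * y) = δ * y := by
    have := hgen y (by
      intro h'
      have h1 : y = -m := by linear_combination h'
      rw [h1] at hy'
      have h2 : (m + n - 1) * (m + n - 2) * (-m) ^ 3 - 3 * (m * n) * (m + n - 2) * (-m)
        + 2 * (m - n) * (m * n) = 0 := by exact_mod_cast hy'
      have h3 : m * ((m - 1) * ((m - 2) * (m + n) ^ 2)) = 0 := by linear_combination -h2
      simp at h3
      omega) (by
      intro h'
      have h1 : y = n := by linear_combination h'
      rw [h1] at hy'
      have h2 : (m + n - 1) * (m + n - 2) * n ^ 3 - 3 * (m * n) * (m + n - 2) * n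
        + 2 * (m - n) * (m * n) = 0 := by exact_mod_cast hy'
      have h3 : n * ((n - 1) * ((n - 2) * (m + n) ^ 2)) = 0 := by linear_combination h2
      simp at h3
      omega) (Or.inr (Or.inr hy'))
    rw [map_add, r1] at this
    linear_combination this
  obtain ⟨ρ, hρ⟩ := conj_real_of (ρ := (δ * y) / (δ * y0)) (by rw [map_div₀, w0, w1])
  have hρ' : y = ρ * y0 := by rw [← hρ]; field_simp
  rw [hρ'] at hy'
  have e1 : ((m : ℂ) + n - 2) * y0 * (ρ ^ 3 - 3 * ρ) = -2 * (m - n) := by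
    apply mul_left_cancel₀ (mul_ne_zero hmc hnc)
    linear_combination hy' - (m + n - 2) * y0 * ρ ^ 3 * hy0'
  have e2 : ((m : ℂ) + n - 2) ^ 2 * (m * n) * (ρ ^ 3 - 3 * ρ) ^ 2
      = 4 * (m - n) ^ 2 * (m + n - 1) := by
    rw [← hy0']
    linear_combination (m + n - 1) * (((m : ℂ) + n - 2) * y0 * (ρ ^ 3 - 3 * ρ) - 2 * (m - n)) * e1
  have e3 : ((m : ℝ) + n - 2) ^ 2 * (m * n) * (ρ ^ 3 - 3 * ρ) ^ 2
      = 4 * (m - n) ^ 2 * (m + n - 1) := by exact_mod_cast e2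
  have m' : (m : ℝ) < 0 := by exact_mod_cast hmneg
  have n' : (n : ℝ) < 0 := by exact_mod_cast hnneg
  have e4 : 0 ≤ ((m : ℝ) + n - 2) ^ 2 * (m * n) * (ρ ^ 3 - 3 * ρ) ^ 2 := by
    have : 0 < (m : ℝ) * n := mul_pos_of_neg_of_neg m' n'
    positivity
  have e5 : (m : ℝ) = n := by
    by_contra hne
    have : 0 < ((m : ℝ) - n) ^ 2 := by
      have := sub_ne_zero.2 hne
      positivity
    nlinarith
  have e6 : m = n := by exact_mod_cast e5
  subst e6
  have e7 : ((starRingEnd ℂ) δ) ^ 2 = δ ^ 2 := by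
    have a1 := congrArg (starRingEnd ℂ) hy0'
    simp only [map_mul, map_sub, map_add, map_pow, map_intCast, map_one] at a1
    rw [map_mul] at w0
    have hc : (starRingEnd ℂ) y0 ≠ 0 := by simpa using hy00
    have a2 : ((starRingEnd ℂ) y0) ^ 2 = y0 ^ 2 := by
      apply mul_left_cancel₀ hS1
      rw [a1, hy0']
    apply mul_right_cancel₀ (pow_ne_zero 2 hy00)
    rw [← mul_pow δ, ← w0, mul_pow, a2]
  have cp : (starRingEnd ℂ) p = z1 - m * (starRingEnd ℂ) δ := by rw [hp]; simp [r1]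
  have cr : (starRingEnd ℂ) r = z1 + m * (starRingEnd ℂ) δ := by rw [hr]; simp [r1]
  refine hf.contra h (by simp) (by simp) ?_ (by simp) ?_ ?_
  · simp only [map_sub, map_neg, map_mul, map_intCast, cp, cr]
    rw [hp, hr]; ring
  · simp only [map_neg, map_add, cp, cr]
    rw [hp, hr]; ring
  · simp only [map_mul, cp, cr]
    rw [hp, hr]
    linear_combination -(m : ℂ) ^ 2 * e7

lemma case1 {f : ℂ → ℂ} (hf : Good f) (hr : IsRatFn (fun z => deriv f z / f z)) : Concl f := by
  obtain ⟨s1, s0, q2, q1, q0, hne, h⟩ := case1_ode hf.h0 hf.h1 hf.h2 hf.h3 hf.hs hr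
  have hord : ∀ z, ∃ n : ℤ, meromorphicOrderAt f z = n := fun z => by
    obtain ⟨n, hn⟩ := WithTop.ne_top_iff_exists.1 (order_ne_top hf.h0.1 hf.ne z)
    exact ⟨n, hn.symm⟩
  by_cases h2 : q2 = 0
  · subst h2
    by_cases h1 : q1 = 0
    · subst h1
      have h0 : q0 ≠ 0 := by simpa using hne
      refine case_La hf (α := s1 / q0) (β := s0 / q0) ?_
      unfold Ode at h ⊢
      filter_upwards [h] with z a
      field_simp
      linear_combination a
    · obtain ⟨m, hm⟩ := hord (-q0 / q1)
      have hres := res_lemma (hf.h0.1 _) hm (q := fun _ => q1) (s := fun z => s1 * z + s0)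
        (by fun_prop) (by fun_prop) (by
          unfold Ode at h
          filter_upwards [h] with z a
          rw [← a]; field_simp; ring)
      refine case_Lb hf (α := s1 / q1) hm ?_
      unfold Ode at h ⊢
      filter_upwards [h] with z a
      have hm' : (m : ℂ) = (s1 * (-q0 / q1) + s0) / q1 := by rw [hres]; field_simp
      rw [hm']
      field_simp
      linear_combination q1 * a
  · obtain ⟨w, hw⟩ := exists_sqrt (q1 ^ 2 - 4 * q2 * q0)
    obtain ⟨p, hp⟩ : ∃ p, p = (-q1 + w) / (2 * q2) := ⟨_, rfl⟩
    obtain ⟨r, hr⟩ : ∃ r, r = (-q1 - w) / (2 * q2) := ⟨_, rfl⟩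
    have e1 : q1 = -q2 * (p + r) := by rw [hp, hr]; field_simp; ring
    have e0 : q0 = q2 * (p * r) := by
      rw [hp, hr]; field_simp; linear_combination hw
    clear hp hr hw
    subst e1 e0
    obtain ⟨m, hm⟩ := hord p
    obtain ⟨n, hn⟩ := hord r
    have res1 := res_lemma (hf.h0.1 _) hm (q := fun z => q2 * (z - r)) (s := fun z => s1 * z + s0)
        (by fun_prop) (by fun_prop) (by
          unfold Ode at h
          filter_upwards [h] with z a
          rw [← a]; ring)
    have res2 := res_lemma (hf.h0.1 _) hn (q := fun z => q2 * (z - p)) (s := fun z => s1 * z + s0)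
        (by fun_prop) (by fun_prop) (by
          unfold Ode at h
          filter_upwards [h] with z a
          rw [← a]; ring)
    by_cases hpr : p = r
    · subst hpr
      simp only [sub_self, mul_zero] at res1
      have h' : ∀ᶠ z in codiscrete ℂ, deriv f z * ((z - p) * q2) = f z * s1 := by
        unfold Ode at h
        filter_upwards [h, quad_ev_ne (a := 0) (b := 1) (c := -p) (by simp)] with z a b
        apply mul_right_cancel₀ b
        linear_combination a + f z * res1
      have res3 := res_lemma (hf.h0.1 _) hm (q := fun z => q2) (s := fun z => s1)
        (by fun_prop) (by fun_prop) h'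
      refine case_Lb0 hf (z0 := p) (m := m) ?_
      unfold Ode
      filter_upwards [h'] with z a
      apply mul_right_cancel₀ h2
      rw [res3] at a
      linear_combination a
    · refine case_Ld hf hpr hm hn ?_
      unfold Ode at h ⊢
      filter_upwards [h] with z a
      apply mul_left_cancel₀ h2
      have hd : p - r ≠ 0 := sub_ne_zero.2 hpr
      have t1 : s1 = q2 * (m + n) := by
        apply mul_right_cancel₀ hd
        linear_combination res1 - res2
      have t0 : s0 = q2 * (-(m * r) - n * p) := by
        rw [t1] at res1
        linear_combination res1
      rw [t1, t0] at a
      linear_combination a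

/-! ### The second case -/

/-- Approaching infinity while avoiding a closed discrete set. -/
noncomputable def inftyF : Filter ℂ := Bornology.cobounded ℂ ⊓ codiscrete ℂ

instance inftyF_neBot : inftyF.NeBot := by
  rw [inftyF, Filter.inf_neBot_iff]
  intro s hs t ht
  obtain ⟨R, -, hR⟩ := (Metric.hasBasis_cobounded_compl_closedBall (0 : ℂ)).mem_iff.1 hs
  have h1 := (ev_iff (P := fun z => z ∈ t)).1 ht ((|R| + 1 : ℝ) : ℂ)
  have h2 : ∀ᶠ w in 𝓝[≠] ((|R| + 1 : ℝ) : ℂ), w ∈ (Metric.closedBall (0 : ℂ) R)ᶜ := by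
    refine nhdsWithin_le_nhds ((Metric.isClosed_closedBall.isOpen_compl).mem_nhds ?_)
    simp only [Set.mem_compl_iff, Metric.mem_closedBall, dist_zero_right, Complex.norm_real,
      Real.norm_eq_abs, not_le]
    rw [abs_of_nonneg (by positivity)]
    linarith [le_abs_self R]
  obtain ⟨w, a, b⟩ := (h1.and h2).exists
  exact ⟨w, hR b, a⟩

lemma inftyF_ev {P : ℂ → Prop} (h : ∀ᶠ z in codiscrete ℂ, P z) : ∀ᶠ z in inftyF, P z :=
  h.filter_mono inf_le_right

lemma inftyF_inv : Tendsto (fun z : ℂ => z⁻¹) inftyF (𝓝 0) :=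
  (Filter.tendsto_inv₀_cobounded (α := ℂ)).mono_left inf_le_left

lemma inftyF_lin {a b : ℂ} {F : ℂ → ℂ} (hF : Tendsto F inftyF (𝓝 b))
    (h : ∀ᶠ z in codiscrete ℂ, a * z = F z) : a = 0 := by
  have h1 : Tendsto (fun z => F z * z⁻¹) inftyF (𝓝 (b * 0)) := hF.mul inftyF_inv
  have hz : ∀ᶠ z in codiscrete ℂ, z ≠ 0 := by
    filter_upwards [quad_ev_ne (a := 0) (b := 1) (c := 0) (by simp)] with z hz h0
    exact hz (by simp [h0])
  have h2 : Tendsto (fun _ : ℂ => a) inftyF (𝓝 (b * 0)) := by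
    refine h1.congr' ?_
    filter_upwards [inftyF_ev h, inftyF_ev hz] with z e1 e2
    rw [← e1]; field_simp
  simpa using tendsto_nhds_unique tendsto_const_nhds h2

lemma logderiv_lim {p : Polynomial ℂ} (hp : p ≠ 0) :
    Tendsto (fun z => p.derivative.eval z / p.eval z) inftyF (𝓝 0) := by
  have h1 : Tendsto (fun z => (p.roots.map fun w => 1 / (z - w)).sum) inftyF (𝓝 0) := by
    generalize p.roots = s
    induction s using Multiset.induction_on with
    | empty => simp
    | cons a s ih =>
      simp only [Multiset.map_cons, Multiset.sum_cons]
      have : Tendsto (fun z : ℂ => 1 / (z - a)) inftyF (𝓝 0) := by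
        have := ((Filter.tendsto_inv₀_cobounded (α := ℂ)).comp
          (tendsto_sub_const_cobounded a)).mono_left (inf_le_left (b := codiscrete ℂ))
        simpa [Function.comp_def, inftyF] using this
      simpa using this.add ih
  refine h1.congr' ?_
  filter_upwards [inftyF_ev (ev_poly_ne hp)] with z hz
  rw [(IsAlgClosed.splits p).eval_derivative_div_eval_of_ne_zero hz]

lemma logderiv_lim2 {p : Polynomial ℂ} (hp : p ≠ 0) :
    Tendsto (fun z => p.derivative.derivative.eval z / p.eval z) inftyF (𝓝 0) := by
  by_cases hp' : p.derivative = 0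
  · simp [hp']
  have := (logderiv_lim hp').mul (logderiv_lim hp)
  rw [mul_zero] at this
  refine this.congr' ?_
  filter_upwards [inftyF_ev (ev_poly_ne hp')] with z hz
  field_simp

lemma rat_logderiv_lim {T : ℂ → ℂ} (hT : IsRatFn T) (hT0 : ∀ᶠ z in codiscrete ℂ, T z ≠ 0) :
    Tendsto (fun z => deriv T z / T z) inftyF (𝓝 0) ∧
      Tendsto (deriv (fun z => deriv T z / T z)) inftyF (𝓝 0) := by
  obtain ⟨p, q, hq, hpq⟩ := hT
  rw [meroEq_iff] at hpq
  have hp : p ≠ 0 := by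
    rintro rfl
    obtain ⟨z, a, b⟩ := (hpq.and hT0).exists
    simp at a
    exact b a
  have e1 : ∀ᶠ z in codiscrete ℂ, deriv T z / T z
      = p.derivative.eval z / p.eval z - q.derivative.eval z / q.eval z := by
    filter_upwards [ev_deriv hpq, hpq, ev_poly_ne hp, ev_poly_ne hq] with z a b c d
    rw [a, b, ((p.hasDerivAt z).fun_div (q.hasDerivAt z) d).deriv]
    field_simp
  have e2 : ∀ᶠ z in codiscrete ℂ, deriv (fun z => deriv T z / T z) z
      = (p.derivative.derivative.eval z / p.eval z
          - (p.derivative.eval z / p.eval z) * (p.derivative.eval z / p.eval z))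
        - (q.derivative.derivative.eval z / q.eval z
          - (q.derivative.eval z / q.eval z) * (q.derivative.eval z / q.eval z)) := by
    filter_upwards [ev_deriv e1, ev_poly_ne hp, ev_poly_ne hq] with z a c d
    rw [a, (((p.derivative.hasDerivAt z).fun_div (p.hasDerivAt z) c).fun_sub
      ((q.derivative.hasDerivAt z).fun_div (q.hasDerivAt z) d)).deriv]
    field_simp
  constructor
  · have := (logderiv_lim hp).sub (logderiv_lim hq)
    rw [sub_zero] at this
    refine this.congr' ?_
    filter_upwards [inftyF_ev e1] with z hz using hz.symm
  · have := ((logderiv_lim2 hp).sub ((logderiv_lim hp).mul (logderiv_lim hp))).sub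
      ((logderiv_lim2 hq).sub ((logderiv_lim hq).mul (logderiv_lim hq)))
    simp only [mul_zero, sub_zero] at this
    refine this.congr' ?_
    filter_upwards [inftyF_ev e2] with z hz using hz.symm

lemma case2 {f : ℂ → ℂ} (hf : Good f) {A : ℝ} {B : ℂ} {T : ℂ → ℂ} (hA : A ≠ 0) (hB : B ≠ 0)
    (hT : IsRatFn T) (hT1 : ∀ x : ℝ, ‖T (x : ℂ)‖ = 1)
    (h : ∀ᶠ z in codiscrete ℂ, f z = B * (1 - T z * Complex.exp (Complex.I * (A : ℂ) * z))) :
    Concl f := by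
  obtain ⟨c, hc⟩ : ∃ c : ℂ, c = I * A := ⟨_, rfl⟩
  have hc0 : c ≠ 0 := by rw [hc]; exact mul_ne_zero I_ne_zero (by exact_mod_cast hA)
  obtain ⟨E, hE⟩ : ∃ E : ℂ → ℂ, E = fun z => T z * exp (c * z) := ⟨_, rfl⟩
  have hTm := hT.meromorphic
  have hexpm : Meromorphic (fun z : ℂ => exp (c * z)) := fun z => by
    have : Differentiable ℂ (fun z : ℂ => exp (c * z)) := by fun_prop
    exact (this.analyticAt z).meromorphicAt
  have hEm : Meromorphic E := by rw [hE]; exact fun z => (hTm z).fun_mul (hexpm z)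
  have hEt := meromorphic_mtilde hEm
  -- `E` has modulus one on the real axis
  have hEE : ∀ᶠ z in codiscrete ℂ, E z * mtilde E z = 1 := by
    have hF : Meromorphic (fun z => E z * mtilde E z - 1) := fun z =>
      ((hEm z).fun_mul (hEt z)).fun_sub (MeromorphicAt.const _ _)
    have hreal : ∀ x : ℝ, E x * mtilde E x - 1 = 0 := by
      intro x
      simp only [mtilde, conj_ofReal, mul_conj, normSq_eq_norm_sq]
      have : ‖E x‖ = 1 := by
        rw [hE, hc]
        simp only [norm_mul, hT1, one_mul, norm_exp]
        simp
      rw [this]; simp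
    have := ev_zero_of_local hF (x := 0) (by
      have ht : Tendsto (fun x : ℝ => (x : ℂ)) (𝓝[≠] 0) (𝓝[≠] 0) := by
        refine tendsto_nhdsWithin_iff.2 ⟨?_, ?_⟩
        · have := (continuous_ofReal.tendsto (0 : ℝ)).mono_left
            (nhdsWithin_le_nhds (s := ({0} : Set ℝ)ᶜ))
          simpa using this
        · filter_upwards [self_mem_nhdsWithin] with x hx
          simpa using hx
      exact ht.frequently (Eventually.of_forall hreal).frequently)
    filter_upwards [this] with z hz
    linear_combination hz
  have hE0 : ∀ᶠ z in codiscrete ℂ, E z ≠ 0 := by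
    filter_upwards [hEE] with z hz h0
    simp [h0] at hz
  have hT0 : ∀ᶠ z in codiscrete ℂ, T z ≠ 0 := by
    filter_upwards [hE0] with z hz h0
    apply hz; rw [hE]; simp [h0]
  obtain ⟨lim1, lim2⟩ := rat_logderiv_lim hT hT0
  obtain ⟨l, hl⟩ : ∃ l : ℂ → ℂ, l = fun z => deriv E z / E z := ⟨_, rfl⟩
  have hlT : ∀ᶠ z in codiscrete ℂ, l z = c + deriv T z / T z := by
    filter_upwards [ev_analytic hTm, hT0] with z a b
    have hx : HasDerivAt (fun z : ℂ => exp (c * z)) (exp (c * z) * c) z := by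
      simpa using ((hasDerivAt_id' z).const_mul c).cexp
    rw [hl, hE]
    simp only
    rw [(a.differentiableAt.hasDerivAt.fun_mul hx).deriv]
    have := exp_ne_zero (c * z)
    field_simp
    ring
  have hlr : IsRatFn l := ((IsRatFn.const c).add (hT.deriv.div hT)).congr hlT
  have hlm := hlr.meromorphic
  have hdl : ∀ᶠ z in codiscrete ℂ, deriv l z = deriv (fun z => deriv T z / T z) z := by
    filter_upwards [ev_deriv hlT] with z a
    rw [a]; exact deriv_const_add _
  have liml : Tendsto l inftyF (𝓝 c) := by
    have := (tendsto_const_nhds (x := c)).add lim1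
    rw [add_zero] at this
    refine this.congr' ?_
    filter_upwards [inftyF_ev hlT] with z hz using hz.symm
  have limdl : Tendsto (deriv l) inftyF (𝓝 0) := by
    refine lim2.congr' ?_
    filter_upwards [inftyF_ev hdl] with z hz using hz.symm
  have hEl : ∀ᶠ z in codiscrete ℂ, deriv E z = l z * E z := by
    filter_upwards [hE0] with z hz
    rw [hl]; field_simp
  have hltil : ∀ᶠ z in codiscrete ℂ, mtilde l z = - l z := by
    filter_upwards [hEE, ev_deriv hEE, ev_analytic hEm, ev_analytic hEt, hE0, ev_mtilde_ne hE0]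
      with z a b c d e g
    rw [(c.differentiableAt.hasDerivAt.fun_mul d.differentiableAt.hasDerivAt).deriv,
      deriv_const, mtilde_deriv] at b
    have : mtilde l z = mtilde (deriv E) z / mtilde E z := by rw [hl]; simp [mtilde]
    rw [this, hl]
    field_simp
    linear_combination b
  have hdltil : ∀ᶠ z in codiscrete ℂ, mtilde (deriv l) z = - deriv l z := by
    filter_upwards [ev_deriv hltil] with z a
    rw [← mtilde_deriv, a]
    exact deriv.fun_neg
  -- derivatives of `f`
  have d1 : ∀ᶠ z in codiscrete ℂ, deriv f z = -B * (l z * E z) := by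
    have h' : ∀ᶠ z in codiscrete ℂ, f z = B * (1 - E z) := by
      filter_upwards [h] with z a
      rw [a, hE, hc]
    filter_upwards [ev_deriv h', ev_analytic hEm, hEl] with z a b e
    rw [a, ((b.differentiableAt.hasDerivAt.const_sub 1).const_mul B).deriv, e]
    ring
  have d2 : ∀ᶠ z in codiscrete ℂ, deriv (deriv f) z = -B * ((deriv l z + l z ^ 2) * E z) := by
    filter_upwards [ev_deriv d1, ev_analytic hEm, ev_analytic hlm, hEl] with z a b e g
    rw [a, ((e.differentiableAt.hasDerivAt.fun_mul
      b.differentiableAt.hasDerivAt).const_mul (-B)).deriv, g]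
    ring
  have l0 : ∀ᶠ z in codiscrete ℂ, l z ≠ 0 := by
    filter_upwards [d1, ev_ne_of_real hf.h1.1 hf.h1.2] with z a b h0
    apply b; rw [a, h0]; ring
  have l1 : ∀ᶠ z in codiscrete ℂ, deriv l z + l z ^ 2 ≠ 0 := by
    filter_upwards [d2, ev_ne_of_real hf.h2.1 hf.h2.2] with z a b h0
    apply b; rw [a, h0]; ring
  have l2 : ∀ᶠ z in codiscrete ℂ, deriv l z - l z ^ 2 ≠ 0 := by
    filter_upwards [ev_mtilde_ne l1, hltil, hdltil] with z a b d h0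
    apply a
    have : mtilde (fun z => deriv l z + l z ^ 2) z = mtilde (deriv l) z + mtilde l z ^ 2 := by
      simp [mtilde]
    rw [this, b, d]
    linear_combination -h0
  have hu : ∀ᶠ z in codiscrete ℂ, deriv f z / deriv (deriv f) z = l z / (deriv l z + l z ^ 2) := by
    filter_upwards [d1, d2, hE0, l1] with z a b e g
    rw [a, b]
    field_simp
  have hv : ∀ᶠ z in codiscrete ℂ, mtilde (fun z => deriv f z / deriv (deriv f) z) z
      = l z / (deriv l z - l z ^ 2) := by
    filter_upwards [ev_mtilde hu, hltil, hdltil, l2] with z a b d g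
    have : mtilde (fun z => l z / (deriv l z + l z ^ 2)) z
        = mtilde l z / (mtilde (deriv l) z + mtilde l z ^ 2) := by
      simp [mtilde]
    rw [a, this, b, d]
    have g' : - deriv l z + (- l z) ^ 2 ≠ 0 := by
      intro h0; apply g; linear_combination -h0
    rw [div_eq_div_iff g' g]
    ring
  have hr1 : IsRatFn (fun z => deriv (deriv f) z / deriv f z) := by
    refine ((hlr.deriv.add (hlr.mul hlr)).div hlr).congr ?_
    filter_upwards [d1, d2, hE0, l0] with z a b e g
    rw [a, b]
    field_simp
  obtain ⟨K, C, hK, hkey⟩ := keyA hf.h1 hf.h2 hf.h3 hr1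
  have hkey' : ∀ᶠ z in codiscrete ℂ, l z / (deriv l z + l z ^ 2)
      = z + K * (l z / (deriv l z - l z ^ 2) - z) + C := by
    filter_upwards [hkey, hu, hv] with z a b d
    rw [← b, a, d]
  have limu : Tendsto (fun z => l z / (deriv l z + l z ^ 2)) inftyF (𝓝 (1 / c)) := by
    have := liml.div (limdl.add (liml.pow 2)) (by simpa using hc0)
    have e : c / (0 + c ^ 2) = 1 / c := by field_simp; ring
    rwa [e] at this
  have limv : Tendsto (fun z => l z / (deriv l z - l z ^ 2)) inftyF (𝓝 (-1 / c)) := by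
    have := liml.div (limdl.sub (liml.pow 2)) (by simpa using hc0)
    have e : c / (0 - c ^ 2) = -1 / c := by
      rw [zero_sub]; field_simp
    rwa [e] at this
  have hK1 : 1 - K = 0 := by
    refine inftyF_lin ((limu.sub (limv.const_mul K)).sub (tendsto_const_nhds (x := C))) ?_
    filter_upwards [hkey'] with z a
    rw [a]; ring
  have hK2 : K = 1 := by linear_combination -hK1
  subst hK2
  have hC : C = 2 / c := by
    have t1 : Tendsto (fun _ : ℂ => C) inftyF (𝓝 (1 / c - -1 / c)) := by
      refine (limu.sub limv).congr' ?_
      filter_upwards [inftyF_ev hkey'] with z a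
      rw [a]; ring
    have := tendsto_nhds_unique tendsto_const_nhds t1
    rw [this]; ring
  have halg : ∀ᶠ z in codiscrete ℂ, -c * l z ^ 3 = deriv l z ^ 2 - l z ^ 4 := by
    filter_upwards [hkey', l1, l2] with z a b d
    rw [hC] at a
    field_simp at a
    linear_combination a / 2
  obtain ⟨σ, hσ⟩ : ∃ σ : ℂ → ℂ, σ = fun z => (l z)⁻¹ := ⟨_, rfl⟩
  have hσm : Meromorphic σ := by rw [hσ]; exact fun z => (hlm z).fun_inv
  have hdσ : ∀ᶠ z in codiscrete ℂ, deriv σ z = - deriv l z / l z ^ 2 := by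
    filter_upwards [ev_analytic hlm, l0] with z a b
    rw [hσ, (a.differentiableAt.hasDerivAt.fun_inv b).deriv]
  have hσeq : ∀ᶠ z in codiscrete ℂ, deriv σ z * deriv σ z = 1 - c * σ z := by
    filter_upwards [hdσ, l0, halg] with z a b d
    rw [a, hσ]
    field_simp
    linear_combination -d
  have hσ2 : ∀ᶠ z in codiscrete ℂ, deriv σ z * (2 * deriv (deriv σ) z + c) = 0 := by
    filter_upwards [ev_deriv hσeq, ev_analytic hσm, ev_analytic hσm.deriv] with z a b d
    rw [(d.differentiableAt.hasDerivAt.fun_mul d.differentiableAt.hasDerivAt).deriv,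
      ((b.differentiableAt.hasDerivAt.const_mul c).const_sub 1).deriv] at a
    linear_combination a
  have hσ0 : ∀ᶠ z in codiscrete ℂ, deriv σ z = 0 := by
    refine (ev_zero_or_ne hσm.deriv).resolve_right fun hne => ?_
    have hlinm : Meromorphic (fun z : ℂ => c / 2 * z) := fun z => by fun_prop
    obtain ⟨d, hd⟩ := ev_const_of_deriv (F := fun z => deriv σ z + c / 2 * z)
      (fun z => (hσm.deriv z).fun_add (hlinm z)) (by
        filter_upwards [hσ2, hne, ev_analytic hσm.deriv] with z a b e
        rw [(e.differentiableAt.hasDerivAt.fun_add ((hasDerivAt_id' z).const_mul (c / 2))).deriv]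
        have := (mul_eq_zero.1 a).resolve_left b
        linear_combination this / 2)
    have limσ : Tendsto (fun z => - deriv l z / l z ^ 2) inftyF (𝓝 (-0 / c ^ 2)) :=
      limdl.neg.div (liml.pow 2) (pow_ne_zero 2 hc0)
    have := inftyF_lin (a := c / 2) ((tendsto_const_nhds (x := d)).sub limσ) (by
      filter_upwards [hd, hdσ] with z a b
      rw [← b]; linear_combination a)
    apply hc0
    linear_combination 2 * this
  obtain ⟨κ, hκ⟩ := ev_const_of_deriv hσm hσ0
  have hκl : ∀ᶠ z in codiscrete ℂ, l z = κ⁻¹ := by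
    filter_upwards [hκ] with z a
    rw [← a, hσ, inv_inv]
  obtain ⟨b, hb⟩ : ∃ b, b = κ⁻¹ := ⟨_, rfl⟩
  have dG : ∀ z : ℂ, HasDerivAt (fun z : ℂ => exp (b * z)) (exp (b * z) * b) z := fun z => by
    simpa using ((hasDerivAt_id' z).const_mul b).cexp
  obtain ⟨C', hC', hEC⟩ := ode_unique hEm hE0 (G := fun z => exp (b * z))
    (fun z => by
      have : Differentiable ℂ (fun z : ℂ => exp (b * z)) := by fun_prop
      exact (this.analyticAt z).meromorphicAt) (Eventually.of_forall fun z => exp_ne_zero _)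
    (q := fun _ => 1) (s := fun _ => b)
    (Eventually.of_forall fun z => one_ne_zero)
    (by filter_upwards [hEl, hκl] with z e1 e2
        rw [e1, e2, hb]; ring)
    (Eventually.of_forall fun z => by rw [(dG z).deriv]; ring)
  refine ⟨b, log (-B * C'), -B, 0, 0, Or.inr (Or.inr (meroEq_iff.2 ?_))⟩
  filter_upwards [h, hEC] with z e1 e2
  rw [exp_add, exp_log (mul_ne_zero (neg_ne_zero.2 hB) hC'), e1]
  rw [hE, hc] at e2
  simp only at e2
  rw [e2]
  ring

/-- Lemma 3.5 of the paper: under the Setup, if `f'/f` is rational or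
`f(z) = B(1 - T(z) exp(i A z))`, and `f` together with its first three derivatives has only
real zeros, then `f` is of one of the three forms of (1.3) of the paper. -/
theorem statement_13 (M : ℕ) (f : ℂ → ℂ) (hs : Setup M f)
    (hcase : IsRatFn (fun z => deriv f z / f z) ∨
      ∃ (A : ℝ) (B : ℂ) (T : ℂ → ℂ), A ≠ 0 ∧ B ≠ 0 ∧ IsRatFn T ∧
        (∀ x : ℝ, ‖T (x : ℂ)‖ = 1) ∧
        MeroEq f (fun z => B * (1 - T z * Complex.exp (Complex.I * (A : ℂ) * z))))
    (hreal : ∀ m, m ≤ 3 → ∀ z : ℂ, 0 < meroOrder (iteratedDeriv m f) z → z.im = 0) :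
    ∃ (a b c d : ℂ) (μ : ℤ),
      MeroEq f (fun z => (a * z + b) ^ μ) ∨
      MeroEq f (fun z => (a * z + b) / (c * z + d)) ∨
      MeroEq f (fun z => Complex.exp (a * z + b) - c) := by
  obtain ⟨-, hf, hs, -⟩ := hs
  have hf0 : Meromorphic f := hf
  have h0 : RealZeros f := ⟨hf0, fun z hz => hreal 0 (by norm_num) z (by
    rwa [iteratedDeriv_zero, meroOrder_eq hf0])⟩
  have h1 : RealZeros (deriv f) := ⟨hf0.deriv, fun z hz => hreal 1 (by norm_num) z (by
    rwa [iteratedDeriv_one, meroOrder_eq hf0.deriv])⟩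
  have h2 : RealZeros (deriv (deriv f)) := ⟨hf0.deriv.deriv, fun z hz => hreal 2 (by norm_num) z (by
    rwa [iteratedDeriv_succ, iteratedDeriv_one, meroOrder_eq hf0.deriv.deriv])⟩
  have h3 : RealZeros (deriv (deriv (deriv f))) :=
    ⟨hf0.deriv.deriv.deriv, fun z hz => hreal 3 (by norm_num) z (by
      rwa [iteratedDeriv_succ, iteratedDeriv_succ, iteratedDeriv_one,
        meroOrder_eq hf0.deriv.deriv.deriv])⟩
  have hg : Good f := ⟨h0, h1, h2, h3, hs⟩
  rcases hcase with hr | ⟨A, B, T, hA, hB, hT, hT1, hfT⟩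
  · exact case1 hg hr
  · exact case2 hg hA hB hT hT1 (meroEq_iff.1 hfT)
end

section
/- Under the Setup, there do not exist integers m₁, m₂, m₃ with m₁ ≥ 1, m₂ ≥ m₁ + 2 and M ≥ m₃ ≥ m₂ + 2 such that, for each m ∈ {m₁, m₂, m₃}, the exponent a_m in the representation K_m(z) = R_m(z)·e^{i a_m z} is nonzero. -/
open Complex Filter Topology MeasureTheory
open scoped Classical

section Helpers

open Metric Set


lemma exists_log_ball {g : ℂ → ℂ} {c : ℂ} {r : ℝ} (hg : DifferentiableOn ℂ g (ball c r))
    (h0 : ∀ z ∈ ball c r, g z ≠ 0) :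
    ∃ u : ℂ → ℂ, DifferentiableOn ℂ u (ball c r) ∧
      ∀ z ∈ ball c r, Complex.exp (u z) = g z ∧ deriv u z = deriv g z / g z := by
  rcases le_or_gt r 0 with hr | hr
  · refine ⟨fun _ => 0, by fun_prop, ?_⟩
    intro z hz
    rw [ball_eq_empty.2 hr] at hz
    exact absurd hz (by simp)
  have hd : DifferentiableOn ℂ (fun z => deriv g z / g z) (ball c r) :=
    (hg.deriv isOpen_ball).div hg h0
  obtain ⟨U, hU⟩ := hd.isExactOn_ball
  have hc : c ∈ ball c r := mem_ball_self hr
  have hgd : ∀ z ∈ ball c r, HasDerivAt g (deriv g z) z := fun z hz =>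
    ((hg z hz).differentiableAt (isOpen_ball.mem_nhds hz)).hasDerivAt
  have hconst : ∀ z ∈ ball c r, g z * exp (-U z) = g c * exp (-U c) := by
    intro z hz
    have hder : ∀ w ∈ ball c r, HasDerivAt (fun w => g w * exp (-U w)) 0 w := by
      intro w hw
      have := (hgd w hw).mul ((hU w hw).neg.cexp)
      refine this.congr_deriv ?_
      have := h0 w hw
      simp only [Pi.neg_apply]
      field_simp
      ring
    exact (convex_ball c r).is_const_of_fderivWithin_eq_zero (𝕜 := ℂ)
      (fun w hw => (hder w hw).differentiableAt.differentiableWithinAt)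
      (fun w hw => by
        rw [fderivWithin_of_isOpen isOpen_ball hw]
        ext
        simp [(hder w hw).deriv]) hz hc
  have hk : g c * exp (-U c) ≠ 0 := mul_ne_zero (h0 c hc) (exp_ne_zero _)
  refine ⟨fun z => U z + log (g c * exp (-U c)), ?_, ?_⟩
  · intro z hz
    exact ((hU z hz).add_const _).differentiableAt.differentiableWithinAt
  · intro z hz
    constructor
    · rw [exp_add, exp_log hk, ← hconst z hz, mul_comm (g z), ← mul_assoc, ← exp_add]
      simp
    · exact ((hU z hz).add_const _).deriv

lemma pos_re_schwarz {u : ℂ → ℂ} {c : ℂ} {d : ℝ} (hd : 0 < d)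
    (hu : DifferentiableOn ℂ u (ball c d)) (hpos : ∀ z ∈ ball c d, 0 < (u z).re) :
    ‖deriv u c‖ ≤ 2 * (u c).re / d ∧
    ∀ z ∈ ball c d, |(u z).re - (u c).re| ≤ dist z c / d * ((u z).re + (u c).re) := by
  have hc : c ∈ ball c d := mem_ball_self hd
  set b := (starRingEnd ℂ) (u c) with hb
  have hbre : b.re = (u c).re := by simp [hb]
  have hbim : b.im = -(u c).im := by simp [hb]
  have hne : ∀ z ∈ ball c d, u z + b ≠ 0 := by
    intro z hz h
    have := congrArg re h
    simp only [add_re, zero_re] at this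
    linarith [hpos z hz, hpos c hc]
  set w : ℂ → ℂ := fun z => (u z - u c) / (u z + b) with hw
  have hwd : DifferentiableOn ℂ w (ball c d) :=
    (hu.sub_const _).div (hu.add_const _) hne
  have hwc : w c = 0 := by simp [hw]
  have sqs : ∀ z, ‖u z - u c‖ ^ 2 = ((u z).re - (u c).re) ^ 2 + ((u z).im - (u c).im) ^ 2 := by
    intro z
    rw [← normSq_eq_norm_sq, normSq_apply]; simp; ring
  have sqa : ∀ z, ‖u z + b‖ ^ 2 = ((u z).re + (u c).re) ^ 2 + ((u z).im - (u c).im) ^ 2 := by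
    intro z
    rw [← normSq_eq_norm_sq, normSq_apply]; simp [hbre, hbim]; ring
  have hmaps : MapsTo w (ball c d) (closedBall (w c) 1) := by
    intro z hz
    rw [hwc, mem_closedBall_zero_iff]
    simp only [hw, norm_div]
    apply div_le_one_of_le₀ _ (norm_nonneg _)
    apply le_of_sq_le_sq _ (norm_nonneg _)
    rw [sqs, sqa]
    nlinarith [hpos z hz, hpos c hc, mul_pos (hpos z hz) (hpos c hc)]
  constructor
  · have h1 := norm_deriv_le_div_of_mapsTo_ball hwd hmaps hd
    have hud : HasDerivAt u (deriv u c) c :=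
      ((hu c hc).differentiableAt (isOpen_ball.mem_nhds hc)).hasDerivAt
    have h2 : HasDerivAt w (deriv u c / (u c + b)) c := by
      have := (hud.sub_const (u c)).div (hud.add_const b) (hne c hc)
      refine this.congr_deriv ?_
      have := hne c hc
      field_simp
      simp
    rw [h2.deriv, norm_div] at h1
    have h3 : ‖u c + b‖ = 2 * (u c).re := by
      have : u c + b = ((2 * (u c).re : ℝ) : ℂ) := by
        apply Complex.ext <;> simp [hbre, hbim]; ring
      rw [this, norm_real, Real.norm_of_nonneg]
      linarith [hpos c hc]
    rw [h3, div_le_iff₀ (by linarith [hpos c hc])] at h1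
    calc _ ≤ _ := h1
      _ = _ := by ring
  · intro z hz
    have h1 := dist_le_div_mul_dist_of_mapsTo_ball hwd hmaps hz
    rw [hwc, dist_zero_right] at h1
    set t := dist z c / d with ht
    have ht0 : 0 ≤ t := by positivity
    have ht1 : t ≤ 1 := by
      rw [ht, div_le_one hd]; exact (mem_ball.1 hz).le
    have h2 : ‖w z‖ ≤ t := by rw [ht]; linarith [h1, show 1 / d * dist z c = dist z c / d by ring]
    simp only [hw, norm_div] at h2
    rw [div_le_iff₀ (norm_pos_iff.2 (hne z hz))] at h2
    have h3 : ‖u z - u c‖ ^ 2 ≤ t ^ 2 * ‖u z + b‖ ^ 2 := by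
      rw [← mul_pow]; gcongr
    rw [sqs, sqa] at h3
    have hp1 := hpos z hz
    have hp2 := hpos c hc
    apply abs_le_of_sq_le_sq _ (by positivity)
    have ht2 : t ^ 2 ≤ 1 := by nlinarith
    nlinarith [sq_nonneg ((u z).im - (u c).im), mul_nonneg (sub_nonneg.2 ht2) (sq_nonneg ((u z).im - (u c).im))]

lemma exists_zero_of_contract {h : ℂ → ℂ} {z0 : ℂ} {ε k : ℝ} (hε : 0 ≤ ε) (hk0 : 0 ≤ k) (hk : k < 1)
    (hd : ∀ z ∈ closedBall z0 ε, DifferentiableAt ℂ h z)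
    (hk' : ∀ z ∈ closedBall z0 ε, ‖1 - deriv h z‖ ≤ k) (h0 : ‖h z0‖ ≤ (1 - k) * ε) :
    ∃ z ∈ closedBall z0 ε, h z = 0 := by
  set T : ℂ → ℂ := fun z => z - h z with hT
  have hlip : LipschitzOnWith ⟨k, hk0⟩ T (closedBall z0 ε) := by
    apply (convex_closedBall z0 ε).lipschitzOnWith_of_nnnorm_deriv_le (𝕜 := ℂ)
    · intro z hz
      exact differentiableAt_id.sub (hd z hz)
    · intro z hz
      have : deriv T z = 1 - deriv h z := by
        rw [hT]
        exact ((hasDerivAt_id z).sub (hd z hz).hasDerivAt).deriv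
      rw [this]
      exact hk' z hz
  have hz0 : z0 ∈ closedBall z0 ε := mem_closedBall_self hε
  have hmaps : MapsTo T (closedBall z0 ε) (closedBall z0 ε) := by
    intro z hz
    rw [mem_closedBall] at hz ⊢
    have h1 := hlip.dist_le_mul z hz z0 hz0
    have h2 : dist (T z0) z0 ≤ (1 - k) * ε := by
      simpa [hT, dist_eq_norm] using h0
    calc dist (T z) z0 ≤ dist (T z) (T z0) + dist (T z0) z0 := dist_triangle _ _ _
      _ ≤ k * dist z z0 + (1 - k) * ε := add_le_add h1 h2
      _ ≤ k * ε + (1 - k) * ε := by gcongr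
      _ = ε := by ring
  have hcon : ContractingWith ⟨k, hk0⟩ (hmaps.restrict T _ _) := by
    refine ⟨by exact_mod_cast hk, ?_⟩
    exact fun x y => hlip x.2 y.2
  obtain ⟨y, hy, hfix, -⟩ := ContractingWith.exists_fixedPoint' isClosed_closedBall.isComplete hmaps
    hcon hz0 (edist_ne_top _ _)
  refine ⟨y, hy, ?_⟩
  have : y - h y = y := hfix
  simpa using this


lemma log_ball_bound {g : ℂ → ℂ} {c : ℂ} {d : ℝ} (hd : 0 < d)
    (hg : DifferentiableOn ℂ g (ball c d)) (hpos : ∀ z ∈ ball c d, 1 / 4 < ‖g z‖) :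
    ‖deriv g c‖ ≤ ‖g c‖ * (2 * Real.log (4 * ‖g c‖) / d) ∧
    ∀ z ∈ ball c d, |Real.log (4 * ‖g z‖) - Real.log (4 * ‖g c‖)| ≤
      dist z c / d * (Real.log (4 * ‖g z‖) + Real.log (4 * ‖g c‖)) := by
  have hc : c ∈ ball c d := mem_ball_self hd
  have hg4 : DifferentiableOn ℂ (fun z => 4 * g z) (ball c d) := hg.const_mul 4
  have hne : ∀ z ∈ ball c d, g z ≠ 0 := by
    intro z hz h
    have := hpos z hz
    rw [h] at this
    norm_num at this
  obtain ⟨u, hu, hexp⟩ := exists_log_ball hg4 (fun z hz => mul_ne_zero (by norm_num) (hne z hz))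
  have hre : ∀ z ∈ ball c d, (u z).re = Real.log (4 * ‖g z‖) := by
    intro z hz
    have h1 := congrArg norm (hexp z hz).1
    rw [Complex.norm_exp, norm_mul] at h1
    norm_num at h1
    rw [← h1, Real.log_exp]
  have hup : ∀ z ∈ ball c d, 0 < (u z).re := by
    intro z hz
    rw [hre z hz]
    apply Real.log_pos
    linarith [hpos z hz]
  obtain ⟨h1, h2⟩ := pos_re_schwarz hd hu hup
  constructor
  · rw [(hexp c hc).2, hre c hc] at h1
    have hgd : DifferentiableAt ℂ g c := (hg c hc).differentiableAt (isOpen_ball.mem_nhds hc)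
    rw [deriv_const_mul _ hgd, mul_div_mul_left _ _ (by norm_num : (4:ℂ) ≠ 0), norm_div,
      div_le_iff₀ (norm_pos_iff.2 (hne c hc))] at h1
    linarith
  · intro z hz
    have := h2 z hz
    rwa [hre z hz, hre c hc] at this

lemma pomm {g : ℂ → ℂ} {R : ℝ} (hR : 16 ≤ R) (hg : DifferentiableOn ℂ g (ball 0 R))
    (h0 : ‖g 0‖ ≤ 1) (h1 : 2 ≤ ‖deriv g 0‖)
    (h2 : ∀ z ∈ ball (0:ℂ) R, ‖g z‖ ≤ 1 / 4 → ‖deriv g z‖ ≤ 3) :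
    ∀ z : ℂ, ‖z‖ < R / 8 → ‖deriv g z‖ ≤ 3 + 48 * ‖g z‖ := by
  have near : ∃ w ∈ ball (0:ℂ) 2, ‖g w‖ ≤ 1 / 4 := by
    by_contra! hcon
    have hb := (log_ball_bound (by norm_num) (hg.mono (ball_subset_ball (by linarith))) hcon).1
    have hg0 := hcon 0 (by simp)
    have hl : Real.log (4 * ‖g 0‖) < 1.5 := by
      have h4 : Real.log (4 * ‖g 0‖) ≤ Real.log (2 ^ 2) :=
        Real.log_le_log (by linarith) (by linarith)
      rw [Real.log_pow] at h4
      have := Real.log_two_lt_d9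
      push_cast at h4
      linarith
    have hl0 : 0 < Real.log (4 * ‖g 0‖) := Real.log_pos (by linarith)
    nlinarith
  intro ζ hζ
  rcases le_or_gt ‖g ζ‖ (1/4) with hs | hbig
  · have := h2 ζ (by rw [mem_ball_zero_iff]; linarith [norm_nonneg ζ]) hs
    linarith [norm_nonneg (g ζ)]
  obtain ⟨w, hw, hgw⟩ := near
  have hcont : ContinuousOn g (closedBall 0 (R/2)) :=
    hg.continuousOn.mono (closedBall_subset_ball (by linarith))
  set T : Set ℂ := closedBall 0 (R/2) ∩ (fun z => ‖g z‖) ⁻¹' (Iic (1/4)) with hT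
  have hTc : IsClosed T := hcont.norm.preimage_isClosed_of_isClosed isClosed_closedBall isClosed_Iic
  have hTk : IsCompact T := (isCompact_closedBall (0:ℂ) (R/2)).of_isClosed_subset hTc inter_subset_left
  have hw2 : ‖w‖ < 2 := by simpa using hw
  have hTn : T.Nonempty := ⟨w, by rw [mem_closedBall_zero_iff]; linarith, hgw⟩
  obtain ⟨a, haT, ha⟩ := hTk.exists_infDist_eq_dist hTn ζ
  have hmin : ∀ z ∈ T, dist ζ a ≤ dist ζ z := fun z hz => ha ▸ infDist_le_dist_of_mem hz
  set d := dist ζ a with hd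
  have hd0 : 0 < d := by
    rw [hd, dist_pos]
    rintro rfl
    exact absurd haT.2 (by simp; linarith)
  have hdle : d ≤ ‖ζ‖ + 2 := by
    have := hmin w ⟨by rw [mem_closedBall_zero_iff]; linarith, hgw⟩
    have h3 : dist ζ w ≤ ‖ζ‖ + ‖w‖ := by rw [dist_eq_norm]; exact norm_sub_le _ _
    linarith
  have hballR : ball ζ d ⊆ closedBall 0 (R/2) := by
    intro z hz
    rw [mem_closedBall_zero_iff]
    have h3 : ‖z‖ ≤ dist z ζ + ‖ζ‖ := by
      rw [dist_eq_norm]; simpa using norm_add_le (z - ζ) ζ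
    have := mem_ball.1 hz
    linarith
  have hpos : ∀ z ∈ ball ζ d, 1/4 < ‖g z‖ := by
    intro z hz
    by_contra! hcon
    have := hmin z ⟨hballR hz, hcon⟩
    rw [mem_ball, dist_comm] at hz
    linarith
  have hgz : DifferentiableOn ℂ g (ball ζ d) :=
    hg.mono (hballR.trans (closedBall_subset_ball (by linarith)))
  obtain ⟨hb1, hb2⟩ := log_ball_bound hd0 hgz hpos
  set U := Real.log (4 * ‖g ζ‖) with hU
  have hU0 : 0 < U := Real.log_pos (by linarith)
  have haR : a ∈ ball (0:ℂ) R := by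
    have := haT.1
    rw [mem_closedBall_zero_iff] at this
    rw [mem_ball_zero_iff]; linarith
  have hga : HasDerivAt g (deriv g a) a :=
    ((hg a haR).differentiableAt (isOpen_ball.mem_nhds haR)).hasDerivAt
  have hga3 : ‖deriv g a‖ ≤ 3 := h2 a haR haT.2
  -- path
  have hkey : U ≤ 24 * d := by
    have hpath : HasDerivAt (fun t : ℝ => g (a + (t : ℂ) * (ζ - a))) (deriv g a * (ζ - a)) 0 := by
      have h3 : HasDerivAt (fun t : ℂ => a + t * (ζ - a)) (ζ - a) ((0:ℝ):ℂ) := by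
        simpa using ((hasDerivAt_id (((0:ℝ):ℂ))).mul_const (ζ - a)).const_add a
      have h4 : HasDerivAt g (deriv g a) (a + ((0:ℝ):ℂ) * (ζ - a)) := by simpa using hga
      have h5 : HasDerivAt (fun t : ℂ => g (a + t * (ζ - a))) (deriv g a * (ζ - a)) ((0:ℝ):ℂ) :=
        HasDerivAt.comp (((0:ℝ):ℂ)) (h := fun t : ℂ => a + t * (ζ - a)) h4 h3
      exact h5.comp_ofReal
    have hsl := hpath.tendsto_slope_zero_right
    have hn := (hsl.norm).const_mul 4
    have hle : U / 2 ≤ 4 * ‖deriv g a * (ζ - a)‖ := by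
      apply ge_of_tendsto hn
      filter_upwards [Ioo_mem_nhdsGT (zero_lt_one)] with t ht
      have ht0 := ht.1
      have ht1 := ht.2
      have hdist : dist (a + (t:ℂ) * (ζ - a)) ζ = (1 - t) * d := by
        have : a + (t:ℂ) * (ζ - a) - ζ = ((1 - t : ℝ) : ℂ) * (a - ζ) := by push_cast; ring
        rw [dist_eq_norm, this, norm_mul, norm_real, Real.norm_of_nonneg (by linarith), hd,
          dist_comm, dist_eq_norm]
      have hmem : a + (t:ℂ) * (ζ - a) ∈ ball ζ d := by
        rw [mem_ball, hdist]; nlinarith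
      have h5 := hb2 _ hmem
      rw [hdist, mul_div_assoc, div_self hd0.ne', mul_one] at h5
      have h6 := hpos _ hmem
      set q := ‖g (a + (t:ℂ) * (ζ - a))‖ with hq
      have hl0 : 0 < Real.log (4 * q) := Real.log_pos (by linarith)
      have h7 : U * t / 2 ≤ Real.log (4 * q) := by
        have := (abs_le.1 h5).1
        nlinarith
      have h8 : Real.log (4 * q) ≤ 4 * q - 1 := Real.log_le_sub_one_of_pos (by linarith)
      have h9 : ‖g a‖ ≤ 1/4 := haT.2
      have h10 : q ≤ ‖g (a + (t:ℂ) * (ζ - a)) - g a‖ + ‖g a‖ := by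
        simpa [hq] using norm_add_le (g (a + (t:ℂ) * (ζ - a)) - g a) (g a)
      simp only [zero_add, ofReal_zero, zero_mul, add_zero, norm_smul, norm_inv, Real.norm_of_nonneg ht0.le]
      rw [← mul_assoc, mul_comm (4:ℝ), mul_assoc, inv_mul_eq_div, le_div_iff₀ ht0]
      linarith
    rw [norm_mul] at hle
    have hza : ‖ζ - a‖ = d := by rw [hd, dist_eq_norm]
    rw [hza] at hle
    nlinarith
  have : 2 * U / d ≤ 48 := by
    rw [div_le_iff₀ hd0]; linarith
  nlinarith [norm_nonneg (g ζ)]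


lemma growth_bound {g : ℂ → ℂ} {d : ℝ} (hg : DifferentiableOn ℂ g (ball 0 d))
    (h0 : ‖g 0‖ ≤ 1) (h1 : ∀ z : ℂ, ‖z‖ < d → ‖deriv g z‖ ≤ 3 + 48 * ‖g z‖) :
    ∀ z : ℂ, ‖z‖ < d → ‖g z‖ ≤ 4 * Real.exp (49 * ‖z‖) := by
  intro ζ hζ
  rcases eq_or_ne ζ 0 with rfl | hne
  · simp; linarith
  have hn : 0 < ‖ζ‖ := norm_pos_iff.2 hne
  have hmem : ∀ t ∈ Icc (0:ℝ) 1, ‖(t:ℂ) * ζ‖ < d := by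
    intro t ht
    rw [norm_mul, norm_real, Real.norm_of_nonneg ht.1]
    nlinarith [ht.2]
  have hder : ∀ t ∈ Icc (0:ℝ) 1, HasDerivAt (fun t : ℝ => g ((t:ℂ) * ζ)) (deriv g ((t:ℂ)*ζ) * ζ) t := by
    intro t ht
    have hm : (t:ℂ) * ζ ∈ ball (0:ℂ) d := by simpa using hmem t ht
    have h4 : HasDerivAt g (deriv g ((t:ℂ)*ζ)) ((t:ℂ)*ζ) :=
      ((hg _ hm).differentiableAt (isOpen_ball.mem_nhds hm)).hasDerivAt
    have h3 : HasDerivAt (fun t : ℂ => t * ζ) ζ ((t:ℝ):ℂ) := by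
      simpa using ((hasDerivAt_id (((t:ℝ):ℂ))).mul_const ζ)
    have h5 : HasDerivAt (fun t : ℂ => g (t * ζ)) (deriv g ((t:ℂ)*ζ) * ζ) ((t:ℝ):ℂ) :=
      HasDerivAt.comp (((t:ℝ):ℂ)) (h := fun t : ℂ => t * ζ) h4 h3
    exact h5.comp_ofReal
  have key := image_norm_le_of_norm_deriv_right_lt_deriv_boundary
    (f := fun t : ℝ => g ((t:ℂ) * ζ)) (f' := fun t : ℝ => deriv g ((t:ℂ)*ζ) * ζ) (a := 0) (b := 1)
    (B := fun t => 4 * Real.exp (49 * ‖ζ‖ * t)) (B' := fun t => 4 * (Real.exp (49 * ‖ζ‖ * t) * (49 * ‖ζ‖)))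
    (fun t ht => (hder t ht).continuousAt.continuousWithinAt)
    (fun t ht => (hder t ⟨ht.1, ht.2.le⟩).hasDerivWithinAt)
    (by simp; linarith)
    (fun t => by
      have := ((hasDerivAt_id t).const_mul (49 * ‖ζ‖)).exp.const_mul 4
      simpa using this)
    (by
      intro t ht heq
      have h2 := h1 _ (hmem t ⟨ht.1, ht.2.le⟩)
      rw [heq] at h2
      have he : 1 ≤ Real.exp (49 * ‖ζ‖ * t) := Real.one_le_exp (by have := ht.1; positivity)
      rw [norm_mul]
      nlinarith)
  have := key (right_mem_Icc.2 zero_le_one)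
  simpa using this

lemma growth_log : ∃ C > 0, ∀ (R : ℝ) (g : ℂ → ℂ), 16 ≤ R → DifferentiableOn ℂ g (ball 0 R) →
    ‖g 0‖ ≤ 1 → 2 ≤ ‖deriv g 0‖ → (∀ z ∈ ball (0:ℂ) R, ‖g z‖ ≤ 1 / 4 → ‖deriv g z‖ ≤ 3) →
    (∀ z ∈ ball (0:ℂ) R, deriv g z ≠ 1) →
    ∃ h : ℂ → ℂ, (∀ z ∈ ball (0:ℂ) (R/32), exp (h z) = 1 - deriv g z) ∧ ‖deriv h 0‖ ≤ C ∧
      ‖deriv g 0‖ ≤ C ∧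
      ∀ z ∈ ball (0:ℂ) (R/32), ‖h z - h 0 - deriv h 0 * z‖ ≤ C * ‖z‖ ^ 2 / R := by
  refine ⟨50000, by norm_num, ?_⟩
  intro R g hR hg h0 h1 h2 h3
  have hp := pomm hR hg h0 h1 h2
  set d := R / 8 with hd
  have hdR : ball (0:ℂ) d ⊆ ball 0 R := ball_subset_ball (by linarith)
  have hgr := growth_bound (hg.mono hdR) h0 hp
  have hpd : DifferentiableOn ℂ (fun z => 1 - deriv g z) (ball 0 d) :=
    ((hg.deriv isOpen_ball).mono hdR).const_sub 1
  obtain ⟨h, hhd, hh⟩ := exists_log_ball hpd (fun z hz => sub_ne_zero.2 (h3 z (hdR hz)).symm)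
  have hd2 : 2 ≤ d := by linarith
  have hre : ∀ z ∈ ball (0:ℂ) d, (h z).re < 53 * d := by
    intro z hz
    have hz' : ‖z‖ < d := by simpa using hz
    have e1 := congrArg norm (hh z hz).1
    rw [norm_exp] at e1
    have e2 : ‖1 - deriv g z‖ ≤ 1 + ‖deriv g z‖ := by simpa using norm_sub_le 1 (deriv g z)
    have e3 := hp z hz'
    have e4 := hgr z hz'
    have e5 : Real.exp (49 * ‖z‖) ≤ Real.exp (49 * d) := Real.exp_le_exp.2 (by linarith)
    have e6 : 1 ≤ Real.exp (49 * d) := Real.one_le_exp (by linarith)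
    have e7 : (2:ℝ)^8 ≤ Real.exp (4 * d) := by
      have : Real.exp 1 ^ 8 ≤ Real.exp (4 * d) := by
        rw [← Real.exp_nat_mul]; exact Real.exp_le_exp.2 (by norm_num; linarith)
      refine le_trans ?_ this
      exact pow_le_pow_left₀ (by norm_num) (by linarith [Real.add_one_le_exp (1:ℝ)]) 8
    have e8 : Real.exp (53 * d) = Real.exp (49 * d) * Real.exp (4 * d) := by
      rw [← Real.exp_add]; ring_nf
    rw [← Real.exp_lt_exp, e1, e8]
    nlinarith
  have hr0 : 0 ≤ (h 0).re := by
    have e1 := congrArg norm (hh 0 (mem_ball_self (by linarith))).1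
    rw [norm_exp] at e1
    have e2 : ‖deriv g 0‖ ≤ 1 + ‖1 - deriv g 0‖ := by
      have := norm_sub_le 1 (1 - deriv g 0); simpa using this
    by_contra! hneg
    have := Real.exp_lt_one_iff.2 hneg
    linarith
  set u : ℂ → ℂ := fun z => ((53 * d : ℝ) : ℂ) - h z with hu
  have hud : DifferentiableOn ℂ u (ball 0 d) := hhd.const_sub _
  have hup : ∀ z ∈ ball (0:ℂ) d, 0 < (u z).re := by
    intro z hz
    have := hre z hz
    rw [hu]
    simp only [sub_re, ofReal_re]; linarith
  have hu0 : (u 0).re ≤ 53 * d := by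
    rw [hu]
    simp only [sub_re, ofReal_re]; linarith
  have hs := (pos_re_schwarz (by linarith) hud hup).2
  have hub : ∀ z ∈ ball (0:ℂ) (d/2), ‖deriv h z‖ ≤ 636 := by
    intro z hz
    have hz' : ‖z‖ < d/2 := by simpa using hz
    have hzd : z ∈ ball (0:ℂ) d := ball_subset_ball (by linarith) hz
    have e1 := hs z hzd
    have e2 := (abs_le.1 e1).2
    have e3 : dist z 0 / d ≤ 1/2 := by
      rw [dist_zero_right, div_le_iff₀ (by linarith)]; linarith
    have e4 : (u z).re ≤ 3 * (u 0).re := by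
      nlinarith [hup z hzd, hup 0 (mem_ball_self (by linarith))]
    have hsub : ball z (d/2) ⊆ ball 0 d := by
      intro w hw
      rw [mem_ball_zero_iff]
      have := mem_ball.1 hw
      have h3 : ‖w‖ ≤ dist w z + ‖z‖ := by
        rw [dist_eq_norm]; simpa using norm_add_le (w - z) z
      linarith
    have e5 := (pos_re_schwarz (by linarith) (hud.mono hsub) (fun w hw => hup w (hsub hw))).1
    have e6 : deriv u z = - deriv h z := by rw [hu]; simp
    rw [e6, norm_neg] at e5
    refine e5.trans ?_
    rw [div_le_iff₀ (by linarith)]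
    linarith
  have hh1 : DifferentiableOn ℂ (deriv h) (ball 0 d) := hhd.deriv isOpen_ball
  have hub2 : ∀ z ∈ ball (0:ℂ) (d/4), ‖deriv (deriv h) z‖ ≤ 40704 / R := by
    intro z hz
    have hz' : ‖z‖ < d/4 := by simpa using hz
    have hsub : closedBall z (d/8) ⊆ ball 0 (d/2) := by
      intro w hw
      rw [mem_ball_zero_iff]
      have := mem_closedBall.1 hw
      have h3 : ‖w‖ ≤ dist w z + ‖z‖ := by
        rw [dist_eq_norm]; simpa using norm_add_le (w - z) z
      linarith
    have hdc : DiffContOnCl ℂ (deriv h) (ball z (d/8)) :=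
      DifferentiableOn.diffContOnCl ((hh1.mono (hsub.trans (ball_subset_ball (by linarith)))).mono
        closure_ball_subset_closedBall)
    have := norm_deriv_le_of_forall_mem_sphere_norm_le (by linarith : 0 < d/8) hdc
      (fun w hw => hub w (hsub (sphere_subset_closedBall hw)))
    refine this.trans (le_of_eq ?_)
    rw [hd]; field_simp; norm_num
  have hd4 : d / 4 = R / 32 := by rw [hd]; ring
  have hsub4 : ball (0:ℂ) (d/4) ⊆ ball 0 d := ball_subset_ball (by linarith)
  have hub3 : ∀ z ∈ ball (0:ℂ) (d/4), ‖deriv h z - deriv h 0‖ ≤ 40704 / R * ‖z‖ := by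
    intro z hz
    have := (convex_ball (0:ℂ) (d/4)).norm_image_sub_le_of_norm_deriv_le (f := deriv h)
      (fun w hw => (hh1 w (hsub4 hw)).differentiableAt (isOpen_ball.mem_nhds (hsub4 hw)))
      hub2 (mem_ball_self (by linarith)) hz
    simpa using this
  refine ⟨h, ?_, ?_, ?_, ?_⟩
  · intro z hz
    exact (hh z (hsub4 (hd4 ▸ hz))).1
  · exact (hub 0 (mem_ball_self (by linarith))).trans (by norm_num)
  · have := hp 0 (by simp; linarith)
    linarith
  · intro z hz
    rw [← hd4] at hz
    have hz' : ‖z‖ < d/4 := by simpa using hz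
    have hsub : closedBall (0:ℂ) ‖z‖ ⊆ ball 0 (d/4) := closedBall_subset_ball hz'
    have hdk : ∀ w ∈ closedBall (0:ℂ) ‖z‖, HasDerivAt (fun w => h w - deriv h 0 * w) (deriv h w - deriv h 0) w := by
      intro w hw
      have hw' := hsub4 (hsub hw)
      have := ((hhd w hw').differentiableAt (isOpen_ball.mem_nhds hw')).hasDerivAt.sub
        ((hasDerivAt_id w).const_mul (deriv h 0))
      rw [mul_one] at this
      exact this
    have := (convex_closedBall (0:ℂ) ‖z‖).norm_image_sub_le_of_norm_deriv_le
      (f := fun w => h w - deriv h 0 * w) (C := 40704 / R * ‖z‖)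
      (fun w hw => (hdk w hw).differentiableAt)
      (fun w hw => by
        rw [(hdk w hw).deriv]
        refine (hub3 w (hsub hw)).trans ?_
        have : ‖w‖ ≤ ‖z‖ := by simpa using hw
        have : 0 < R := by linarith
        gcongr)
      (mem_closedBall_self (norm_nonneg z)) (show z ∈ closedBall 0 ‖z‖ by simp)
    have e : h z - deriv h 0 * z - (h 0 - deriv h 0 * 0) = h z - h 0 - deriv h 0 * z := by ring
    rw [e, sub_zero] at this
    refine this.trans ?_
    have hR0 : 0 < R := by linarith
    rw [mul_assoc, ← sq, div_mul_eq_mul_div]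
    gcongr
    norm_num


lemma exists_fixed_exp (κ : ℂ) : ∃ s : ℂ, exp (s + κ) = s ∧ 0 < s.im := by
  have h1 : ∀ᶠ x : ℝ in atTop, ‖Real.log x‖ ≤ 1/8 * ‖x‖ :=
    (Real.isLittleO_log_id_atTop).bound (by norm_num)
  have h2 : ∀ᶠ x : ℝ in atTop, ‖κ‖ + 4 ≤ 1/8 * x := by
    filter_upwards [eventually_ge_atTop (8 * (‖κ‖ + 4))] with x hx
    linarith
  have h3 : Tendsto (fun k : ℕ => 2 * Real.pi * (k : ℝ)) atTop atTop :=
    tendsto_natCast_atTop_atTop.const_mul_atTop (by positivity)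
  obtain ⟨k, hk1, hk2⟩ := ((h3.eventually h1).and (h3.eventually h2)).exists
  set x : ℝ := 2 * Real.pi * k with hx
  have hx32 : 32 ≤ x := by linarith [norm_nonneg κ]
  have hlower : ∀ s ∈ closedBall ((x:ℂ) * I) (x/2), x/2 ≤ s.im := by
    intro s hs
    have := mem_closedBall.1 hs
    rw [dist_eq_norm] at this
    have h5 := (abs_le.1 (abs_im_le_norm (s - x * I))).1
    simp at h5
    linarith
  have hslit : ∀ s ∈ closedBall ((x:ℂ) * I) (x/2), s ∈ slitPlane := by
    intro s hs
    exact Or.inr (by linarith [hlower s hs])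
  have hder : ∀ s ∈ closedBall ((x:ℂ) * I) (x/2),
      HasDerivAt (fun s => s + κ - log s - x * I) (1 - s⁻¹) s := by
    intro s hs
    have := (((hasDerivAt_id s).add_const κ).sub (hasDerivAt_log (hslit s hs))).sub_const ((x:ℂ) * I)
    exact this
  obtain ⟨s, hs, hs0⟩ := exists_zero_of_contract (h := fun s => s + κ - log s - x * I)
    (z0 := (x:ℂ) * I) (ε := x/2) (k := 1/2) (by linarith) (by norm_num) (by norm_num)
    (fun s hs => (hder s hs).differentiableAt)
    (fun s hs => by
      rw [(hder s hs).deriv]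
      have : x/2 ≤ ‖s‖ := (hlower s hs).trans ((le_abs_self _).trans (abs_im_le_norm s))
      simp only [sub_sub_cancel, norm_inv]
      rw [inv_le_comm₀ (by linarith) (by norm_num)]
      norm_num; linarith)
    (by
      have e1 : (x:ℂ) * I + κ - log (x * I) - x * I = κ - log (x * I) := by ring
      rw [e1]
      have e2 : ‖log ((x:ℂ) * I)‖ ≤ Real.log x + 4 := by
        refine (norm_le_abs_re_add_abs_im _).trans ?_
        rw [log_re, log_im]
        have e3 : ‖(x:ℂ) * I‖ = x := by simp; linarith
        rw [e3]
        have e4 := abs_arg_le_pi ((x:ℂ) * I)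
        have e5 := Real.pi_le_four
        rw [abs_of_nonneg (Real.log_nonneg (by linarith))]
        linarith
      have e6 := norm_sub_le κ (log ((x:ℂ) * I))
      rw [Real.norm_of_nonneg (Real.log_nonneg (by linarith)), Real.norm_of_nonneg (by linarith)] at hk1
      linarith)
  have him := hlower s hs
  have hsne : s ≠ 0 := by
    rintro rfl
    simp at him
    linarith
  refine ⟨s, ?_, by linarith⟩
  have e1 : s + κ = log s + (k:ℂ) * (2 * Real.pi * I) := by
    have : (x:ℂ) = 2 * Real.pi * k := by rw [hx]; push_cast; ring
    rw [this] at hs0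
    linear_combination hs0
  rw [e1, exp_add, exp_log hsne, exp_nat_mul_two_pi_mul_I, mul_one]

lemma limit_zero (p c A : ℂ) (hp : p ≠ 0) (hp2 : 2 ≤ ‖1 - p‖) :
    ∃ (G : ℂ → ℂ) (z : ℂ), (∀ w, HasDerivAt G (1 - p * exp (A * w)) w) ∧ G 0 = c ∧ G z = 0 ∧
      ∀ t : ℝ, 1 ≤ t → t ≤ 2 → p * exp (A * z) ≠ t := by
  rcases eq_or_ne A 0 with rfl | hA
  · have hne : 1 - p ≠ 0 := by
      intro h; rw [h] at hp2; norm_num at hp2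
    refine ⟨fun w => c + (1 - p) * w, -c / (1 - p), ?_, by simp, by field_simp; ring, ?_⟩
    · intro w
      have := ((hasDerivAt_id w).const_mul (1 - p)).const_add c
      simpa using this
    · intro t h1 h2 h
      rw [zero_mul, exp_zero, mul_one] at h
      rw [h, ← ofReal_one, ← ofReal_sub, norm_real, Real.norm_eq_abs] at hp2
      rw [abs_of_nonpos (by linarith)] at hp2
      linarith
  · obtain ⟨s, hs, him⟩ := exists_fixed_exp (log p - (A * c + p))
    have hkey : p * exp (A * ((s - (A * c + p)) / A)) = s := by
      rw [mul_div_cancel₀ _ hA]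
      conv_rhs => rw [← hs]
      rw [show s + (log p - (A * c + p)) = log p + (s - (A * c + p)) by ring, exp_add, exp_log hp]
    refine ⟨fun w => c + w - p * (exp (A * w) - 1) / A, (s - (A * c + p)) / A, ?_, by simp, ?_, ?_⟩
    · intro w
      have h1 : HasDerivAt (fun w => exp (A * w)) (exp (A * w) * A) w := by
        have := ((hasDerivAt_id w).const_mul A).cexp
        simpa using this
      have := ((hasDerivAt_id w).const_add c).sub (((h1.sub_const 1).const_mul p).div_const A)
      refine this.congr_deriv ?_
      field_simp
    · show _ + _ - p * (exp (A * ((s - (A * c + p)) / A)) - 1) / A = 0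
      rw [mul_sub, hkey]
      field_simp
      ring
    · intro t _ _ h
      rw [hkey] at h
      rw [h] at him
      simp at him


def Good_s16 (Y : ℂ → ℂ) (z0 : ℂ) (r : ℝ) : Prop :=
  DifferentiableOn ℂ Y (ball z0 r) ∧ ∀ z ∈ ball z0 r, deriv Y z ≠ 1 ∧
    (Y z = 0 → ∃ t : ℝ, 1 ≤ t ∧ t ≤ 2 ∧ 1 - deriv Y z = t)

lemma core_nonexist : ∃ R0 > 0, ∀ R ≥ R0, ∀ g : ℂ → ℂ, Good_s16 g 0 R → ‖g 0‖ ≤ 1 →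
    2 ≤ ‖deriv g 0‖ → (∀ z ∈ ball (0:ℂ) R, ‖g z‖ ≤ 1 / 4 → ‖deriv g z‖ ≤ 3) → False := by
  by_contra! hcon
  have hcon' : ∀ n : ℕ, ∃ R ≥ (n:ℝ) + 16, ∃ g : ℂ → ℂ, Good_s16 g 0 R ∧ ‖g 0‖ ≤ 1 ∧
      2 ≤ ‖deriv g 0‖ ∧ (∀ z ∈ ball (0:ℂ) R, ‖g z‖ ≤ 1 / 4 → ‖deriv g z‖ ≤ 3) := by
    intro n
    obtain ⟨R, hR, g, h1, h2, h3, h4, -⟩ := hcon (n + 16) (by positivity)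
    exact ⟨R, hR, g, h1, h2, h3, h4⟩
  choose R hR g hgood hg0 hg1 hg2 using hcon'
  obtain ⟨C, hC, hgl⟩ := growth_log
  have hR16 : ∀ n, 16 ≤ R n := fun n => by
    have := hR n
    have : (0:ℝ) ≤ n := by positivity
    linarith
  have hex := fun n => hgl (R n) (g n) (hR16 n) (hgood n).1 (hg0 n) (hg1 n) (hg2 n)
    (fun z hz => ((hgood n).2 z hz).1)
  choose h hexp hA hP herr using hex
  have hRt : Tendsto R atTop atTop := by
    refine tendsto_atTop_mono (fun n => ?_) tendsto_natCast_atTop_atTop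
    linarith [hR n]
  -- bounded sequence
  obtain ⟨⟨c, A, D⟩, -, φ, hφ, hlim⟩ := (isCompact_closedBall (0 : ℂ × ℂ × ℂ) (1 + C)).tendsto_subseq
    (x := fun n => (g n 0, deriv (h n) 0, deriv (g n) 0)) (by
      intro n
      rw [mem_closedBall_zero_iff, Prod.norm_def, Prod.norm_def]
      simp only [sup_le_iff]
      exact ⟨by linarith [hg0 n], by linarith [hA n], by linarith [hP n]⟩)
  have hlc : Tendsto (fun n => g (φ n) 0) atTop (𝓝 c) := (continuous_fst.tendsto _).comp hlim
  have hlA : Tendsto (fun n => deriv (h (φ n)) 0) atTop (𝓝 A) :=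
    ((continuous_fst.comp continuous_snd).tendsto _).comp hlim
  have hlD : Tendsto (fun n => deriv (g (φ n)) 0) atTop (𝓝 D) :=
    ((continuous_snd.comp continuous_snd).tendsto _).comp hlim
  have hRφ : Tendsto (fun n => R (φ n)) atTop atTop := hRt.comp hφ.tendsto_atTop
  have hD2 : 2 ≤ ‖D‖ := ge_of_tendsto hlD.norm (Eventually.of_forall fun n => hg1 _)
  set p := 1 - D with hp
  have hlp : Tendsto (fun n => 1 - deriv (g (φ n)) 0) atTop (𝓝 p) := hlD.const_sub 1
  have hpD : 1 - p = D := by rw [hp]; ring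
  have hp0 : p ≠ 0 := by
    intro h0
    rw [h0] at hpD
    rw [← hpD] at hD2
    norm_num at hD2
  obtain ⟨G, z, hG, hG0, hGz, hslope⟩ := limit_zero p c A hp0 (by rw [hpD]; exact hD2)
  set s := p * exp (A * z) with hs
  -- distance to the segment
  obtain ⟨η, hη, hηd⟩ : ∃ η > 0, ∀ t : ℝ, 1 ≤ t → t ≤ 2 → η ≤ ‖s - t‖ := by
    obtain ⟨t0, ht0, hmin⟩ := (isCompact_Icc (a := (1:ℝ)) (b := 2)).exists_isMinOn
      (nonempty_Icc.2 (by norm_num)) (f := fun t : ℝ => ‖s - t‖) (by fun_prop)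
    refine ⟨‖s - t0‖, norm_pos_iff.2 (sub_ne_zero.2 (hslope t0 ht0.1 ht0.2)), fun t h1 h2 => ?_⟩
    exact hmin (show t ∈ Icc 1 2 from ⟨h1, h2⟩)
  have hη1 : η ≤ ‖1 - s‖ := by
    have := hηd 1 le_rfl (by norm_num)
    rwa [norm_sub_rev, ofReal_one] at this
  set E := 1 - s with hE
  have hE0 : 0 < ‖E‖ := lt_of_lt_of_le hη hη1
  -- continuity of limit derivative
  have hcont : ContinuousAt (fun w => 1 - p * exp (A * w)) z := by fun_prop
  obtain ⟨ε, hε, hεb⟩ : ∃ ε > 0, ∀ w ∈ closedBall z ε, ‖(1 - p * exp (A * w)) - E‖ ≤ η / 4 := by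
    obtain ⟨ε, hε, hb⟩ := Metric.continuousAt_iff.1 hcont (η/4) (by linarith)
    refine ⟨ε/2, by linarith, fun w hw => ?_⟩
    have := hb (lt_of_le_of_lt (mem_closedBall.1 hw) (by linarith))
    rw [dist_eq_norm] at this
    exact this.le
  set ρ := ‖z‖ + ε with hρ
  have hρ0 : 0 < ρ := by positivity
  -- uniform convergence
  have hunif : ∀ δ > 0, ∀ᶠ n in atTop, ∀ w ∈ closedBall (0:ℂ) ρ,
      ‖deriv (g (φ n)) w - (1 - p * exp (A * w))‖ ≤ δ := by
    intro δ hδ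
    obtain ⟨v, hv, hv2⟩ := (isCompact_closedBall (0:ℂ) ρ).mem_uniformity_of_prod
      (f := fun (q : ℂ × ℂ × ℂ) (w : ℂ) => 1 - q.1 * exp (q.2.1 * w + q.2.2)) (s := univ)
      (q := (p, A, 0)) (by unfold Function.uncurry; fun_prop) (mem_univ _) (dist_mem_uniformity hδ)
    rw [nhdsWithin_univ] at hv
    obtain ⟨τ, hτ, hτv⟩ := Metric.mem_nhds_iff.1 hv
    have e1 : ∀ᶠ n in atTop, dist (1 - deriv (g (φ n)) 0) p < τ := Metric.tendsto_nhds.1 hlp τ hτ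
    have e2 : ∀ᶠ n in atTop, dist (deriv (h (φ n)) 0) A < τ := Metric.tendsto_nhds.1 hlA τ hτ
    filter_upwards [e1, e2, hRφ.eventually_gt_atTop (32 * ρ), hRφ.eventually_gt_atTop (C * ρ^2 / τ)]
      with n h1 h2 h3 h4 w hw
    have hw' : ‖w‖ ≤ ρ := by simpa using hw
    have hwR : w ∈ ball (0:ℂ) (R (φ n) / 32) := by
      rw [mem_ball_zero_iff]; linarith
    have hRp : 0 < R (φ n) := by linarith [hR16 (φ n)]
    have h5 := herr (φ n) w hwR
    set e := h (φ n) w - h (φ n) 0 - deriv (h (φ n)) 0 * w with he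
    have h6 : ‖e‖ < τ := by
      refine lt_of_le_of_lt h5 ?_
      rw [div_lt_iff₀ hRp]
      rw [div_lt_iff₀ hτ] at h4
      have : C * ‖w‖^2 ≤ C * ρ^2 := by gcongr
      linarith
    have hmem : ((1 - deriv (g (φ n)) 0, deriv (h (φ n)) 0, e) : ℂ × ℂ × ℂ) ∈ v := by
      apply hτv
      rw [mem_ball, Prod.dist_eq, Prod.dist_eq]
      simp only [sup_lt_iff, dist_zero_right]
      exact ⟨h1, h2, h6⟩
    have h7 := hv2 _ hmem w hw
    have h8 : 1 - deriv (g (φ n)) w = (1 - deriv (g (φ n)) 0) * exp (deriv (h (φ n)) 0 * w + e) := by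
      rw [← hexp (φ n) w hwR, ← hexp (φ n) 0 (by rw [mem_ball_zero_iff]; simp; linarith), ← exp_add, he]
      congr 1
      ring
    have h9 : dist (1 - (1 - deriv (g (φ n)) 0) * exp (deriv (h (φ n)) 0 * w + e))
      (1 - p * exp (A * w + 0)) < δ := h7
    rw [← h8, add_zero, dist_eq_norm] at h9
    simp only [sub_sub_cancel] at h9
    exact h9.le
  set δ := min (η/4) (ε * ‖E‖ / (4 * ρ)) with hδ
  have hδ0 : 0 < δ := by rw [hδ]; positivity
  have hδ1 : δ ≤ η/4 := min_le_left _ _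
  have hδ2 : δ * ρ ≤ ε * ‖E‖ / 4 := by
    have : δ ≤ ε * ‖E‖ / (4 * ρ) := min_le_right _ _
    calc δ * ρ ≤ ε * ‖E‖ / (4 * ρ) * ρ := by gcongr
      _ = _ := by field_simp
  have e3 : ∀ᶠ n in atTop, dist (g (φ n) 0) c < ε * ‖E‖ / 4 :=
    Metric.tendsto_nhds.1 hlc _ (by positivity)
  obtain ⟨n, h1, h2, h3⟩ := ((hunif δ hδ0).and (e3.and (hRφ.eventually_gt_atTop (32 * ρ)))).exists
  have hsubR : closedBall (0:ℂ) ρ ⊆ ball 0 (R (φ n)) := closedBall_subset_ball (by linarith)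
  have hzρ : z ∈ closedBall (0:ℂ) ρ := by rw [mem_closedBall_zero_iff]; linarith
  have hgd : ∀ w ∈ closedBall (0:ℂ) ρ, DifferentiableAt ℂ (g (φ n)) w := fun w hw =>
    ((hgood (φ n)).1 w (hsubR hw)).differentiableAt (isOpen_ball.mem_nhds (hsubR hw))
  have hdiff : ‖g (φ n) z‖ ≤ ε * ‖E‖ / 2 := by
    have hdd : ∀ w ∈ closedBall (0:ℂ) ρ, HasDerivAt (fun w => g (φ n) w - G w)
        (deriv (g (φ n)) w - (1 - p * exp (A * w))) w :=
      fun w hw => (hgd w hw).hasDerivAt.sub (hG w)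
    have := (convex_closedBall (0:ℂ) ρ).norm_image_sub_le_of_norm_deriv_le
      (f := fun w => g (φ n) w - G w) (C := δ) (fun w hw => (hdd w hw).differentiableAt)
      (fun w hw => by rw [(hdd w hw).deriv]; exact h1 w hw)
      (mem_closedBall_self hρ0.le) hzρ
    rw [hGz, hG0, sub_zero, sub_zero] at this
    have h5 := norm_add_le (g (φ n) z - (g (φ n) 0 - c)) (g (φ n) 0 - c)
    rw [sub_add_cancel] at h5
    rw [dist_eq_norm] at h2
    have : δ * ‖z‖ ≤ δ * ρ := by gcongr; linarith
    linarith
  have hsubz : closedBall z ε ⊆ closedBall (0:ℂ) ρ := by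
    intro w hw
    rw [mem_closedBall_zero_iff]
    have := mem_closedBall.1 hw
    have h3 : ‖w‖ ≤ dist w z + ‖z‖ := by
      rw [dist_eq_norm]; simpa using norm_add_le (w - z) z
    linarith
  have hclose : ∀ w ∈ closedBall z ε, ‖deriv (g (φ n)) w - E‖ ≤ η / 2 := by
    intro w hw
    have e1 := h1 w (hsubz hw)
    have e2 := hεb w hw
    have e3 := norm_add_le (deriv (g (φ n)) w - (1 - p * exp (A * w))) ((1 - p * exp (A * w)) - E)
    rw [sub_add_sub_cancel] at e3
    linarith
  have hEne : E ≠ 0 := norm_pos_iff.1 hE0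
  obtain ⟨w, hw, hw0⟩ := exists_zero_of_contract (h := fun w => g (φ n) w / E) (z0 := z) (ε := ε)
    (k := 1/2) hε.le (by norm_num) (by norm_num)
    (fun w hw => (hgd w (hsubz hw)).div_const E)
    (fun w hw => by
      rw [deriv_div_const]
      have e1 := hclose w hw
      have : 1 - deriv (g (φ n)) w / E = (E - deriv (g (φ n)) w) / E := by field_simp
      rw [this, norm_div, norm_sub_rev, div_le_iff₀ hE0]
      linarith)
    (by
      rw [norm_div, div_le_iff₀ hE0]
      linarith)
  have hw0' : g (φ n) w = 0 := by
    simpa [hEne] using hw0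
  obtain ⟨t, ht1, ht2, ht⟩ := ((hgood (φ n)).2 w (hsubR (hsubz hw))).2 hw0'
  have e1 := hηd t ht1 ht2
  have e2 := hclose w hw
  have e3 : s - t = deriv (g (φ n)) w - E := by rw [← ht, hE]; ring
  rw [e3] at e1
  linarith


lemma Good_s16.mono {Y : ℂ → ℂ} {z0 z1 : ℂ} {r r1 : ℝ} (h : Good_s16 Y z0 r) (hs : ball z1 r1 ⊆ ball z0 r) :
    Good_s16 Y z1 r1 := ⟨h.1.mono hs, fun z hz => h.2 z (hs hz)⟩

lemma Good_s16.zero_bound {Y : ℂ → ℂ} {z0 z : ℂ} {r : ℝ} (h : Good_s16 Y z0 r) (hz : z ∈ ball z0 r)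
    (h0 : Y z = 0) : ‖deriv Y z‖ ≤ 1 := by
  obtain ⟨t, h1, h2, h3⟩ := (h.2 z hz).2 h0
  have : deriv Y z = ((1 - t : ℝ) : ℂ) := by push_cast; linear_combination -h3
  rw [this, norm_real, Real.norm_eq_abs, abs_le]
  constructor <;> linarith

lemma rescale : ∃ C > 0, ∀ (Y : ℂ → ℂ) (z0 : ℂ) (r : ℝ), Good_s16 Y z0 r → ‖Y z0‖ < r / C →
    ‖deriv Y z0‖ ≤ 3 := by
  obtain ⟨R0, hR0, hcore⟩ := core_nonexist
  refine ⟨4 * R0, by positivity, ?_⟩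
  intro Y z0 r hY hsmall
  by_contra! hbig
  have hr : 0 < r := by
    have := (norm_nonneg _).trans_lt hsmall
    by_contra! h
    have : r / (4 * R0) ≤ 0 := div_nonpos_of_nonpos_of_nonneg h (by positivity)
    linarith
  have hz0 : z0 ∈ ball z0 r := mem_ball_self hr
  have hYc : ∀ z ∈ ball z0 r, ContinuousAt Y z := fun z hz =>
    (hY.1.continuousOn).continuousAt (isOpen_ball.mem_nhds hz)
  have hYc' : ∀ z ∈ ball z0 r, ContinuousAt (deriv Y) z := fun z hz =>
    ((hY.1.deriv isOpen_ball).continuousOn).continuousAt (isOpen_ball.mem_nhds hz)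
  set m : ℂ → ℝ := fun z => min (max (‖deriv Y z‖ - 2) 0) 1 with hm
  set S : ℂ → ℝ := fun z => m z / ‖Y z‖ with hS
  have hm0 : ∀ z, 0 ≤ m z := fun z => le_min (le_max_right _ _) zero_le_one
  have hm1 : ∀ z, m z ≤ 1 := fun z => min_le_right _ _
  have hS0 : ∀ z, 0 ≤ S z := fun z => div_nonneg (hm0 z) (norm_nonneg _)
  have hmc : ∀ z ∈ ball z0 r, ContinuousAt m z := by
    intro z hz
    have := hYc' z hz
    exact (((this.norm).sub continuousAt_const).max continuousAt_const).min continuousAt_const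
  have hSc : ∀ z ∈ ball z0 r, ContinuousAt S z := by
    intro z hz
    by_cases h0 : Y z = 0
    · have h1 := hY.zero_bound hz h0
      have h2 : ∀ᶠ w in 𝓝 z, ‖deriv Y w‖ < 2 :=
        (hYc' z hz).norm.eventually (gt_mem_nhds (by linarith : ‖deriv Y z‖ < 2))
      have h3 : S =ᶠ[𝓝 z] fun _ => 0 := by
        filter_upwards [h2] with w hw
        simp only [hS, hm]
        rw [max_eq_right (by linarith), min_eq_left zero_le_one, zero_div]
      exact continuousAt_const.congr h3.symm
    · exact (hmc z hz).div (hYc z hz).norm (norm_ne_zero_iff.2 h0)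
  have hsub : closedBall z0 (r/2) ⊆ ball z0 r := closedBall_subset_ball (by linarith)
  obtain ⟨w, hw, hmax⟩ := (isCompact_closedBall z0 (r/2)).exists_isMaxOn
    (nonempty_closedBall.2 (by linarith)) (f := fun z => (r/2 - dist z z0) * S z) (by
      intro z hz
      have h1 := hSc z (hsub hz)
      have h2 : ContinuousAt (fun z => r/2 - dist z z0) z := by fun_prop
      exact (h2.mul h1).continuousWithinAt)
  have hY0 : Y z0 ≠ 0 := by
    intro h
    have := hY.zero_bound hz0 h
    linarith
  have hY0n : 0 < ‖Y z0‖ := norm_pos_iff.2 hY0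
  have hmz0 : m z0 = 1 := by
    simp only [hm]
    rw [max_eq_left (by linarith), min_eq_right (by linarith)]
  have hφ : 2 * R0 < (r/2 - dist w z0) * S w := by
    have h1 : (r/2 - dist z0 z0) * S z0 ≤ (r/2 - dist w z0) * S w :=
      hmax (mem_closedBall_self (by linarith))
    refine lt_of_lt_of_le ?_ h1
    rw [dist_self, sub_zero, hS]
    simp only [hmz0]
    rw [lt_div_iff₀ (by positivity)] at hsmall
    rw [mul_one_div, lt_div_iff₀ hY0n]
    linarith
  set δ := r/2 - dist w z0 with hδ
  have hδ0 : 0 ≤ δ := by have := mem_closedBall.1 hw; rw [hδ]; linarith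
  have hSw : 0 < S w := by
    rcases (hS0 w).eq_or_lt with h | h
    · rw [← h, mul_zero] at hφ; linarith
    · exact h
  have hδp : 0 < δ := by
    rcases hδ0.eq_or_lt with h | h
    · rw [← h, zero_mul] at hφ; linarith
    · exact h
  have hwr : w ∈ ball z0 r := hsub hw
  have hYw : Y w ≠ 0 := by
    intro h
    simp [hS, h] at hSw
  have hYwn : 0 < ‖Y w‖ := norm_pos_iff.2 hYw
  have hmw : 0 < m w := by
    by_contra! h
    have : S w ≤ 0 := div_nonpos_of_nonpos_of_nonneg h (norm_nonneg _)
    linarith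
  have hYw2 : 2 < ‖deriv Y w‖ := by
    by_contra! h
    simp only [hm] at hmw
    rw [max_eq_right (by linarith), min_eq_left zero_le_one] at hmw
    exact lt_irrefl _ hmw
  set ρ := (S w)⁻¹ with hρ
  have hρ0 : 0 < ρ := by positivity
  have hρS : ρ * S w = 1 := inv_mul_cancel₀ hSw.ne'
  have hYwρ : ‖Y w‖ ≤ ρ := by
    have : S w * ‖Y w‖ = m w := div_mul_cancel₀ _ hYwn.ne'
    have h1 := hm1 w
    rw [← this] at h1
    rw [hρ, ← one_div, le_div_iff₀ hSw]
    linarith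
  have hρR : ρ * R0 ≤ δ / 2 := by
    have : ρ * (2 * R0) ≤ ρ * (δ * S w) := by gcongr
    have h2 : ρ * (δ * S w) = δ := by rw [mul_left_comm, hρS, mul_one]
    linarith
  have hmem : ∀ ζ ∈ ball (0:ℂ) R0, (ρ:ℂ) * ζ + w ∈ ball w (δ/2) := by
    intro ζ hζ
    have : ‖ζ‖ < R0 := by simpa using hζ
    rw [mem_ball, dist_eq_norm, add_sub_cancel_right, norm_mul, norm_real, Real.norm_of_nonneg hρ0.le]
    nlinarith
  have hballs : ∀ z ∈ ball w (δ/2), z ∈ ball z0 r ∧ S z ≤ 2 * S w := by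
    intro z hz
    have h1 : dist z w < δ/2 := hz
    have h2 := dist_triangle z w z0
    have h3 : z ∈ closedBall z0 (r/2) := by rw [mem_closedBall]; linarith
    refine ⟨hsub h3, ?_⟩
    have h4 : (r/2 - dist z z0) * S z ≤ δ * S w := hmax h3
    have h5 : δ/2 ≤ r/2 - dist z z0 := by linarith
    have h6 := hS0 z
    have h7 : δ/2 * S z ≤ δ * S w := le_trans (by gcongr) h4
    have h8 : δ/2 * S z ≤ δ/2 * (2 * S w) := by linarith
    exact le_of_mul_le_mul_left h8 (by linarith)
  have hρc : (ρ:ℂ) ≠ 0 := ofReal_ne_zero.2 hρ0.ne'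
  have hder : ∀ ζ ∈ ball (0:ℂ) R0, HasDerivAt (fun ζ => Y ((ρ:ℂ) * ζ + w) / ρ)
      (deriv Y ((ρ:ℂ) * ζ + w)) ζ := by
    intro ζ hζ
    have h1 := (hballs _ (hmem ζ hζ)).1
    have h2 : HasDerivAt Y (deriv Y ((ρ:ℂ) * ζ + w)) ((ρ:ℂ) * ζ + w) :=
      ((hY.1 _ h1).differentiableAt (isOpen_ball.mem_nhds h1)).hasDerivAt
    have h3 : HasDerivAt (fun ζ => (ρ:ℂ) * ζ + w) (ρ:ℂ) ζ := by
      simpa using ((hasDerivAt_id ζ).const_mul (ρ:ℂ)).add_const w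
    have h4 : HasDerivAt (fun ζ => Y ((ρ:ℂ) * ζ + w)) (deriv Y ((ρ:ℂ) * ζ + w) * ρ) ζ :=
      HasDerivAt.comp ζ (h := fun ζ => (ρ:ℂ) * ζ + w) h2 h3
    refine (h4.div_const (ρ:ℂ)).congr_deriv ?_
    field_simp
  have h0mem : (0:ℂ) ∈ ball (0:ℂ) R0 := mem_ball_self hR0
  refine hcore R0 le_rfl (fun ζ => Y ((ρ:ℂ) * ζ + w) / ρ) ⟨?_, ?_⟩ ?_ ?_ ?_
  · intro ζ hζ
    exact (hder ζ hζ).differentiableAt.differentiableWithinAt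
  · intro ζ hζ
    rw [(hder ζ hζ).deriv]
    have h1 := hY.2 _ (hballs _ (hmem ζ hζ)).1
    refine ⟨h1.1, fun h => h1.2 ?_⟩
    simpa [hρc] using h
  · simp only [mul_zero, zero_add, norm_div, norm_real]
    rw [Real.norm_of_nonneg hρ0.le, div_le_one hρ0]
    exact hYwρ
  · rw [(hder 0 h0mem).deriv]
    simpa using hYw2.le
  · intro ζ hζ hs
    rw [(hder ζ hζ).deriv]
    obtain ⟨h1, h2⟩ := hballs _ (hmem ζ hζ)
    set z := (ρ:ℂ) * ζ + w with hz
    by_cases h0 : Y z = 0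
    · have := hY.zero_bound h1 h0
      linarith
    · have hn : 0 < ‖Y z‖ := norm_pos_iff.2 h0
      rw [norm_div, norm_real, Real.norm_of_nonneg hρ0.le, div_le_iff₀ hρ0] at hs
      have h3 : S z * ‖Y z‖ = m z := div_mul_cancel₀ _ hn.ne'
      have h4 : m z ≤ 1/2 := by
        rw [← h3]
        calc S z * ‖Y z‖ ≤ (2 * S w) * (1/4 * ρ) := by gcongr
          _ = 1/2 * (ρ * S w) := by ring
          _ = 1/2 := by rw [hρS, mul_one]
      simp only [hm] at h4
      by_contra! h5
      rw [max_eq_left (by linarith)] at h4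
      rcases min_le_iff.1 h4 with h6 | h6 <;> linarith


lemma keyA_s16 : ∀ B > 0, ∀ c > 0, ∃ r0 > 0, ∀ r ≥ r0, ∀ (Y : ℂ → ℂ) (z0 : ℂ), Good_s16 Y z0 r → ‖Y z0‖ ≤ B →
    ‖deriv (deriv Y) z0 / (1 - deriv Y z0)‖ < c ∧ 1 / 2 ≤ ‖1 - deriv Y z0‖ := by
  obtain ⟨C, hC, hres⟩ := rescale
  intro B hB c hc
  set s := 48 / c + 192 * B + 1 with hs
  have hs0 : 0 < s := by positivity
  refine ⟨2 * C * (B + 4 * s) + 2 * s + 1, by positivity, ?_⟩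
  intro r hr Y z0 hY hY0
  have hCB : 0 < C * (B + 4 * s) := by positivity
  have hrs : s < r / 2 := by linarith
  have hrC : B + 4 * s < r / 2 / C := by
    rw [lt_div_iff₀ hC]; linarith
  have hder3 : ∀ z ∈ ball z0 s, ‖Y z‖ ≤ B + 4 * s → ‖deriv Y z‖ ≤ 3 := by
    intro z hz hle
    refine hres Y z (r/2) (hY.mono ?_) (hle.trans_lt hrC)
    apply ball_subset_ball'
    have := mem_ball.1 hz
    linarith
  have hsubr : ball z0 s ⊆ ball z0 r := ball_subset_ball (by linarith)
  have hbd : ∀ z ∈ ball z0 s, ‖Y z‖ ≤ B + 4 * s := by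
    intro z hz
    set v := z - z0 with hv
    have hvn : ‖v‖ < s := by rw [hv, ← dist_eq_norm]; exact hz
    have hmem : ∀ t ∈ Icc (0:ℝ) 1, (t:ℂ) * v + z0 ∈ ball z0 s := by
      intro t ht
      rw [mem_ball, dist_eq_norm, add_sub_cancel_right, norm_mul, norm_real, Real.norm_of_nonneg ht.1]
      nlinarith [ht.2, norm_nonneg v]
    have hder : ∀ t ∈ Icc (0:ℝ) 1,
        HasDerivAt (fun t : ℝ => Y ((t:ℂ) * v + z0)) (deriv Y ((t:ℂ) * v + z0) * v) t := by
      intro t ht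
      have hm := hsubr (hmem t ht)
      have h4 : HasDerivAt Y (deriv Y ((t:ℂ)*v + z0)) ((t:ℂ)*v + z0) :=
        ((hY.1 _ hm).differentiableAt (isOpen_ball.mem_nhds hm)).hasDerivAt
      have h3 : HasDerivAt (fun t : ℂ => t * v + z0) v ((t:ℝ):ℂ) := by
        simpa using ((hasDerivAt_id (((t:ℝ):ℂ))).mul_const v).add_const z0
      have h5 : HasDerivAt (fun t : ℂ => Y (t * v + z0)) (deriv Y ((t:ℂ)*v + z0) * v) ((t:ℝ):ℂ) :=
        HasDerivAt.comp (((t:ℝ):ℂ)) (h := fun t : ℂ => t * v + z0) h4 h3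
      exact h5.comp_ofReal
    have key := image_norm_le_of_norm_deriv_right_lt_deriv_boundary
      (f := fun t : ℝ => Y ((t:ℂ) * v + z0)) (f' := fun t : ℝ => deriv Y ((t:ℂ)*v + z0) * v)
      (a := 0) (b := 1) (B := fun t => B + 4 * s * t) (B' := fun _ => 4 * s)
      (fun t ht => (hder t ht).continuousAt.continuousWithinAt)
      (fun t ht => (hder t ⟨ht.1, ht.2.le⟩).hasDerivWithinAt)
      (by simpa using hY0)
      (fun t => by
        have := ((hasDerivAt_id t).const_mul (4 * s)).const_add B
        simpa using this)
      (by
        intro t ht heq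
        have h2 := hder3 _ (hmem t ⟨ht.1, ht.2.le⟩) (by rw [heq]; nlinarith [ht.2])
        rw [norm_mul]
        nlinarith [norm_nonneg v])
    have := key (right_mem_Icc.2 zero_le_one)
    simpa [hv] using this
  have hd3 : ∀ z ∈ ball z0 s, ‖deriv Y z‖ ≤ 3 := fun z hz => hder3 z hz (hbd z hz)
  have hYd : DifferentiableOn ℂ (deriv Y) (ball z0 s) := (hY.1.deriv isOpen_ball).mono hsubr
  have hsec : ∀ z ∈ ball z0 (s/2), ‖deriv (deriv Y) z‖ ≤ 12 / s := by
    intro z hz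
    have hsub : closedBall z (s/4) ⊆ ball z0 s := by
      apply closedBall_subset_ball'
      have := mem_ball.1 hz
      linarith
    have hdc : DiffContOnCl ℂ (deriv Y) (ball z (s/4)) :=
      DifferentiableOn.diffContOnCl ((hYd.mono hsub).mono closure_ball_subset_closedBall)
    have := norm_deriv_le_of_forall_mem_sphere_norm_le (by linarith : 0 < s/4) hdc
      (fun w hw => hd3 w (hsub (sphere_subset_closedBall hw)))
    refine this.trans (le_of_eq ?_)
    field_simp; norm_num
  have hhalf : 1 / 2 ≤ ‖1 - deriv Y z0‖ := by
    by_contra! hlt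
    have hsubB : closedBall z0 (4 * B) ⊆ ball z0 (s/2) := by
      apply closedBall_subset_ball
      have : 0 < 48 / c := by positivity
      linarith
    have hsub2 : ball z0 (s/2) ⊆ ball z0 s := ball_subset_ball (by linarith)
    have hk : ∀ z ∈ closedBall z0 (4 * B), ‖1 - deriv Y z‖ ≤ 3/4 := by
      intro z hz
      have h1 := (convex_closedBall z0 (4 * B)).norm_image_sub_le_of_norm_deriv_le (f := deriv Y)
        (fun w hw => (hYd w (hsub2 (hsubB hw))).differentiableAt
          (isOpen_ball.mem_nhds (hsub2 (hsubB hw))))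
        (fun w hw => hsec w (hsubB hw)) (mem_closedBall_self (by positivity)) hz
      have h2 : ‖z - z0‖ ≤ 4 * B := by rw [← dist_eq_norm]; exact hz
      have h3 : 12 / s * ‖z - z0‖ ≤ 1/4 := by
        rw [div_mul_eq_mul_div, div_le_iff₀ hs0]
        have : 0 < 48 / c := by positivity
        linarith
      have h4 := norm_sub_le (1 - deriv Y z0) (deriv Y z - deriv Y z0)
      have h5 : 1 - deriv Y z0 - (deriv Y z - deriv Y z0) = 1 - deriv Y z := by ring
      rw [h5] at h4
      linarith
    obtain ⟨z, hz, hz0⟩ := exists_zero_of_contract (h := Y) (z0 := z0) (ε := 4 * B) (k := 3/4)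
      (by positivity) (by norm_num) (by norm_num)
      (fun w hw => (hY.1 w (hsubr (hsub2 (hsubB hw)))).differentiableAt
          (isOpen_ball.mem_nhds (hsubr (hsub2 (hsubB hw)))))
      hk (by linarith)
    obtain ⟨t, h1, h2, h3⟩ := (hY.2 z (hsubr (hsub2 (hsubB hz)))).2 hz0
    have := hk z hz
    rw [h3, norm_real, Real.norm_of_nonneg (by linarith)] at this
    linarith
  refine ⟨?_, hhalf⟩
  rw [norm_div, div_lt_iff₀ (by linarith)]
  have h1 := hsec z0 (mem_ball_self (by linarith))
  have h2 : 12 / s < c * (1/2) := by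
    rw [div_lt_iff₀ hs0, hs]
    have : c * (1/2) * (48 / c + 192 * B + 1) = 24 + c * (96 * B) + c/2 := by field_simp; ring
    nlinarith [mul_pos hc hB]
  have h3 : c * (1/2) ≤ c * ‖1 - deriv Y z0‖ := by gcongr
  linarith


lemma lam_identity {Y0 Y1 Y2 : ℂ → ℂ} {z0 : ℂ} {r : ℝ} (hr : 0 < r)
    (h0 : Good_s16 Y0 z0 r) (h1 : Good_s16 Y1 z0 r)
    (e01 : ∀ z ∈ ball z0 r, Y0 z = Y1 z * (1 - deriv Y0 z))
    (e12 : Y1 z0 = Y2 z0 * (1 - deriv Y1 z0))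
    (n1 : Y1 z0 ≠ 0) (n2 : Y2 z0 ≠ 0) :
    -(deriv (deriv Y0) z0 / (1 - deriv Y0 z0)) = 1 / Y0 z0 - 2 / Y1 z0 + 1 / Y2 z0 := by
  have hz : z0 ∈ ball z0 r := mem_ball_self hr
  have hb := isOpen_ball.mem_nhds hz
  have d1 : HasDerivAt Y1 (deriv Y1 z0) z0 := ((h1.1 z0 hz).differentiableAt hb).hasDerivAt
  have d0 : HasDerivAt (deriv Y0) (deriv (deriv Y0) z0) z0 :=
    (((h0.1.deriv isOpen_ball) z0 hz).differentiableAt hb).hasDerivAt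
  have hd := d1.mul (d0.const_sub 1)
  have heq : Y0 =ᶠ[𝓝 z0] fun z => Y1 z * (1 - deriv Y0 z) := by
    filter_upwards [hb] with z hz using e01 z hz
  have hd0 := heq.deriv_eq
  have hd' : deriv (fun z => Y1 z * (1 - deriv Y0 z)) z0 = _ := hd.deriv
  rw [hd'] at hd0
  have hP0 : 1 - deriv Y0 z0 ≠ 0 := sub_ne_zero.2 (h0.2 z0 hz).1.symm
  have e0 := e01 z0 hz
  set P := 1 - deriv Y0 z0 with hP
  set Q := 1 - deriv Y1 z0 with hQ
  have q1 : deriv Y0 z0 = 1 - P := by rw [hP]; ring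
  have q2 : deriv Y1 z0 = 1 - Q := by rw [hQ]; ring
  have hQ0 : Q ≠ 0 := by
    intro h
    rw [h, mul_zero] at e12
    exact n1 e12
  rw [q1, q2] at hd0
  rw [e0, e12]
  have n1' : Y2 z0 * Q ≠ 0 := mul_ne_zero n2 hQ0
  rw [e12] at hd0
  field_simp
  linear_combination -hd0

lemma mainClaim (M : ℕ) (c : ℝ) (hc : 0 < c) : ∃ r0 > 0, ∀ r ≥ r0, ∀ (z0 : ℂ) (Y : ℕ → ℂ → ℂ),
    (∀ j ≤ M, Good_s16 (Y j) z0 r) →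
    (∀ j < M, ∀ z ∈ ball z0 r, Y j z = Y (j+1) z * (1 - deriv (Y j) z)) →
    ∀ m m', m + 2 ≤ m' → m' ≤ M → c ≤ ‖deriv (deriv (Y m)) z0 / (1 - deriv (Y m) z0)‖ →
      ‖deriv (deriv (Y m')) z0 / (1 - deriv (Y m') z0)‖ < c := by
  obtain ⟨r0, hr0, hkey⟩ := keyA_s16 (2 ^ M * (4 / c)) (by positivity) c hc
  refine ⟨r0, hr0, ?_⟩
  intro r hr z0 Y hG hE m m' hmm hm' hbig
  have hr' : 0 < r := by linarith
  have hz : z0 ∈ ball z0 r := mem_ball_self hr'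
  have hex : ∃ j, m ≤ j ∧ j ≤ m + 2 ∧ ‖Y j z0‖ ≤ 4 / c := by
    by_contra! hcon
    have b0 := hcon m (by omega) (by omega)
    have b1 := hcon (m+1) (by omega) (by omega)
    have b2 := hcon (m+2) (by omega) (by omega)
    have h4 : 0 < 4 / c := by positivity
    have hne : ∀ j, 4 / c < ‖Y j z0‖ → Y j z0 ≠ 0 := fun j hj => norm_pos_iff.1 (h4.trans hj)
    have hid := lam_identity hr' (hG m (by omega)) (hG (m+1) (by omega)) (hE m (by omega))
      (hE (m+1) (by omega) z0 hz) (hne _ b1) (hne _ b2)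
    have hinv : ∀ j, 4 / c < ‖Y j z0‖ → ‖1 / Y j z0‖ < c / 4 := by
      intro j hj
      rw [norm_div, norm_one, one_div, inv_lt_comm₀ (h4.trans hj) (by positivity), inv_div]
      exact hj
    have i0 := hinv _ b0
    have i1 := hinv _ b1
    have i2 := hinv _ b2
    rw [← norm_neg, hid] at hbig
    have t1 := norm_add_le (1 / Y m z0 - 2 / Y (m+1) z0) (1 / Y (m+2) z0)
    have t2 := norm_sub_le (1 / Y m z0) (2 / Y (m+1) z0)
    have t3 : ‖2 / Y (m+1) z0‖ = 2 * ‖1 / Y (m+1) z0‖ := by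
      rw [norm_div, norm_div]; simp; ring
    have : m + 1 + 1 = m + 2 := rfl
    rw [this] at hbig
    linarith
  obtain ⟨j, hj1, hj2, hj⟩ := hex
  have hind : ∀ k, j + k ≤ M → ‖Y (j + k) z0‖ ≤ 2 ^ k * (4 / c) := by
    intro k
    induction k with
    | zero => intro _; simpa using hj
    | succ k ih =>
      intro hk
      have i1 := ih (by omega)
      have i2 : (2:ℝ) ^ k * (4 / c) ≤ 2 ^ M * (4 / c) := by
        gcongr
        · norm_num
        · omega
      have i3 := (hkey r hr (Y (j+k)) z0 (hG _ (by omega)) (i1.trans i2)).2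
      have i4 := hE (j+k) (by omega) z0 hz
      have i5 := congrArg norm i4
      rw [norm_mul] at i5
      have i6 : ‖Y (j + (k + 1)) z0‖ * (1/2) ≤ ‖Y (j+k) z0‖ := by
        rw [i5]
        exact mul_le_mul_of_nonneg_left i3 (norm_nonneg _)
      rw [pow_succ]
      linarith
  have hk := hind (m' - j) (by omega)
  rw [show j + (m' - j) = m' by omega] at hk
  refine (hkey r hr (Y m') z0 (hG _ hm') (hk.trans ?_)).1
  gcongr
  · norm_num
  · omega


lemma order_deriv_zero {φ : ℂ → ℂ} {z : ℂ} (hφ : MeromorphicAt φ z) (h0 : meromorphicOrderAt φ z = 0)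
    (h1 : meromorphicOrderAt (deriv φ) z ≤ 0) : meromorphicOrderAt (deriv φ) z = 0 := by
  apply le_antisymm h1
  obtain ⟨g, hg, hg0, heq⟩ := (meromorphicOrderAt_eq_int_iff (n := 0) hφ).1 h0
  have heq' : φ =ᶠ[𝓝[≠] z] g := by
    filter_upwards [heq] with w hw
    simpa using hw
  rw [meromorphicOrderAt_congr heq'.nhdsNE_deriv]
  exact hg.deriv.meromorphicOrderAt_nonneg

lemma one_sub_deriv_quot {φ Y : ℂ → ℂ} {z : ℂ} (hφ : MeromorphicAt φ z)
    (h1 : meromorphicOrderAt (deriv φ) z ≠ ⊤) (hY : Y =ᶠ[𝓝[≠] z] fun w => φ w / deriv φ w) :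
    ∀ᶠ w in 𝓝[≠] z, deriv φ w ≠ 0 ∧ 1 - deriv Y w = φ w * deriv (deriv φ) w / (deriv φ w) ^ 2 := by
  have hne := (meromorphicOrderAt_ne_top_iff_eventually_ne_zero hφ.deriv).1 h1
  filter_upwards [hne, hY.nhdsNE_deriv, hφ.eventually_analyticAt] with w h2 h3 h4
  refine ⟨h2, ?_⟩
  have h5 : deriv (fun w => φ w / deriv φ w) w = _ :=
    (h4.differentiableAt.hasDerivAt.div h4.deriv.differentiableAt.hasDerivAt h2).deriv
  rw [h3, h5]
  field_simp
  ring

lemma quot_good {φ : ℂ → ℂ} (hφ : ∀ z, MeromorphicAt φ z) {z0 : ℂ} {r : ℝ}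
    (o0 : ∀ z ∈ ball z0 r, meromorphicOrderAt φ z ≤ 0)
    (o1 : ∀ z ∈ ball z0 r, meromorphicOrderAt (deriv φ) z ≤ 0)
    (o2 : ∀ z ∈ ball z0 r, meromorphicOrderAt (deriv (deriv φ)) z ≤ 0) :
    ∃ Y : ℂ → ℂ, Good_s16 Y z0 r ∧ ∀ z ∈ ball z0 r, Y =ᶠ[𝓝[≠] z] fun w => φ w / deriv φ w := by
  have hmero : MeromorphicOn (fun w => φ w / deriv φ w) univ := fun z _ => (hφ z).div (hφ z).deriv
  set Y := toMeromorphicNFOn (fun w => φ w / deriv φ w) univ with hYdef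
  have hNF : ∀ z, MeromorphicNFAt Y z := fun z => meromorphicNFOn_toMeromorphicNFOn _ _ (mem_univ z)
  have hYe : ∀ z, Y =ᶠ[𝓝[≠] z] fun w => φ w / deriv φ w := fun z =>
    MeromorphicOn.toMeromorphicNFOn_eq_self_on_nhdsNE hmero (mem_univ z)
  have hordY : ∀ z, meromorphicOrderAt Y z + meromorphicOrderAt (deriv φ) z = meromorphicOrderAt φ z ∨
      meromorphicOrderAt (deriv φ) z = ⊤ := by
    intro z
    by_cases ht : meromorphicOrderAt (deriv φ) z = ⊤
    · exact Or.inr ht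
    left
    have hYm : MeromorphicAt Y z := (hNF z).meromorphicAt
    rw [← meromorphicOrderAt_mul hYm (hφ z).deriv]
    apply meromorphicOrderAt_congr
    filter_upwards [hYe z, (meromorphicOrderAt_ne_top_iff_eventually_ne_zero (hφ z).deriv).1 ht] with w h1 h2
    simp only [Pi.mul_apply, h1]
    field_simp
  -- orders
  have hcase : ∀ z ∈ ball z0 r,
      (meromorphicOrderAt φ z = 0 ∧ meromorphicOrderAt (deriv φ) z = 0 ∧
        meromorphicOrderAt (deriv (deriv φ)) z = 0) ∨
      ∃ n : ℤ, n < 0 ∧ meromorphicOrderAt φ z = n ∧ meromorphicOrderAt (deriv φ) z = ((n - 1 : ℤ) : WithTop ℤ) ∧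
        meromorphicOrderAt (deriv (deriv φ)) z = ((n - 2 : ℤ) : WithTop ℤ) := by
    intro z hz
    have hnt : meromorphicOrderAt φ z ≠ ⊤ := ne_top_of_le_ne_top (by simp) (o0 z hz)
    obtain ⟨n, hn⟩ := WithTop.ne_top_iff_exists.1 hnt
    have hn0 : n ≤ 0 := by
      have := o0 z hz
      rw [← hn] at this
      exact_mod_cast this
    rcases hn0.eq_or_lt with h | h
    · left
      have h0 : meromorphicOrderAt φ z = 0 := by rw [← hn, h]; rfl
      have h1 := order_deriv_zero (hφ z) h0 (o1 z hz)
      exact ⟨h0, h1, order_deriv_zero (hφ z).deriv h1 (o2 z hz)⟩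
    · right
      have h1 := meromorphicOrderAt_deriv_eq_sub_one (n := n) (Int.cast_ne_zero.2 h.ne) hn.symm
      have h2 := meromorphicOrderAt_deriv_eq_sub_one (n := n - 1) (Int.cast_ne_zero.2 (by omega)) h1
      refine ⟨n, h, hn.symm, h1, ?_⟩
      rw [h2]
      congr 1
      omega
  have hdt : ∀ z ∈ ball z0 r, meromorphicOrderAt (deriv φ) z ≠ ⊤ := fun z hz =>
    ne_top_of_le_ne_top (by simp) (o1 z hz)
  have hYord : ∀ z ∈ ball z0 r, (meromorphicOrderAt φ z = 0 → meromorphicOrderAt Y z = 0) ∧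
      0 ≤ meromorphicOrderAt Y z := by
    intro z hz
    have h1 := (hordY z).resolve_right (hdt z hz)
    rcases hcase z hz with ⟨a, b, _⟩ | ⟨n, hn, a, b, _⟩
    · rw [a, b, add_zero] at h1
      exact ⟨fun _ => h1, h1.ge⟩
    · rw [a, b] at h1
      constructor
      · intro h; rw [a] at h
        exact absurd (by exact_mod_cast h) hn.ne
      · cases hY : meromorphicOrderAt Y z with
        | top => simp
        | coe k =>
          rw [hY] at h1
          norm_cast at h1 ⊢
          omega
  have hYan : ∀ z ∈ ball z0 r, AnalyticAt ℂ Y z := fun z hz =>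
    (hNF z).meromorphicOrderAt_nonneg_iff_analyticAt.1 (hYord z hz).2
  refine ⟨Y, ⟨fun z hz => (hYan z hz).differentiableAt.differentiableWithinAt, ?_⟩, fun z _ => hYe z⟩
  intro z hz
  constructor
  · have hord : meromorphicOrderAt (fun w => 1 - deriv Y w) z = 0 := by
      have hev : (fun w => 1 - deriv Y w) * (deriv φ * deriv φ) =ᶠ[𝓝[≠] z] φ * deriv (deriv φ) := by
        filter_upwards [one_sub_deriv_quot (hφ z) (hdt z hz) (hYe z)] with w hw
        simp only [Pi.mul_apply, hw.2]
        have := hw.1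
        field_simp
      have hm : MeromorphicAt (fun w => 1 - deriv Y w) z :=
        (analyticAt_const.sub (hYan z hz).deriv).meromorphicAt
      have hd1 := (hφ z).deriv
      have := meromorphicOrderAt_congr hev
      rw [meromorphicOrderAt_mul hm (hd1.mul hd1), meromorphicOrderAt_mul hd1 hd1,
        meromorphicOrderAt_mul (hφ z) hd1.deriv] at this
      rcases hcase z hz with ⟨a, b, c⟩ | ⟨n, hn, a, b, c⟩
      · rw [a, b, c] at this
        simpa using this
      · rw [a, b, c] at this
        cases hY : meromorphicOrderAt (fun w => 1 - deriv Y w) z with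
        | top =>
          rw [hY] at this
          norm_cast at this
        | coe k =>
          rw [hY] at this
          norm_cast at this ⊢
          omega
    have han : AnalyticAt ℂ (fun w => 1 - deriv Y w) z := analyticAt_const.sub (hYan z hz).deriv
    have := han.meromorphicNFAt.meromorphicOrderAt_eq_zero_iff.1 hord
    intro h
    apply this
    simp [h]
  · intro hY0
    rcases hcase z hz with ⟨a, b, _⟩ | ⟨n, hn, a, b, _⟩
    · have := (hNF z).meromorphicOrderAt_eq_zero_iff.1 ((hYord z hz).1 a)
      exact absurd hY0 this
    · obtain ⟨ψ, hψ, hψ0, heq⟩ := (meromorphicOrderAt_eq_int_iff (hφ z)).1 a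
      have hn' : (n:ℂ) ≠ 0 := Int.cast_ne_zero.2 hn.ne
      have hY' : deriv Y z = 1 / (n:ℂ) := by
        have hsl := (hasDerivAt_iff_tendsto_slope.1 (hYan z hz).differentiableAt.hasDerivAt)
        have hlim : Tendsto (fun w => ψ w / (n * ψ w + (w - z) * deriv ψ w)) (𝓝[≠] z)
            (𝓝 (ψ z / (n * ψ z + (z - z) * deriv ψ z))) := by
          have hc1 := hψ.continuousAt
          have hc2 := hψ.deriv.continuousAt
          have : ContinuousAt (fun w => ψ w / (n * ψ w + (w - z) * deriv ψ w)) z := by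
            refine hc1.div ((continuousAt_const.mul hc1).add ((continuousAt_id.sub continuousAt_const).mul hc2)) ?_
            simp [hn', hψ0]
          exact this.tendsto.mono_left nhdsWithin_le_nhds
        have hev : slope Y z =ᶠ[𝓝[≠] z] fun w => ψ w / (n * ψ w + (w - z) * deriv ψ w) := by
          have heq' : φ =ᶠ[𝓝[≠] z] fun w => (w - z) ^ n * ψ w := heq
          have hψe : ∀ᶠ w in 𝓝[≠] z, AnalyticAt ℂ ψ w :=
            hψ.eventually_analyticAt.filter_mono nhdsWithin_le_nhds
          filter_upwards [hYe z, heq', heq'.nhdsNE_deriv, self_mem_nhdsWithin, hψe] with w w1 w2 w3 w4 w5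
          have hwz : w - z ≠ 0 := sub_ne_zero.2 w4
          have hd : HasDerivAt (fun w => (w - z) ^ n * ψ w)
              ((n * (w - z) ^ (n - 1) * 1) * ψ w + (w - z) ^ n * deriv ψ w) w := by
            have e1 : HasDerivAt (fun w => (w - z) ^ n) (n * (w - z) ^ (n - 1) * 1) w :=
              HasDerivAt.comp w (h := fun w => w - z) (hasDerivAt_zpow n (w - z) (Or.inl hwz))
                ((hasDerivAt_id w).sub_const z)
            exact e1.mul w5.differentiableAt.hasDerivAt
          rw [slope_def_field, hY0, sub_zero, w1, w2, w3, hd.deriv]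
          have hz1 : (w - z) ^ n = (w - z) ^ (n - 1) * (w - z) := by
            rw [← zpow_add_one₀ hwz]; congr 1; omega
          have hz2 : (w - z) ^ (n - 1) ≠ 0 := zpow_ne_zero _ hwz
          rw [hz1]
          have : (n * (w - z) ^ (n - 1) * 1) * ψ w + (w - z) ^ (n - 1) * (w - z) * deriv ψ w
            = (w - z) ^ (n - 1) * (n * ψ w + (w - z) * deriv ψ w) := by ring
          rw [this, mul_assoc, mul_div_mul_left _ _ hz2, div_right_comm,
            mul_div_cancel_left₀ _ hwz]
        have := tendsto_nhds_unique hsl (hlim.congr' hev.symm)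
        rw [this, sub_self, zero_mul, add_zero]
        field_simp
      refine ⟨1 - 1 / (n:ℝ), ?_, ?_, ?_⟩
      · have : (n:ℝ) < 0 := by exact_mod_cast hn
        have := one_div_neg.2 this
        linarith
      · have h1 : (n:ℝ) ≤ -1 := by exact_mod_cast (by omega : n ≤ -1)
        have : -1 ≤ 1 / (n:ℝ) := by
          rw [le_div_iff_of_neg (by linarith)]; linarith
        linarith
      · rw [hY']; push_cast; ring


lemma tendsto_conj_nhdsNE (z : ℂ) :
    Tendsto (starRingEnd ℂ) (𝓝[≠] z) (𝓝[≠] ((starRingEnd ℂ) z)) := by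
  apply tendsto_nhdsWithin_iff.2
  refine ⟨(continuous_conj.tendsto z).mono_left nhdsWithin_le_nhds, ?_⟩
  filter_upwards [self_mem_nhdsWithin] with w hw h
  exact hw ((starRingEnd ℂ).injective h)

lemma mtilde_analytic {ψ : ℂ → ℂ} {z : ℂ} (h : AnalyticAt ℂ ψ ((starRingEnd ℂ) z)) :
    AnalyticAt ℂ (mtilde ψ) z := by
  rw [analyticAt_iff_eventually_differentiableAt] at h ⊢
  have := (continuous_conj.tendsto z).eventually h
  filter_upwards [this] with w hw
  exact differentiableAt_conj_conj_iff.2 hw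

lemma mtilde_eventually {f : ℂ → ℂ} {z : ℂ} {n : ℤ} {ψ : ℂ → ℂ}
    (h : ∀ᶠ w in 𝓝[≠] ((starRingEnd ℂ) z), f w = (w - (starRingEnd ℂ) z) ^ n • ψ w) :
    ∀ᶠ w in 𝓝[≠] z, mtilde f w = (w - z) ^ n • mtilde ψ w := by
  filter_upwards [(tendsto_conj_nhdsNE z).eventually h] with w hw
  simp [mtilde, hw]

lemma mtilde_mero {f : ℂ → ℂ} {z : ℂ} (h : MeromorphicAt f ((starRingEnd ℂ) z)) :
    MeromorphicAt (mtilde f) z := by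
  obtain ⟨n, hn⟩ := h
  refine ⟨n, ?_⟩
  have := mtilde_analytic hn
  have e : mtilde (fun w => (w - (starRingEnd ℂ) z) ^ n • f w) = fun w => (w - z) ^ n • mtilde f w := by
    ext w
    simp [mtilde]
  rwa [e] at this

lemma mtilde_iteratedDeriv (f : ℂ → ℂ) (n : ℕ) :
    iteratedDeriv n (mtilde f) = mtilde (iteratedDeriv n f) := by
  induction n with
  | zero => simp
  | succ n ih =>
    rw [iteratedDeriv_succ, iteratedDeriv_succ, ih]
    exact deriv_conj_conj (𝕜 := ℂ) (f := iteratedDeriv n f)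

lemma mtilde_order_le {f : ℂ → ℂ} {z : ℂ} (h : MeromorphicAt f ((starRingEnd ℂ) z))
    (ho : meromorphicOrderAt f ((starRingEnd ℂ) z) ≤ 0) : meromorphicOrderAt (mtilde f) z ≤ 0 := by
  have hnt : meromorphicOrderAt f ((starRingEnd ℂ) z) ≠ ⊤ := ne_top_of_le_ne_top (by simp) ho
  obtain ⟨n, hn⟩ := WithTop.ne_top_iff_exists.1 hnt
  obtain ⟨ψ, hψ, hψ0, heq⟩ := (meromorphicOrderAt_eq_int_iff h).1 hn.symm
  have : meromorphicOrderAt (mtilde f) z = n :=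
    (meromorphicOrderAt_eq_int_iff (mtilde_mero h)).2
      ⟨mtilde ψ, mtilde_analytic hψ, by simpa [mtilde] using hψ0, mtilde_eventually heq⟩
  rw [this, hn]
  exact ho

lemma iteratedDeriv_mero {f : ℂ → ℂ} (h : ∀ z, MeromorphicAt f z) (n : ℕ) :
    ∀ z, MeromorphicAt (iteratedDeriv n f) z := by
  induction n with
  | zero => simpa using h
  | succ n ih =>
    intro z
    rw [iteratedDeriv_succ]
    exact (ih z).deriv

lemma eq_of_punctured {u v : ℂ → ℂ} {z : ℂ} (hu : ContinuousAt u z) (hv : ContinuousAt v z)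
    (h : u =ᶠ[𝓝[≠] z] v) : u z = v z :=
  ((hu.eventuallyEq_nhds_iff_eventuallyEq_nhdsNE hv).1 h).eq_of_nhds

lemma Good_s16.analytic {Y : ℂ → ℂ} {z0 z : ℂ} {r : ℝ} (h : Good_s16 Y z0 r) (hz : z ∈ ball z0 r) :
    AnalyticAt ℂ Y z := h.1.analyticAt (isOpen_ball.mem_nhds hz)

lemma chain {φ : ℂ → ℂ} (hφ : ∀ z, MeromorphicAt φ z) (M : ℕ) {z0 : ℂ} {r : ℝ}
    (ho : ∀ j ≤ M + 2, ∀ z ∈ ball z0 r, meromorphicOrderAt (iteratedDeriv j φ) z ≤ 0) :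
    ∃ Y : ℕ → ℂ → ℂ, (∀ j ≤ M, Good_s16 (Y j) z0 r) ∧
      (∀ j < M, ∀ z ∈ ball z0 r, Y j z = Y (j+1) z * (1 - deriv (Y j) z)) ∧
      ∀ j ≤ M, ∀ z ∈ ball z0 r,
        Y j =ᶠ[𝓝[≠] z] fun w => iteratedDeriv j φ w / iteratedDeriv (j+1) φ w := by
  have hex : ∀ j, ∃ Y : ℂ → ℂ, j ≤ M → (Good_s16 Y z0 r ∧ ∀ z ∈ ball z0 r,
      Y =ᶠ[𝓝[≠] z] fun w => iteratedDeriv j φ w / iteratedDeriv (j+1) φ w) := by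
    intro j
    by_cases hj : j ≤ M
    · have o1 := ho (j+1) (by omega)
      have o2 := ho (j+1+1) (by omega)
      rw [iteratedDeriv_succ] at o1
      rw [iteratedDeriv_succ, iteratedDeriv_succ] at o2
      obtain ⟨Y, h1, h2⟩ := quot_good (iteratedDeriv_mero hφ j) (ho j (by omega)) o1 o2
      refine ⟨Y, fun _ => ⟨h1, ?_⟩⟩
      rw [iteratedDeriv_succ]
      exact h2
    · exact ⟨0, fun h => absurd h hj⟩
  choose Y hY using hex
  refine ⟨Y, fun j hj => (hY j hj).1, ?_, fun j hj => (hY j hj).2⟩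
  intro j hj z hz
  have g1 := (hY j hj.le).1
  have g2 := (hY (j+1) hj).1
  have a1 := g1.analytic hz
  have a2 := g2.analytic hz
  apply eq_of_punctured (u := Y j) (v := fun z => Y (j+1) z * (1 - deriv (Y j) z)) a1.continuousAt
    (a2.continuousAt.mul (continuousAt_const.sub a1.deriv.continuousAt))
  have o1 := ho (j+1) (by omega) z hz
  have o2 := ho (j+1+1) (by omega) z hz
  have e1 := (hY j hj.le).2 z hz
  have e2 := (hY (j+1) hj).2 z hz
  rw [iteratedDeriv_succ] at e1
  have hm := iteratedDeriv_mero hφ (j+1+1) z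
  have n2 := (meromorphicOrderAt_ne_top_iff_eventually_ne_zero hm).1
    (ne_top_of_le_ne_top (by simp) o2)
  rw [iteratedDeriv_succ] at o1
  have e3 := one_sub_deriv_quot (iteratedDeriv_mero hφ j z) (ne_top_of_le_ne_top (by simp) o1) e1
  filter_upwards [e1, e2, n2, e3] with w w1 w2 w3 w4
  rw [w1, w2, w4.2]
  have w5 := w4.1
  rw [iteratedDeriv_succ (n := j+1)] at w3 ⊢
  rw [iteratedDeriv_succ (n := j)] at w3 ⊢
  field_simp


lemma Fm_deriv {φ Y : ℂ → ℂ} {m : ℕ} {z0 z : ℂ} {r : ℝ} (hY : Good_s16 Y z0 r) (hz : z ∈ ball z0 r)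
    (h : Y =ᶠ[𝓝[≠] z] fun w => iteratedDeriv m φ w / iteratedDeriv (m+1) φ w) :
    deriv (Fm φ m) =ᶠ[𝓝[≠] z] fun w => 1 - deriv Y w := by
  have h1 : Fm φ m =ᶠ[𝓝[≠] z] fun w => w - Y w := by
    filter_upwards [h] with w hw
    simp [Fm, hw]
  have h2 : ∀ᶠ w in 𝓝[≠] z, w ∈ ball z0 r :=
    mem_nhdsWithin_of_mem_nhds (isOpen_ball.mem_nhds hz)
  filter_upwards [h1.nhdsNE_deriv, h2] with w hw hb
  rw [hw]
  exact ((hasDerivAt_id w).sub (hY.analytic hb).differentiableAt.hasDerivAt).deriv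

lemma poly_ne_nhdsNE {q : Polynomial ℂ} (hq : q ≠ 0) (z : ℂ) : ∀ᶠ w in 𝓝[≠] z, q.eval w ≠ 0 := by
  have hf : {w : ℂ | q.IsRoot w}.Finite := Polynomial.finite_setOfPred_isRoot hq
  have : ({w : ℂ | q.IsRoot w} \ {z})ᶜ ∈ 𝓝 z :=
    (hf.subset sdiff_subset).isClosed.isOpen_compl.mem_nhds (by simp)
  filter_upwards [mem_nhdsWithin_of_mem_nhds this, self_mem_nhdsWithin] with w hw hne h0
  exact hw ⟨h0, hne⟩

lemma tendsto_im_cobounded (z : ℂ) :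
    Tendsto (fun y : ℝ => I * (y:ℂ) - z) atTop (Bornology.cobounded ℂ) := by
  rw [← tendsto_norm_atTop_iff_cobounded]
  apply tendsto_atTop_mono (f := fun y : ℝ => y - ‖z‖)
  · intro y
    have h1 := norm_sub_norm_le (I * (y:ℂ)) z
    have h2 : ‖I * (y:ℂ)‖ = |y| := by simp
    linarith [le_abs_self y]
  · exact tendsto_atTop_add_const_right _ _ tendsto_id

lemma poly_logDeriv (p : Polynomial ℂ) (ε : ℝ) (hε : 0 < ε) : ∀ᶠ y : ℝ in atTop, p ≠ 0 →
    p.eval (I * (y:ℂ)) ≠ 0 ∧ ‖p.derivative.eval (I * (y:ℂ)) / p.eval (I * (y:ℂ))‖ ≤ ε := by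
  by_cases hp : p = 0
  · simp [hp]
  have hf : {w : ℂ | p.IsRoot w}.Finite := Polynomial.finite_setOfPred_isRoot hp
  have h1 : ∀ᶠ y : ℝ in atTop, p.eval (I * (y:ℂ)) ≠ 0 := by
    have := (tendsto_im_cobounded 0).eventually (Bornology.isBounded_def.1 hf.isBounded)
    filter_upwards [this] with y hy h0
    apply hy
    simpa using h0
  have h2 : Tendsto (fun y : ℝ => (p.roots.map fun z ↦ 1/(I * (y:ℂ) - z)).sum) atTop (𝓝 0) := by
    have := tendsto_multiset_sum (f := fun (z:ℂ) (y:ℝ) => 1/(I * (y:ℂ) - z)) (a := fun _ => 0)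
      (x := atTop) p.roots (by
        intro z _
        simp only [one_div]
        apply tendsto_inv₀_cobounded.comp
        exact tendsto_im_cobounded z)
    simpa using this
  have h3 : ∀ᶠ y : ℝ in atTop, ‖(p.roots.map fun z ↦ 1/(I * (y:ℂ) - z)).sum‖ ≤ ε := by
    have := h2.norm
    simp only [norm_zero] at this
    exact this.eventually (ge_mem_nhds hε)
  filter_upwards [h1, h3] with y y1 y3 _
  refine ⟨y1, ?_⟩
  rw [(IsAlgClosed.splits p).eval_derivative_div_eval_of_ne_zero y1]
  exact y3

lemma kOne {f : ℂ → ℂ} {m : ℕ} {Km Rm : ℂ → ℂ} {a : ℝ} (hK : IsKm f m Km) (hR : IsRatFn Rm)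
    (hE : MeroEq Km (fun z => Rm z * Complex.exp (Complex.I * (a : ℂ) * z))) (ha : a ≠ 0) :
    ∀ᶠ y : ℝ in atTop, ∀ (Y Z : ℂ → ℂ) (r : ℝ), 0 < r →
      Good_s16 Y (I * (y:ℂ)) r → Good_s16 Z (I * (y:ℂ)) r →
      (∀ z ∈ ball (I * (y:ℂ)) r,
        Y =ᶠ[𝓝[≠] z] fun w => iteratedDeriv m f w / iteratedDeriv (m+1) f w) →
      (∀ z ∈ ball (I * (y:ℂ)) r,
        Z =ᶠ[𝓝[≠] z] fun w => iteratedDeriv m (mtilde f) w / iteratedDeriv (m+1) (mtilde f) w) →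
      |a| / 2 ≤ ‖deriv (deriv Y) (I * (y:ℂ)) / (1 - deriv Y (I * (y:ℂ)))‖
        + ‖deriv (deriv Z) (I * (y:ℂ)) / (1 - deriv Z (I * (y:ℂ)))‖ := by
  obtain ⟨p, q, hq, hpq⟩ := hR
  have hε : 0 < |a| / 4 := by positivity
  filter_upwards [poly_logDeriv p _ hε, poly_logDeriv q _ hε] with y hp' hq' Y Z r hr gY gZ eY eZ
  obtain ⟨q1, q2⟩ := hq' hq
  have rel : ∀ z ∈ ball (I * (y:ℂ)) r, q.eval z * (1 - deriv Y z) =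
      p.eval z * Complex.exp (I * a * z) * (1 - deriv Z z) := by
    intro z hz
    have aY := (gY.analytic hz).deriv.continuousAt
    have aZ := (gZ.analytic hz).deriv.continuousAt
    apply eq_of_punctured (u := fun z => q.eval z * (1 - deriv Y z))
      (v := fun z => p.eval z * Complex.exp (I * a * z) * (1 - deriv Z z))
    · exact q.continuous.continuousAt.mul (continuousAt_const.sub aY)
    · exact (p.continuous.continuousAt.mul (by fun_prop)).mul (continuousAt_const.sub aZ)
    filter_upwards [Fm_deriv gY hz (eY z hz), Fm_deriv gZ hz (eZ z hz), hK.2.2.2 z, hE z, hpq z,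
      poly_ne_nhdsNE hq z] with w w1 w2 w3 w4 w5 w6
    rw [w1, w2, w4, w5] at w3
    rw [w3]
    field_simp
  set z := I * (y:ℂ) with hzdef
  have hz : z ∈ ball z r := mem_ball_self hr
  have nY : 1 - deriv Y z ≠ 0 := sub_ne_zero.2 (gY.2 z hz).1.symm
  have nZ : 1 - deriv Z z ≠ 0 := sub_ne_zero.2 (gZ.2 z hz).1.symm
  have r0 := rel z hz
  have pz : p.eval z ≠ 0 := by
    intro h
    rw [h] at r0
    simp [q1, nY] at r0
  obtain ⟨-, p2⟩ := hp' (by rintro rfl; simp at pz)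
  have dY := (gY.analytic hz).deriv.differentiableAt.hasDerivAt
  have dZ := (gZ.analytic hz).deriv.differentiableAt.hasDerivAt
  have dl := (q.hasDerivAt z).mul (dY.const_sub 1)
  have dE : HasDerivAt (fun z => Complex.exp (I * a * z)) (Complex.exp (I * a * z) * (I * a)) z := by
    have := ((hasDerivAt_id z).const_mul (I * (a:ℂ))).cexp
    simpa using this
  have dr := ((p.hasDerivAt z).mul dE).mul (dZ.const_sub 1)
  have ev : (fun z => q.eval z * (1 - deriv Y z)) =ᶠ[𝓝 z]
      (fun z => p.eval z * Complex.exp (I * a * z) * (1 - deriv Z z)) := by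
    filter_upwards [isOpen_ball.mem_nhds hz] with w hw using rel w hw
  have de := dl.unique (dr.congr_of_eventuallyEq ev)
  have hex := Complex.exp_ne_zero (I * a * z)
  have key : I * (a:ℂ) = - (deriv (deriv Y) z / (1 - deriv Y z)) + deriv (deriv Z) z / (1 - deriv Z z)
      + q.derivative.eval z / q.eval z - p.derivative.eval z / p.eval z := by
    simp only [Pi.mul_apply] at de
    have e1 : (q.derivative.eval z * (1 - deriv Y z) + q.eval z * -deriv (deriv Y) z) /
        (q.eval z * (1 - deriv Y z)) = q.derivative.eval z / q.eval z
          - deriv (deriv Y) z / (1 - deriv Y z) := by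
      field_simp
      ring
    have e2 : ((p.derivative.eval z * Complex.exp (I * a * z) + p.eval z * (Complex.exp (I * a * z) * (I * a))) * (1 - deriv Z z) + p.eval z * Complex.exp (I * a * z) * -deriv (deriv Z) z) /
        (p.eval z * Complex.exp (I * a * z) * (1 - deriv Z z)) = p.derivative.eval z / p.eval z
          + I * a - deriv (deriv Z) z / (1 - deriv Z z) := by
      generalize Complex.exp (I * a * z) = E at *
      field_simp
      ring
    rw [← r0] at e2
    have de' := congrArg (fun t => t / (q.eval z * (1 - deriv Y z))) de
    rw [e1] at de'
    rw [e2] at de'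
    linear_combination -de'
  have hn : |a| = ‖I * (a:ℂ)‖ := by simp
  have h1 := norm_sub_le (- (deriv (deriv Y) z / (1 - deriv Y z)) + deriv (deriv Z) z / (1 - deriv Z z)
      + q.derivative.eval z / q.eval z) (p.derivative.eval z / p.eval z)
  have h2 := norm_add_le (- (deriv (deriv Y) z / (1 - deriv Y z)) + deriv (deriv Z) z / (1 - deriv Z z))
      (q.derivative.eval z / q.eval z)
  have h3 := norm_add_le (- (deriv (deriv Y) z / (1 - deriv Y z))) (deriv (deriv Z) z / (1 - deriv Z z))
  rw [norm_neg] at h3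
  rw [← key, ← hn] at h1
  linarith

lemma avoid {M : ℕ} {f : ℂ → ℂ} (hs : Setup M f) : ∀ᶠ y : ℝ in atTop,
    (∀ j ≤ M + 2, ∀ z ∈ ball (I * (y:ℂ)) (y/2), meromorphicOrderAt (iteratedDeriv j f) z ≤ 0) ∧
    (∀ j ≤ M + 2, ∀ z ∈ ball (I * (y:ℂ)) (y/2),
      meromorphicOrderAt (iteratedDeriv j (mtilde f)) z ≤ 0) := by
  obtain ⟨-, hm, -, hfin⟩ := hs
  have hU : (⋃ j ∈ Set.Iic (M+2), {z : ℂ | 0 < meroOrder (iteratedDeriv j f) z ∧ z.im ≠ 0}).Finite :=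
    (Set.finite_Iic (M+2)).biUnion fun j hj => hfin j (le_trans hj (by omega))
  obtain ⟨T, hT⟩ := hU.isBounded.exists_norm_le
  have base : ∀ j ≤ M + 2, ∀ z : ℂ, T < ‖z‖ → z.im ≠ 0 →
      meromorphicOrderAt (iteratedDeriv j f) z ≤ 0 := by
    intro j hj z hz hi
    by_contra h
    have h0 : 0 < meroOrder (iteratedDeriv j f) z := by
      rw [meroOrder, dif_pos (iteratedDeriv_mero hm j z)]
      exact not_le.1 h
    exact absurd (hT z (Set.mem_biUnion (show j ∈ Set.Iic (M+2) from hj) ⟨h0, hi⟩)) (not_le.2 hz)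
  filter_upwards [eventually_gt_atTop (2 * T), eventually_gt_atTop 0] with y hy hy0
  have geo : ∀ z ∈ ball (I * (y:ℂ)) (y/2), T < ‖z‖ ∧ z.im ≠ 0 := by
    intro z hz
    rw [mem_ball, dist_eq_norm] at hz
    have h1 := (abs_im_le_norm (z - I * (y:ℂ))).trans_lt hz
    simp only [sub_im, mul_im, I_re, I_im, ofReal_re, ofReal_im] at h1
    have h2 := (abs_lt.1 h1).1
    have h3 := im_le_norm z
    constructor
    · linarith
    · intro h
      rw [h] at h2
      linarith
  refine ⟨fun j hj z hz => base j hj z (geo z hz).1 (geo z hz).2, fun j hj z hz => ?_⟩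
  rw [mtilde_iteratedDeriv]
  apply mtilde_order_le (iteratedDeriv_mero hm j _)
  apply base j hj
  · rw [norm_conj]
    exact (geo z hz).1
  · rw [conj_im]
    exact neg_ne_zero.2 (geo z hz).2

lemma final (M : ℕ) (f : ℂ → ℂ) (hs : Setup M f) :
    ¬ ∃ m₁ m₂ m₃ : ℕ, 1 ≤ m₁ ∧ m₁ + 2 ≤ m₂ ∧ m₂ + 2 ≤ m₃ ∧ m₃ ≤ M ∧
      ∀ m ∈ ({m₁, m₂, m₃} : Set ℕ), ∃ (Km Rm : ℂ → ℂ) (am : ℝ),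
        IsKm f m Km ∧ IsRatFn Rm ∧
        MeroEq Km (fun z => Rm z * Complex.exp (Complex.I * (am : ℂ) * z)) ∧ am ≠ 0 := by
  rintro ⟨m₁, m₂, m₃, -, h12, h23, h3M, H⟩
  obtain ⟨K1, R1, a1, k1, r1, e1, n1⟩ := H m₁ (by simp)
  obtain ⟨K2, R2, a2, k2, r2, e2, n2⟩ := H m₂ (by simp)
  obtain ⟨K3, R3, a3, k3, r3, e3, n3⟩ := H m₃ (by simp)
  have p1 := abs_pos.2 n1
  have p2 := abs_pos.2 n2
  have p3 := abs_pos.2 n3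
  obtain ⟨c, hc, c1, c2, c3⟩ : ∃ c : ℝ, 0 < c ∧ 4 * c ≤ |a1| ∧ 4 * c ≤ |a2| ∧ 4 * c ≤ |a3| := by
    refine ⟨min |a1| (min |a2| |a3|) / 4, by positivity, ?_, ?_, ?_⟩
    · linarith [min_le_left |a1| (min |a2| |a3|)]
    · linarith [min_le_right |a1| (min |a2| |a3|), min_le_left |a2| |a3|]
    · linarith [min_le_right |a1| (min |a2| |a3|), min_le_right |a2| |a3|]
  obtain ⟨r0, hr0, main⟩ := mainClaim M c hc
  have E := (avoid hs).and ((kOne k1 r1 e1 n1).and ((kOne k2 r2 e2 n2).and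
    ((kOne k3 r3 e3 n3).and (eventually_ge_atTop (2 * r0)))))
  obtain ⟨y, ⟨o1, o2⟩, q1, q2, q3, hy⟩ := E.exists
  have hm := hs.2.1
  obtain ⟨Y, gY, rY, eY⟩ := chain hm M o1
  obtain ⟨Z, gZ, rZ, eZ⟩ := chain (fun z => mtilde_mero (hm _)) M o2
  have hr : r0 ≤ y / 2 := by linarith
  have hrp : 0 < y / 2 := by linarith
  have s1 := q1 (Y m₁) (Z m₁) _ hrp (gY _ (by omega)) (gZ _ (by omega)) (eY _ (by omega)) (eZ _ (by omega))
  have s2 := q2 (Y m₂) (Z m₂) _ hrp (gY _ (by omega)) (gZ _ (by omega)) (eY _ (by omega)) (eZ _ (by omega))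
  have s3 := q3 (Y m₃) (Z m₃) _ hrp (gY _ (by omega)) (gZ _ (by omega)) (eY _ (by omega)) (eZ _ (by omega))
  have A := main _ hr _ Y gY rY
  have B := main _ hr _ Z gZ rZ
  have A12 := A m₁ m₂ h12 (by omega)
  have A13 := A m₁ m₃ (by omega) h3M
  have A23 := A m₂ m₃ h23 h3M
  have B12 := B m₁ m₂ h12 (by omega)
  have B13 := B m₁ m₃ (by omega) h3M
  have B23 := B m₂ m₃ h23 h3M
  rcases le_or_gt c ‖deriv (deriv (Y m₁)) (I * (y:ℂ)) / (1 - deriv (Y m₁) (I * (y:ℂ)))‖ with h | h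
  · have u1 := A12 h
    have u2 := A13 h
    have := B23 (by linarith)
    linarith
  · have hB : c ≤ ‖deriv (deriv (Z m₁)) (I * (y:ℂ)) / (1 - deriv (Z m₁) (I * (y:ℂ)))‖ := by linarith
    have u1 := B12 hB
    have u2 := B13 hB
    have := A23 (by linarith)
    linarith

end Helpers

/-- Lemma 3.9 of the paper: under the Setup there do not exist integers
`m₁, m₂, m₃` with `m₁ ≥ 1`, `m₂ ≥ m₁ + 2`, `M ≥ m₃ ≥ m₂ + 2` such that the exponent `a_m`
in the representation `K_m(z) = R_m(z) exp(i a_m z)` is nonzero for `m = m₁, m₂, m₃`. -/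
theorem statement_16 (M : ℕ) (f : ℂ → ℂ) (hs : Setup M f) :
    ¬ ∃ m₁ m₂ m₃ : ℕ, 1 ≤ m₁ ∧ m₁ + 2 ≤ m₂ ∧ m₂ + 2 ≤ m₃ ∧ m₃ ≤ M ∧
      ∀ m ∈ ({m₁, m₂, m₃} : Set ℕ), ∃ (Km Rm : ℂ → ℂ) (am : ℝ),
        IsKm f m Km ∧ IsRatFn Rm ∧
        MeroEq Km (fun z => Rm z * Complex.exp (Complex.I * (am : ℂ) * z)) ∧ am ≠ 0 := by
  exact final M f hs
end
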